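/- For every ε₀ ∈ (0,1) there exists a constant C > 0 (depending only on ε₀ and on the curve γ) such that the following holds: for every positive integer m which is a sum of two squares and satisfies |τ̂_m(4)| ≤ 1 − ε₀, the number of nodal intersections Z of the arithmetic random wave F with γ satisfies Var(Z) ≤ C · m / N, where N = #{μ ∈ ℤ² : μ₁² + μ₂² = m}. -/

import Mathlib

open MeasureTheory ProbabilityTheory Real

noncomputable section

/-- The set of lattice points on the circle of radius `√m`:
`E = {μ ∈ ℤ² : μ₁² + μ₂² = m}` (all solutions satisfy `|μᵢ| ≤ m`). -/
def latticeSet (m : ℕ) : Finset (ℤ × ℤ) :=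
  (Finset.Icc (-(m : ℤ)) (m : ℤ) ×ˢ Finset.Icc (-(m : ℤ)) (m : ℤ)).filter
    (fun μ => μ.1 ^ 2 + μ.2 ^ 2 = (m : ℤ))

/-- `N = #E`, the number of lattice points on the circle of radius `√m`. -/
def latN (m : ℕ) : ℕ := (latticeSet m).card

/-- The probability space of the arithmetic random wave: `ℝ^E × ℝ^E`. -/
abbrev WaveSpace (m : ℕ) : Type :=
  (↥(latticeSet m) → ℝ) × (↥(latticeSet m) → ℝ)

/-- The Gaussian probability measure of the arithmetic random wave: the product of
standard Gaussian measures on `ℝ^E × ℝ^E`. -/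
def waveMeasure (m : ℕ) : Measure (WaveSpace m) :=
  (Measure.pi fun _ : ↥(latticeSet m) => gaussianReal 0 1).prod
    (Measure.pi fun _ : ↥(latticeSet m) => gaussianReal 0 1)

/-- The arithmetic random wave
`F(x) = N^{-1/2} ∑_{μ ∈ E} (b_μ cos(2π⟨μ,x⟩) + c_μ sin(2π⟨μ,x⟩))`. -/
def wave (m : ℕ) (ω : WaveSpace m) (x : ℝ × ℝ) : ℝ :=
  (Real.sqrt (latN m))⁻¹ *
    ∑ μ : ↥(latticeSet m),
      (ω.1 μ * Real.cos (2 * π * (((μ : ℤ × ℤ).1 : ℝ) * x.1 + ((μ : ℤ × ℤ).2 : ℝ) * x.2)) +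
       ω.2 μ * Real.sin (2 * π * (((μ : ℤ × ℤ).1 : ℝ) * x.1 + ((μ : ℤ × ℤ).2 : ℝ) * x.2)))

/-- The number of nodal intersections of the wave with the curve `γ` on `[0, L]`. -/
def nodalCount (m : ℕ) (γ : ℝ → ℝ × ℝ) (L : ℝ) (ω : WaveSpace m) : ℕ :=
  Set.ncard {t : ℝ | t ∈ Set.Icc 0 L ∧ wave m ω (γ t) = 0}

/-- The fourth Fourier coefficient of the angular measure:
`τ̂_m(4) = (N m²)⁻¹ ∑_{μ ∈ E} (μ₁⁴ − 6 μ₁² μ₂² + μ₂⁴)`. -/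
def tauHat4 (m : ℕ) : ℝ :=
  ((latN m : ℝ) * (m : ℝ) ^ 2)⁻¹ *
    ∑ μ ∈ latticeSet m,
      ((μ.1 : ℝ) ^ 4 - 6 * (μ.1 : ℝ) ^ 2 * (μ.2 : ℝ) ^ 2 + (μ.2 : ℝ) ^ 4)

/-- The standard Gaussian measure on `ι → ℝ`. -/
abbrev stdG (ι : Type*) [Fintype ι] : Measure (ι → ℝ) :=
  Measure.pi fun _ : ι => gaussianReal 0 1

/-- The linear functional with coefficients `c`. -/
def lin {ι : Type*} [Fintype ι] (c ω : ι → ℝ) : ℝ := ∑ i, c i * ω i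

@[fun_prop]
lemma continuous_lin {ι : Type*} [Fintype ι] (c : ι → ℝ) : Continuous (lin c) := by
  unfold lin; fun_prop

@[fun_prop]
lemma measurable_lin {ι : Type*} [Fintype ι] (c : ι → ℝ) : Measurable (lin c) :=
  (continuous_lin c).measurable

lemma integral_exp_lin {ι : Type*} [Fintype ι] (e : ι → ℝ) :
    ∫ ω, Complex.exp ((lin e ω : ℝ) * Complex.I) ∂(stdG ι)
      = Complex.exp (-(((∑ i, e i ^ 2 : ℝ) : ℂ) / 2)) := by
  have h : ∀ ω : ι → ℝ, Complex.exp ((lin e ω : ℝ) * Complex.I)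
      = ∏ i, Complex.exp ((e i : ℂ) * (ω i : ℂ) * Complex.I) := by
    intro ω
    rw [← Complex.exp_sum, lin]
    push_cast
    rw [Finset.sum_mul]
  simp_rw [h]
  rw [integral_fintype_prod_eq_prod (𝕜 := ℂ)
    (fun i (x : ℝ) => Complex.exp ((e i : ℂ) * (x : ℂ) * Complex.I))]
  have h2 : ∀ i, ∫ x : ℝ, Complex.exp ((e i : ℂ) * (x : ℂ) * Complex.I) ∂(gaussianReal 0 1)
      = Complex.exp (-((e i : ℂ) ^ 2 / 2)) := by
    intro i
    have := charFun_gaussianReal (μ := 0) (v := 1) (e i)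
    rw [charFun_apply_real] at this
    rw [this]
    congr 1
    push_cast
    ring
  simp_rw [h2]
  rw [← Complex.exp_sum]
  congr 1
  push_cast
  rw [Finset.sum_neg_distrib, Finset.sum_div]

lemma charFunDual_map_lin {ι κ : Type*} [Fintype ι] [Fintype κ] [DecidableEq κ]
    (c : κ → ι → ℝ) (L : StrongDual ℝ (κ → ℝ)) :
    charFunDual ((stdG ι).map (fun ω k => lin (c k) ω)) L
      = Complex.exp (-(((∑ k, ∑ l, L (Pi.single k 1) * L (Pi.single l 1) *
          ∑ i, c k i * c l i : ℝ) : ℂ) / 2)) := by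
  rw [charFunDual_apply, integral_map (by fun_prop) (by fun_prop)]
  have hL : ∀ ω : ι → ℝ, L (fun k => lin (c k) ω)
      = lin (fun i => ∑ k, L (Pi.single k 1) * c k i) ω := by
    intro ω
    have h0 := LinearMap.pi_apply_eq_sum_univ (L : (κ → ℝ) →ₗ[ℝ] ℝ) (fun k => lin (c k) ω)
    simp only [ContinuousLinearMap.coe_coe, smul_eq_mul] at h0
    rw [h0]
    simp only [lin, Finset.sum_mul]
    rw [Finset.sum_comm]
    refine Finset.sum_congr rfl fun k _ => ?_
    have this (k : κ) : (fun j => if k = j then (1 : ℝ) else 0) = Pi.single k 1 := by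
      ext j; simp [Pi.single_apply, eq_comm]
    refine Finset.sum_congr rfl fun i _ => ?_
    rw [this]; ring
  simp_rw [hL]
  rw [integral_exp_lin]
  congr 4
  have : ∀ i, (∑ k, L (Pi.single k 1) * c k i) ^ 2
      = ∑ k, ∑ l, L (Pi.single k 1) * L (Pi.single l 1) * (c k i * c l i) := by
    intro i
    rw [sq, Finset.sum_mul_sum]
    refine Finset.sum_congr rfl fun k _ => Finset.sum_congr rfl fun l _ => by ring
  simp_rw [this, Finset.mul_sum]
  rw [Finset.sum_comm]
  refine Finset.sum_congr rfl fun k _ => ?_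
  rw [Finset.sum_comm]

/-- The law of finitely many linear functionals under a standard Gaussian measure
only depends on their Gram matrix. -/
lemma map_lin_eq_of_gram {ι ι' κ : Type*} [Fintype ι] [Fintype ι'] [Fintype κ]
    (c : κ → ι → ℝ) (d : κ → ι' → ℝ)
    (h : ∀ k l, ∑ i, c k i * c l i = ∑ i, d k i * d l i) :
    (stdG ι).map (fun ω k => lin (c k) ω) = (stdG ι').map (fun ω k => lin (d k) ω) := by
  classical
  have : IsProbabilityMeasure ((stdG ι).map (fun ω k => lin (c k) ω)) :=
    Measure.isProbabilityMeasure_map (by fun_prop)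
  have : IsProbabilityMeasure ((stdG ι').map (fun ω k => lin (d k) ω)) :=
    Measure.isProbabilityMeasure_map (by fun_prop)
  refine Measure.ext_of_charFunDual ?_
  ext L
  rw [charFunDual_map_lin, charFunDual_map_lin]
  simp_rw [h]

lemma gaussianReal_abs_le (r : ℝ) : gaussianReal 0 1 {x | |x| ≤ r} ≤ ENNReal.ofReal r := by
  rw [gaussianReal_apply _ one_ne_zero]
  have hset : {x : ℝ | |x| ≤ r} = Set.Icc (-r) r := by ext x; simp [abs_le]
  rw [hset]
  have h2 : (2 : ℝ) ≤ √(2 * π) := by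
    apply Real.le_sqrt_of_sq_le
    nlinarith [Real.pi_gt_three]
  calc ∫⁻ x in Set.Icc (-r) r, gaussianPDF 0 1 x
      ≤ ∫⁻ _ in Set.Icc (-r) r, ENNReal.ofReal (1 / 2) := by
        refine lintegral_mono fun x => ?_
        rw [gaussianPDF]
        apply ENNReal.ofReal_le_ofReal
        rw [gaussianPDFReal]
        have h3 : rexp (-(x - 0) ^ 2 / (2 * ((1 : NNReal) : ℝ))) ≤ 1 := by
          apply Real.exp_le_one_iff.2
          have := sq_nonneg (x - 0)
          simp only [NNReal.coe_one]
          linarith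
        have h4 : (√(2 * π * ((1 : NNReal) : ℝ)))⁻¹ ≤ 1 / 2 := by
          simp only [NNReal.coe_one, mul_one, one_div]
          exact inv_anti₀ (by norm_num) h2
        calc _ ≤ (1 / 2 : ℝ) * 1 := by
              apply mul_le_mul h4 h3 (Real.exp_nonneg _) (by norm_num)
          _ = 1 / 2 := by ring
    _ = ENNReal.ofReal (1 / 2) * ENNReal.ofReal (r - -r) := by
        rw [setLIntegral_const, Real.volume_Icc]
    _ = ENNReal.ofReal r := by
        rw [← ENNReal.ofReal_mul (by norm_num)]
        congr 1; ring

lemma stdG_small_ball {ι : Type*} [Fintype ι] (c d : ι → ℝ) {s t : ℝ} (hs : 0 < s) (ht : 0 < t)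
    (hc : ∑ i, c i ^ 2 = s ^ 2) (hd : ∑ i, d i ^ 2 = t ^ 2) (hcd : ∑ i, c i * d i = 0) (x y : ℝ) :
    stdG ι {ω | |lin c ω| ≤ x ∧ |lin d ω| ≤ y}
      ≤ ENNReal.ofReal (x / s) * ENNReal.ofReal (y / t) := by
  have hlaw := map_lin_eq_of_gram (ι := ι) (ι' := Fin 2) (κ := Fin 2) ![c, d]
    ![![s, 0], ![0, t]] (by
      have hdc : ∑ i, d i * c i = 0 := by rw [← hcd]; simp [mul_comm]
      simp only [Fin.forall_fin_two, Fin.sum_univ_two]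
      simp [hcd, hdc]
      simp only [← sq]
      exact ⟨hc, hd⟩)
  set S : Set (Fin 2 → ℝ) := {v | |v 0| ≤ x ∧ |v 1| ≤ y} with hS
  have hSm : MeasurableSet S := by
    have h0 : MeasurableSet {v : Fin 2 → ℝ | |v 0| ≤ x} :=
      (isClosed_le (by fun_prop) (by fun_prop)).measurableSet
    have h1 : MeasurableSet {v : Fin 2 → ℝ | |v 1| ≤ y} :=
      (isClosed_le (by fun_prop) (by fun_prop)).measurableSet
    exact h0.inter h1
  have h1 := congrArg (fun μ => μ S) hlaw
  rw [Measure.map_apply (by fun_prop) hSm, Measure.map_apply (by fun_prop) hSm] at h1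
  have h2 : (fun ω k => lin (![c, d] k) ω) ⁻¹' S = {ω | |lin c ω| ≤ x ∧ |lin d ω| ≤ y} := by
    ext ω; simp [hS]
  rw [← h2, h1]
  have h3 : (fun (ω : Fin 2 → ℝ) k => lin ((![![s, 0], ![0, t]] : Fin 2 → Fin 2 → ℝ) k) ω) ⁻¹' S
      ⊆ Set.univ.pi ![{z | |z| ≤ x / s}, {z | |z| ≤ y / t}] := by
    intro ω hω
    simp only [hS, lin, Fin.sum_univ_two, Set.mem_preimage, Set.mem_ofPred_eq, Matrix.cons_val_zero,
      Matrix.cons_val_one, zero_mul, add_zero, zero_add, abs_mul, abs_of_pos hs, abs_of_pos ht]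
      at hω
    simp only [Set.mem_univ_pi, Fin.forall_fin_two]
    constructor
    · change |ω 0| ≤ x / s
      rw [le_div_iff₀ hs]; linarith [hω.1]
    · change |ω 1| ≤ y / t
      rw [le_div_iff₀ ht]; linarith [hω.2]
  refine (measure_mono h3).trans ?_
  rw [Measure.pi_pi]
  simp only [Fin.prod_univ_two, Matrix.cons_val_zero, Matrix.cons_val_one]
  exact mul_le_mul' (gaussianReal_abs_le _) (gaussianReal_abs_le _)

lemma memLp_lin {ι : Type*} [Fintype ι] (c : ι → ℝ) (p : ENNReal) (hp : p ≠ ⊤) :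
    MemLp (lin c) p (stdG ι) := by
  unfold lin
  refine memLp_finsetSum _ fun i _ => ?_
  refine MemLp.const_mul ?_ _
  have h := memLp_id_gaussianReal' (μ := 0) (v := 1) p hp
  exact h.comp_measurePreserving (measurePreserving_eval (fun _ : ι => gaussianReal 0 1) i)

lemma integral_lin_sq {ι : Type*} [Fintype ι] (c : ι → ℝ) :
    ∫ ω, lin c ω ^ 2 ∂(stdG ι) = ∑ i, c i ^ 2 := by
  have h0 : 0 ≤ ∑ i, c i ^ 2 := Finset.sum_nonneg fun i _ => sq_nonneg _
  have hlaw := map_lin_eq_of_gram (ι := ι) (ι' := Unit) (κ := Unit) (fun _ => c)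
    (fun _ _ => √(∑ i, c i ^ 2)) (by
      intro k l
      simp [Real.mul_self_sqrt h0, ← sq])
  have e1 := integral_map (μ := stdG ι) (φ := fun ω (_ : Unit) => lin c ω) (by fun_prop)
    (f := fun v => v () ^ 2) (by fun_prop : Continuous fun v : Unit → ℝ => v () ^ 2).aestronglyMeasurable
  have e2 := integral_map (μ := stdG Unit)
    (φ := fun ω (_ : Unit) => lin (fun _ => √(∑ i, c i ^ 2)) ω) (by fun_prop)
    (f := fun v => v () ^ 2) (by fun_prop : Continuous fun v : Unit → ℝ => v () ^ 2).aestronglyMeasurable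
  rw [← e1, hlaw, e2]
  simp only [lin, Finset.univ_unique, Finset.sum_singleton, mul_pow, Real.sq_sqrt h0]
  rw [integral_const_mul]
  have h1 : ∫ ω : Unit → ℝ, ω default ^ 2 ∂(stdG Unit) = ∫ x, x ^ 2 ∂(gaussianReal 0 1) := by
    have hmp := measurePreserving_eval (fun _ : Unit => gaussianReal 0 1) ()
    rw [← hmp.map_eq, integral_map (measurable_pi_apply _).aemeasurable
      (by fun_prop : Continuous fun x : ℝ => x ^ 2).aestronglyMeasurable]
  rw [h1]
  have h2 := variance_id_gaussianReal (μ := 0) (v := 1)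
  rw [variance_of_integral_eq_zero (by fun_prop) (by simp)] at h2
  simp only [id] at h2
  rw [h2]; simp

lemma lintegral_lin_sq {ι : Type*} [Fintype ι] (c : ι → ℝ) :
    ∫⁻ ω, ENNReal.ofReal (lin c ω ^ 2) ∂(stdG ι) = ENNReal.ofReal (∑ i, c i ^ 2) := by
  rw [← integral_lin_sq c, ofReal_integral_eq_lintegral_ofReal]
  · exact (memLp_lin c 2 (by simp)).integrable_sq
  · exact Filter.Eventually.of_forall fun ω => sq_nonneg _

/-- The normalised indicator of `(-ε, ε)`. -/
def bump (ε x : ℝ) : ℝ := if |x| < ε then (2 * ε)⁻¹ else 0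

lemma bump_nonneg {ε : ℝ} (hε : 0 < ε) (x : ℝ) : 0 ≤ bump ε x := by
  unfold bump; split_ifs <;> positivity

lemma bump_le {ε : ℝ} (hε : 0 < ε) (x : ℝ) : bump ε x ≤ (2 * ε)⁻¹ := by
  unfold bump; split_ifs
  · exact le_rfl
  · positivity

@[fun_prop]
lemma measurable_bump (ε : ℝ) : Measurable (bump ε) := by
  unfold bump
  exact Measurable.ite (measurableSet_lt (by fun_prop) (by fun_prop)) (by fun_prop) (by fun_prop)

/-- Gaussian smoothing of `f` at scale `a`. -/
def gsmooth (f : ℝ → ℝ) (a m : ℝ) : ℝ := ∫ w, f (m + a * w) ∂(gaussianReal 0 1)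

lemma measurable_gsmooth {f : ℝ → ℝ} (hf : Measurable f) (a : ℝ) : Measurable (gsmooth f a) := by
  have h : StronglyMeasurable (Function.uncurry fun m w : ℝ => f (m + a * w)) := by
    apply Measurable.stronglyMeasurable
    exact hf.comp (by fun_prop)
  exact (StronglyMeasurable.integral_prod_right (ν := gaussianReal 0 1) h).measurable

lemma gsmooth_nonneg {f : ℝ → ℝ} (hf : ∀ x, 0 ≤ f x) (a m : ℝ) : 0 ≤ gsmooth f a m :=
  integral_nonneg fun _ => hf _

lemma gsmooth_one (a m : ℝ) : gsmooth (fun _ => 1) a m = 1 := by simp [gsmooth]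

lemma exp_mul_cosh_sub_one_abs_le {x m v : ℝ} (hv : 1 / 2 ≤ v) (hx : x ^ 2 ≤ v) :
    |rexp (-m ^ 2 / (2 * v)) * cosh (x * m / v) - 1| ≤ m ^ 2 := by
  have hv0 : 0 < v := by linarith
  have hm : m ^ 2 / (2 * v) ≤ m ^ 2 := by
    rw [div_le_iff₀ (by positivity)]
    nlinarith [sq_nonneg m]
  have h1 : 1 - m ^ 2 ≤ rexp (-m ^ 2 / (2 * v)) := by
    have := Real.add_one_le_exp (-m ^ 2 / (2 * v))
    have e : -m ^ 2 / (2 * v) = -(m ^ 2 / (2 * v)) := by ring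
    rw [e] at this ⊢
    linarith
  have h2 := Real.one_le_cosh (x * m / v)
  have h3 : rexp (-m ^ 2 / (2 * v)) * cosh (x * m / v) ≤ 1 := by
    calc rexp (-m ^ 2 / (2 * v)) * cosh (x * m / v)
        ≤ rexp (-m ^ 2 / (2 * v)) * rexp ((x * m / v) ^ 2 / 2) := by
          gcongr; exact Real.cosh_le_exp_half_sq _
      _ = rexp (-m ^ 2 / (2 * v) + (x * m / v) ^ 2 / 2) := by rw [Real.exp_add]
      _ ≤ 1 := by
          apply Real.exp_le_one_iff.2
          have e : -m ^ 2 / (2 * v) + (x * m / v) ^ 2 / 2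
              = -(m ^ 2 * (v - x ^ 2)) / (2 * v ^ 2) := by
            field_simp; ring
          rw [e]
          apply div_nonpos_of_nonpos_of_nonneg
          · have := mul_nonneg (sq_nonneg m) (sub_nonneg.2 hx)
            linarith
          · positivity
  have h4 : rexp (-m ^ 2 / (2 * v)) ≤ rexp (-m ^ 2 / (2 * v)) * cosh (x * m / v) :=
    le_mul_of_one_le_right (Real.exp_nonneg _) h2
  rw [abs_le]
  constructor <;> nlinarith [sq_nonneg m]

lemma gaussianPDFReal_symm_sub_le {x m : ℝ} {v : NNReal} (hv : 1 / 2 ≤ (v : ℝ))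
    (hx : x ^ 2 ≤ v) :
    |(gaussianPDFReal m v x + gaussianPDFReal m v (-x)) / 2 - gaussianPDFReal 0 v x| ≤ m ^ 2 := by
  have hv0 : (0 : ℝ) < v := by linarith
  have e1 : (gaussianPDFReal m v x + gaussianPDFReal m v (-x)) / 2 - gaussianPDFReal 0 v x
      = (√(2 * π * v))⁻¹ * rexp (-x ^ 2 / (2 * v)) *
        (rexp (-m ^ 2 / (2 * v)) * cosh (x * m / v) - 1) := by
    simp only [gaussianPDFReal, sub_zero]
    have a1 : rexp (-(x - m) ^ 2 / (2 * v))
        = rexp (-x ^ 2 / (2 * v)) * rexp (-m ^ 2 / (2 * v)) * rexp (x * m / v) := by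
      rw [← Real.exp_add, ← Real.exp_add]; congr 1; field_simp; ring
    have a2 : rexp (-(-x - m) ^ 2 / (2 * v))
        = rexp (-x ^ 2 / (2 * v)) * rexp (-m ^ 2 / (2 * v)) * rexp (-(x * m / v)) := by
      rw [← Real.exp_add, ← Real.exp_add]; congr 1; field_simp; ring
    rw [a1, a2, Real.cosh_eq]
    ring
  rw [e1, abs_mul, abs_mul, abs_of_nonneg (inv_nonneg.2 (Real.sqrt_nonneg _)), Real.abs_exp]
  have h1 : (√(2 * π * v))⁻¹ ≤ 1 := by
    apply inv_le_one_of_one_le₀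
    rw [Real.one_le_sqrt]
    nlinarith [Real.pi_gt_three]
  have h2 : rexp (-x ^ 2 / (2 * v)) ≤ 1 := by
    apply Real.exp_le_one_iff.2
    apply div_nonpos_of_nonpos_of_nonneg
    · nlinarith [sq_nonneg x]
    · positivity
  have h3 := exp_mul_cosh_sub_one_abs_le (m := m) hv hx
  calc _ ≤ 1 * 1 * m ^ 2 := by gcongr
    _ = m ^ 2 := by ring

lemma gsmooth_bump_eq {a : ℝ} (ha : a ≠ 0) {ε : ℝ} (hε : 0 < ε) (m : ℝ) :
    gsmooth (bump ε) a m
      = (2 * ε)⁻¹ * ∫ x in (-ε)..ε, gaussianPDFReal m (NNReal.mk (a ^ 2) (sq_nonneg a)) x := by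
  have hmap : (gaussianReal 0 1).map (fun w => m + a * w)
      = gaussianReal m (NNReal.mk (a ^ 2) (sq_nonneg a)) := by
    have h1 := gaussianReal_map_const_mul (μ := 0) (v := 1) a
    have h2 := gaussianReal_map_const_add (μ := a * 0) (v := NNReal.mk (a ^ 2) (sq_nonneg a) * 1) m
    rw [← h1, Measure.map_map (by fun_prop) (by fun_prop)] at h2
    simpa [Function.comp_def] using h2
  have hv : NNReal.mk (a ^ 2) (sq_nonneg a) ≠ 0 := by
    intro h
    have h1 := congrArg NNReal.toReal h
    have h2 : a ^ 2 = 0 := by simpa using h1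
    exact ha (by simpa using h2)
  unfold gsmooth
  rw [← integral_map (φ := fun w => m + a * w) (by fun_prop)
    (measurable_bump ε).aestronglyMeasurable, hmap, integral_gaussianReal_eq_integral_smul hv,
    intervalIntegral.integral_of_le (by linarith), integral_Ioc_eq_integral_Ioo,
    ← integral_indicator measurableSet_Ioo, ← integral_const_mul]
  congr 1
  ext x
  by_cases hx : |x| < ε
  · have : x ∈ Set.Ioo (-ε) ε := abs_lt.1 hx
    simp [bump, hx, this, mul_comm]
  · have : x ∉ Set.Ioo (-ε) ε := fun h => hx (abs_lt.2 h)
    simp [bump, hx, this]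

lemma gsmooth_bump_sub_le {a : ℝ} (ha : 1 / 2 ≤ a ^ 2) {ε : ℝ} (hε : 0 < ε) (hε' : ε ≤ 1 / 2)
    (m : ℝ) : |gsmooth (bump ε) a m - gsmooth (bump ε) a 0| ≤ m ^ 2 := by
  have ha0 : a ≠ 0 := by rintro rfl; norm_num at ha
  set v := NNReal.mk (a ^ 2) (sq_nonneg a) with hv
  have hv' : (1 : ℝ) / 2 ≤ v := ha
  have hcont : ∀ m, Continuous (gaussianPDFReal m v) := by
    intro m; unfold gaussianPDFReal; fun_prop
  have hsymm : ∫ x in (-ε)..ε, gaussianPDFReal m v x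
      = ∫ x in (-ε)..ε, (gaussianPDFReal m v x + gaussianPDFReal m v (-x)) / 2 := by
    have h1 := intervalIntegral.integral_comp_neg (a := -ε) (b := ε) (gaussianPDFReal m v)
    rw [neg_neg] at h1
    rw [intervalIntegral.integral_div, intervalIntegral.integral_add
      ((hcont m).intervalIntegrable _ _)
      ((show Continuous fun x => gaussianPDFReal m v (-x) from
        (hcont m).comp continuous_neg).intervalIntegrable _ _), h1]
    ring
  rw [gsmooth_bump_eq ha0 hε, gsmooth_bump_eq ha0 hε, ← hv, hsymm, ← mul_sub,
    ← intervalIntegral.integral_sub]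
  · have h2 := intervalIntegral.norm_integral_le_of_norm_le_const (a := -ε) (b := ε) (C := m ^ 2)
      (f := fun x => (gaussianPDFReal m v x + gaussianPDFReal m v (-x)) / 2
        - gaussianPDFReal 0 v x) (by
        intro x hx
        rw [Set.uIoc_of_le (by linarith)] at hx
        refine gaussianPDFReal_symm_sub_le hv' ?_
        nlinarith [hx.1, hx.2])
    rw [abs_mul, abs_of_pos (by positivity)]
    rw [Real.norm_eq_abs, abs_of_pos (by linarith : (0 : ℝ) < ε - -ε)] at h2
    calc _ ≤ (2 * ε)⁻¹ * (m ^ 2 * (ε - -ε)) := by gcongr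
      _ = m ^ 2 := by field_simp; ring
  · exact (((hcont m).add ((hcont m).comp continuous_neg)).div_const 2).intervalIntegrable _ _
  · exact (hcont 0).intervalIntegrable _ _

lemma gsmooth_bump_zero_le {a : ℝ} (ha : 1 / 2 ≤ a ^ 2) {ε : ℝ} (hε : 0 < ε) :
    gsmooth (bump ε) a 0 ≤ 1 := by
  have ha0 : a ≠ 0 := by rintro rfl; norm_num at ha
  rw [gsmooth_bump_eq ha0 hε]
  set v := NNReal.mk (a ^ 2) (sq_nonneg a) with hv
  have hv' : (1 : ℝ) / 2 ≤ v := ha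
  have h2 := intervalIntegral.norm_integral_le_of_norm_le_const (a := -ε) (b := ε) (C := 1)
      (f := fun x => gaussianPDFReal 0 v x) (by
        intro x _
        rw [Real.norm_eq_abs, abs_of_nonneg (gaussianPDFReal_nonneg _ _ _), gaussianPDFReal]
        have h1 : (√(2 * π * v))⁻¹ ≤ 1 := by
          apply inv_le_one_of_one_le₀
          rw [Real.one_le_sqrt]
          nlinarith [Real.pi_gt_three]
        have h2 : rexp (-(x - 0) ^ 2 / (2 * v)) ≤ 1 := by
          apply Real.exp_le_one_iff.2
          apply div_nonpos_of_nonpos_of_nonneg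
          · nlinarith [sq_nonneg (x - 0)]
          · positivity
        exact mul_le_one₀ h1 (Real.exp_nonneg _) h2)
  rw [Real.norm_eq_abs, abs_of_pos (by linarith : (0 : ℝ) < ε - -ε)] at h2
  calc _ ≤ (2 * ε)⁻¹ * (1 * (ε - -ε)) := by
        gcongr; exact (le_abs_self _).trans h2
    _ = 1 := by field_simp; ring

lemma integrable_abs_add_mul (m a : ℝ) :
    Integrable (fun w : ℝ => |m + a * w|) (gaussianReal 0 1) := by
  have h : MemLp (fun w : ℝ => w) 1 (gaussianReal 0 1) := memLp_id_gaussianReal' 1 (by simp)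
  exact ((integrable_const m).add ((memLp_one_iff_integrable.1 h).const_mul a)).abs

lemma gsmooth_abs_neg (a m : ℝ) : ∫ w, |m - a * w| ∂(gaussianReal 0 1) = gsmooth abs a m := by
  have h := gaussianReal_map_neg (μ := 0) (v := 1)
  rw [neg_zero] at h
  unfold gsmooth
  conv_rhs => rw [← h]
  rw [integral_map (by fun_prop) (by fun_prop)]
  simp [sub_eq_add_neg]

lemma gsmooth_abs_sub_le {a : ℝ} (ha : 1 / 2 ≤ a ^ 2) (m : ℝ) :
    |gsmooth abs a m - gsmooth abs a 0| ≤ 2 * m ^ 2 := by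
  have ha0 : a ≠ 0 := by rintro rfl; norm_num at ha
  have hi : Integrable (fun w : ℝ => |m - a * w|) (gaussianReal 0 1) := by
    simpa [sub_eq_add_neg] using integrable_abs_add_mul m (-a)
  have h12 : Integrable (fun w : ℝ => (|m + a * w| + |m - a * w|) / 2) (gaussianReal 0 1) :=
    ((integrable_abs_add_mul m a).add hi).div_const 2
  have e : gsmooth abs a m - gsmooth abs a 0
      = ∫ w, ((|m + a * w| + |m - a * w|) / 2 - |0 + a * w|) ∂(gaussianReal 0 1) := by
    rw [integral_sub h12 (integrable_abs_add_mul 0 a), integral_div, integral_add (integrable_abs_add_mul m a) hi,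
      gsmooth_abs_neg]
    simp only [gsmooth]
    ring
  have hpt : ∀ w : ℝ, 0 ≤ (|m + a * w| + |m - a * w|) / 2 - |0 + a * w| ∧
      (|m + a * w| + |m - a * w|) / 2 - |0 + a * w|
        ≤ Set.indicator {w | |w| ≤ |m| / |a|} (fun _ => |m|) w := by
    intro w
    rw [zero_add]
    have hmax : (|m + a * w| + |m - a * w|) / 2 = max |m| |a * w| := by
      rcases abs_cases (m + a * w) with ⟨h1, _⟩ | ⟨h1, _⟩ <;>
      rcases abs_cases (m - a * w) with ⟨h2, _⟩ | ⟨h2, _⟩ <;>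
      rcases abs_cases m with ⟨h3, _⟩ | ⟨h3, _⟩ <;>
      rcases abs_cases (a * w) with ⟨h4, _⟩ | ⟨h4, _⟩ <;>
      rcases max_cases |m| |a * w| with ⟨h5, _⟩ | ⟨h5, _⟩ <;> linarith
    rw [hmax]
    constructor
    · linarith [le_max_right |m| |a * w|]
    · by_cases hw : |w| ≤ |m| / |a|
      · rw [Set.indicator_of_mem (by exact hw)]
        rcases max_cases |m| |a * w| with ⟨h5, _⟩ | ⟨h5, _⟩ <;>
          linarith [abs_nonneg m, abs_nonneg (a * w)]
      · rw [Set.indicator_of_notMem (by exact hw)]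
        rw [not_le, div_lt_iff₀ (abs_pos.2 ha0)] at hw
        rw [abs_mul, max_eq_right (by linarith [mul_comm |a| |w|])]
        simp
  have hms : MeasurableSet {w : ℝ | |w| ≤ |m| / |a|} := measurableSet_le (by fun_prop) (by fun_prop)
  rw [e, abs_of_nonneg (integral_nonneg fun w => (hpt w).1)]
  calc _ ≤ ∫ w, Set.indicator {w | |w| ≤ |m| / |a|} (fun _ => |m|) w ∂(gaussianReal 0 1) := by
        apply integral_mono
        · exact h12.sub (integrable_abs_add_mul 0 a)
        · exact (integrable_const _).indicator hms
        · exact fun w => (hpt w).2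
    _ = (gaussianReal 0 1).real {w | |w| ≤ |m| / |a|} * |m| := by
        rw [integral_indicator hms]; simp
    _ ≤ (|m| / |a|) * |m| := by
        gcongr
        exact ENNReal.toReal_le_of_le_ofReal (by positivity) (gaussianReal_abs_le _)
    _ ≤ 2 * m ^ 2 := by
        have h1 : 1 / 2 ≤ |a| := by
          rw [← sq_abs] at ha
          nlinarith [abs_nonneg a]
        rw [div_mul_eq_mul_div, ← sq, sq_abs, div_le_iff₀ (by linarith)]
        nlinarith [sq_nonneg m]

lemma gsmooth_abs_zero_le {a : ℝ} (ha : a ^ 2 ≤ 1) : gsmooth abs a 0 ≤ 1 := by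
  have h : MemLp (fun w : ℝ => w) 2 (gaussianReal 0 1) := memLp_id_gaussianReal' 2 (by simp)
  have h2 := variance_id_gaussianReal (μ := 0) (v := 1)
  rw [variance_of_integral_eq_zero (by fun_prop) (by simp)] at h2
  simp only [id] at h2
  calc gsmooth abs a 0 ≤ ∫ w, (1 + w ^ 2) / 2 ∂(gaussianReal 0 1) := by
        apply integral_mono (integrable_abs_add_mul 0 a)
        · exact ((integrable_const _).add h.integrable_sq).div_const 2
        · intro w
          simp only [zero_add]
          rw [abs_le]
          constructor <;>
          nlinarith [sq_nonneg (a * w - 1), sq_nonneg (a * w + 1),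
            mul_nonneg (sub_nonneg.2 ha) (sq_nonneg w)]
    _ = 1 := by
        rw [integral_div, integral_add (integrable_const _) h.integrable_sq, h2]
        simp

/-- Conditioning formula: if the Gram matrix of `c` is `M Mᵀ + diag (a²)`, the expectation of a
product of functions of the `lin (c k)` is an average of products of Gaussian smoothings. -/
lemma integral_prod_lin {ι κ κ₁ : Type*} [Fintype ι] [Fintype κ] [DecidableEq κ] [Fintype κ₁]
    (c : κ → ι → ℝ) (M : κ → κ₁ → ℝ) (a : κ → ℝ)
    (h : ∀ k l, ∑ i, c k i * c l i = ∑ j, M k j * M l j + if k = l then a k ^ 2 else 0)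
    (f : κ → ℝ → ℝ) (hf : ∀ k, Measurable (f k))
    (hint : Integrable (fun ω => ∏ k, f k (lin (c k) ω)) (stdG ι)) :
    ∫ ω, ∏ k, f k (lin (c k) ω) ∂(stdG ι)
      = ∫ v, ∏ k, gsmooth (f k) (a k) (lin (M k) v) ∂(stdG κ₁) := by
  set d : κ → κ₁ ⊕ κ → ℝ := fun k => Sum.elim (M k) (Pi.single k (a k)) with hd
  have hlaw := map_lin_eq_of_gram c d (by
    intro k l
    rw [h, Fintype.sum_sum_type]
    congr 1
    simp only [hd, Sum.elim_inr, Pi.single_apply]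
    by_cases hkl : k = l
    · subst hkl
      simp [sq]
    · rw [if_neg hkl, Finset.sum_eq_zero]
      intro x _
      by_cases h1 : x = k
      · simp [h1, hkl]
      · simp [h1])
  have hG : Measurable (fun x : κ → ℝ => ∏ k, f k (x k)) :=
    Finset.measurable_prod _ fun k _ => (hf k).comp (measurable_pi_apply k)
  have hdm : Measurable (fun (w : κ₁ ⊕ κ → ℝ) k => lin (d k) w) := by fun_prop
  have hcm : Measurable (fun (w : ι → ℝ) k => lin (c k) w) := by fun_prop
  have e1 : ∫ ω, ∏ k, f k (lin (c k) ω) ∂(stdG ι)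
      = ∫ x, ∏ k, f k (x k) ∂((stdG ι).map (fun ω k => lin (c k) ω)) := by
    rw [integral_map hcm.aemeasurable hG.aestronglyMeasurable]
  have hint1 : Integrable (fun x : κ → ℝ => ∏ k, f k (x k))
      ((stdG ι).map (fun ω k => lin (c k) ω)) := by
    rw [integrable_map_measure hG.aestronglyMeasurable hcm.aemeasurable]
    exact hint
  have hmp := measurePreserving_sumPiEquivProdPi (X := fun _ : κ₁ ⊕ κ => ℝ)
    (fun _ : κ₁ ⊕ κ => gaussianReal 0 1)
  have hlin : ∀ (w : κ₁ ⊕ κ → ℝ) k, lin (d k) w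
      = lin (M k) (fun j => w (Sum.inl j)) + a k * w (Sum.inr k) := by
    intro w k
    simp [lin, hd, Fintype.sum_sum_type, Pi.single_apply]
  have hFm : Measurable (fun p : (κ₁ → ℝ) × (κ → ℝ) =>
      ∏ k, f k (lin (M k) p.1 + a k * p.2 k)) :=
    Finset.measurable_prod _ fun k _ => (hf k).comp (by fun_prop)
  rw [hlaw] at e1 hint1
  rw [integrable_map_measure hG.aestronglyMeasurable hdm.aemeasurable] at hint1
  rw [e1, integral_map hdm.aemeasurable hG.aestronglyMeasurable]
  simp_rw [hlin]
  have e2 := hmp.integral_comp (MeasurableEquiv.measurableEmbedding _)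
    (fun p : (κ₁ → ℝ) × (κ → ℝ) => ∏ k, f k (lin (M k) p.1 + a k * p.2 k))
  have hint2 := (hmp.integrable_comp_emb (MeasurableEquiv.measurableEmbedding _)
    (g := fun p : (κ₁ → ℝ) × (κ → ℝ) => ∏ k, f k (lin (M k) p.1 + a k * p.2 k))).1 (by
      convert hint1 using 1
      ext w
      simp only [Function.comp, hlin]
      rfl)
  refine Eq.trans ?_ (e2.trans ?_)
  · rfl
  rw [integral_prod _ hint2]
  congr 1
  ext v
  exact integral_fintype_prod_eq_prod (𝕜 := ℝ) (fun k (w : ℝ) => f k (lin (M k) v + a k * w))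

lemma integrable_coord_pow {κ : Type*} [Fintype κ] (j : κ) (n : ℕ) :
    Integrable (fun v : κ → ℝ => v j ^ (2 * n)) (stdG κ) := by
  classical
  have h := (memLp_lin (Pi.single j (1 : ℝ)) ((2 * n : ℕ) : ENNReal)
    (ENNReal.natCast_ne_top _)).integrable_norm_pow'
  refine h.congr (Filter.Eventually.of_forall fun v => ?_)
  simp only [lin, Pi.single_apply, ite_mul, one_mul, zero_mul, Finset.sum_ite_eq',
    Finset.mem_univ, if_true, Real.norm_eq_abs, pow_mul, sq_abs]

/-- The Kac integrand. -/
def kac (ε x y : ℝ) : ℝ := bump ε x * |y|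

/-- The dominating polynomial in the covariance estimate. -/
def domQ (v : Fin 4 → ℝ) : ℝ := ∑ j, (v j ^ (2 * 1) + 4 * v j ^ (2 * 2))

/-- A dominating polynomial for `domQ ^ 2`. -/
def domQ2 (v : Fin 4 → ℝ) : ℝ := ∑ j, (8 * v j ^ (2 * 2) + 128 * v j ^ (2 * 4))

lemma integrable_domQ : Integrable domQ (stdG (Fin 4)) := by
  refine integrable_finsetSum _ fun j _ => ?_
  exact (integrable_coord_pow j 1).add ((integrable_coord_pow j 2).const_mul 4)

lemma integrable_domQ2 : Integrable domQ2 (stdG (Fin 4)) := by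
  refine integrable_finsetSum _ fun j _ => ?_
  exact ((integrable_coord_pow j 2).const_mul 8).add ((integrable_coord_pow j 4).const_mul 128)

lemma domQ_nonneg (v : Fin 4 → ℝ) : 0 ≤ domQ v :=
  Finset.sum_nonneg fun j _ => by
    have h1 := pow_mul (v j) 2 1
    have h2 := pow_mul (v j) 2 2
    rw [h1, h2]; positivity

lemma domQ2_nonneg (v : Fin 4 → ℝ) : 0 ≤ domQ2 v :=
  Finset.sum_nonneg fun j _ => by
    have h1 := pow_mul (v j) 2 4
    have h2 := pow_mul (v j) 2 2
    rw [h1, h2]; positivity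

lemma domQ_sq_le (v : Fin 4 → ℝ) : domQ v ^ 2 ≤ domQ2 v := by
  unfold domQ domQ2
  have h := sq_sum_le_card_mul_sum_sq (s := Finset.univ)
    (f := fun j : Fin 4 => v j ^ (2 * 1) + 4 * v j ^ (2 * 2))
  refine h.trans ?_
  rw [Finset.mul_sum]
  refine Finset.sum_le_sum fun j _ => ?_
  simp only [Finset.card_univ, Fintype.card_fin]
  have := sq_nonneg (v j ^ 2 - 4 * v j ^ 4)
  push_cast
  nlinarith

/-- The absolute constant in the covariance estimate. -/
def covC : ℝ := 36 * (∫ v, domQ2 v ∂(stdG (Fin 4)) + (∫ v, domQ v ∂(stdG (Fin 4))) ^ 2)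

lemma exists_factor (r : ℝ) : ∃ α β : ℝ, α ^ 2 = |r| ∧ β ^ 2 = |r| ∧ α * β = r := by
  rcases le_total 0 r with h | h
  · refine ⟨√r, √r, ?_, ?_, ?_⟩
    · rw [Real.sq_sqrt h, abs_of_nonneg h]
    · rw [Real.sq_sqrt h, abs_of_nonneg h]
    · exact Real.mul_self_sqrt h
  · refine ⟨√(-r), -√(-r), ?_, ?_, ?_⟩
    · rw [Real.sq_sqrt (by linarith), abs_of_nonpos h]
    · rw [neg_sq, Real.sq_sqrt (by linarith), abs_of_nonpos h]
    · rw [mul_neg, Real.mul_self_sqrt (by linarith)]; ring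

lemma abs_gsmooth_kac_sub_le {a b ε ρ : ℝ} (ha : 1 / 2 ≤ a ^ 2) (hb : 1 / 2 ≤ b ^ 2)
    (hb1 : b ^ 2 ≤ 1) (hε : 0 < ε) (hε' : ε ≤ 1 / 2) (hρ : 0 ≤ ρ) (hρ' : ρ ≤ 1 / 4)
    {m n : ℝ} (v : Fin 4 → ℝ) (hm : m ^ 2 ≤ 2 * ρ * ∑ j, v j ^ 2)
    (hn : n ^ 2 ≤ 2 * ρ * ∑ j, v j ^ 2) :
    |gsmooth (bump ε) a m * gsmooth abs b n - gsmooth (bump ε) a 0 * gsmooth abs b 0|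
      ≤ 6 * ρ * domQ v := by
  set S := ∑ j, v j ^ 2 with hS
  have hS0 : 0 ≤ S := Finset.sum_nonneg fun j _ => sq_nonneg _
  have hQ : S + S ^ 2 ≤ domQ v := by
    have h := sq_sum_le_card_mul_sum_sq (s := Finset.univ) (f := fun j : Fin 4 => v j ^ 2)
    unfold domQ
    rw [Finset.sum_add_distrib, ← Finset.mul_sum]
    simp only [mul_one]
    simp only [Finset.card_univ, Fintype.card_fin, ← pow_mul] at h
    push_cast at h
    linarith
  have h1 := gsmooth_bump_sub_le ha hε hε' m
  have h2 := gsmooth_abs_sub_le hb n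
  have h3 := gsmooth_bump_zero_le ha hε
  have h4 := gsmooth_abs_zero_le hb1
  have h5 := gsmooth_nonneg (bump_nonneg hε) a 0
  have h6 := gsmooth_nonneg abs_nonneg b 0
  set p := gsmooth (bump ε) a m
  set p0 := gsmooth (bump ε) a 0
  set q := gsmooth abs b n
  set q0 := gsmooth abs b 0
  have h7 : |q| ≤ 1 + 2 * n ^ 2 := by
    rw [abs_le] at h2 ⊢
    constructor <;> linarith
  calc |p * q - p0 * q0| = |(p - p0) * q + p0 * (q - q0)| := by ring_nf
    _ ≤ |p - p0| * |q| + |p0| * |q - q0| := by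
        rw [← abs_mul, ← abs_mul]; exact abs_add_le _ _
    _ ≤ m ^ 2 * (1 + 2 * n ^ 2) + 1 * (2 * n ^ 2) := by
        rw [abs_of_nonneg h5]; gcongr
    _ ≤ (2 * ρ * S) * (1 + 2 * (2 * ρ * S)) + 1 * (2 * (2 * ρ * S)) := by gcongr
    _ = 6 * ρ * S + (8 * ρ) * (ρ * S ^ 2) := by ring
    _ ≤ 6 * ρ * S + 2 * (ρ * S ^ 2) := by
        gcongr; linarith
    _ ≤ 6 * ρ * (S + S ^ 2) := by nlinarith [mul_nonneg hρ (sq_nonneg S)]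
    _ ≤ 6 * ρ * domQ v := by gcongr

/-- Covariance of Kac integrands at two weakly correlated points. -/
lemma kac_cov_le {ι : Type*} [Fintype ι] (c : Fin 4 → ι → ℝ) {ρ ε : ℝ} (R : Fin 2 → Fin 2 → ℝ)
    (hρ : 0 ≤ ρ) (hρ' : ρ ≤ 1 / 4) (hε : 0 < ε) (hε' : ε ≤ 1 / 2)
    (h00 : ∑ i, c 0 i * c 0 i = 1) (h11 : ∑ i, c 1 i * c 1 i = 1) (h01 : ∑ i, c 0 i * c 1 i = 0)
    (h22 : ∑ i, c 2 i * c 2 i = 1) (h33 : ∑ i, c 3 i * c 3 i = 1) (h23 : ∑ i, c 2 i * c 3 i = 0)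
    (h02 : ∑ i, c 0 i * c 2 i = R 0 0) (h03 : ∑ i, c 0 i * c 3 i = R 0 1)
    (h12 : ∑ i, c 1 i * c 2 i = R 1 0) (h13 : ∑ i, c 1 i * c 3 i = R 1 1)
    (hR : ∀ a b, |R a b| ≤ ρ) :
    |∫ ω, kac ε (lin (c 0) ω) (lin (c 1) ω) * kac ε (lin (c 2) ω) (lin (c 3) ω) ∂(stdG ι)
      - (∫ ω, kac ε (lin (c 0) ω) (lin (c 1) ω) ∂(stdG ι))
        * ∫ ω, kac ε (lin (c 2) ω) (lin (c 3) ω) ∂(stdG ι)| ≤ covC * ρ ^ 2 := by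
  choose α β hα hβ hαβ using fun a b => exists_factor (R a b)
  set M : Fin 4 → Fin 4 → ℝ := ![![α 0 0, α 0 1, 0, 0], ![0, 0, α 1 0, α 1 1],
    ![β 0 0, 0, β 1 0, 0], ![0, β 0 1, 0, β 1 1]] with hM
  set A : Fin 4 → ℝ := ![1 - |R 0 0| - |R 0 1|, 1 - |R 1 0| - |R 1 1|,
    1 - |R 0 0| - |R 1 0|, 1 - |R 0 1| - |R 1 1|] with hA
  have hA1 : ∀ k, 1 / 2 ≤ A k ∧ A k ≤ 1 := by
    have g00 := hR 0 0
    have g01 := hR 0 1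
    have g10 := hR 1 0
    have g11 := hR 1 1
    have p00 := abs_nonneg (R 0 0)
    have p01 := abs_nonneg (R 0 1)
    have p10 := abs_nonneg (R 1 0)
    have p11 := abs_nonneg (R 1 1)
    intro k
    fin_cases k <;> simp [hA] <;> constructor <;> linarith
  set a : Fin 4 → ℝ := fun k => √(A k) with ha
  have ha2 : ∀ k, a k ^ 2 = A k := fun k => Real.sq_sqrt (by linarith [(hA1 k).1])
  have hgram : ∀ k l, ∑ i, c k i * c l i
      = ∑ j, M k j * M l j + if k = l then a k ^ 2 else 0 := by
    have hsymm : ∀ k l, ∑ i, c k i * c l i = ∑ i, c l i * c k i := fun k l =>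
      Finset.sum_congr rfl fun i _ => mul_comm _ _
    intro k l
    rw [ha2]
    fin_cases k <;> fin_cases l <;>
      simp [hM, hA, Fin.sum_univ_four, h00, h11, h01, h22, h33, h23, h02, h03, h12, h13,
        hsymm 1 0, hsymm 2 0, hsymm 3 0, hsymm 2 1, hsymm 3 1, hsymm 3 2] <;>
      linarith [hα 0 0, hα 0 1, hα 1 0, hα 1 1, hβ 0 0, hβ 0 1, hβ 1 0, hβ 1 1,
        hαβ 0 0, hαβ 0 1, hαβ 1 0, hαβ 1 1]
  have hmb : ∀ k v, lin (M k) v ^ 2 ≤ 2 * ρ * ∑ j, v j ^ 2 := by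
    have haux : ∀ {x y s t S : ℝ}, x ^ 2 ≤ ρ → y ^ 2 ≤ ρ → s ^ 2 + t ^ 2 ≤ S →
        (x * s + y * t) ^ 2 ≤ 2 * ρ * S := by
      intro x y s t S hx hy hS
      calc (x * s + y * t) ^ 2 ≤ (x ^ 2 + y ^ 2) * (s ^ 2 + t ^ 2) := by
            nlinarith [sq_nonneg (x * t - y * s)]
        _ ≤ (ρ + ρ) * S := by gcongr
        _ = 2 * ρ * S := by ring
    have hα' : ∀ a b, α a b ^ 2 ≤ ρ := fun a b => (hα a b).trans_le (hR a b)
    have hβ' : ∀ a b, β a b ^ 2 ≤ ρ := fun a b => (hβ a b).trans_le (hR a b)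
    intro k v
    have hv : ∀ j, 0 ≤ v j ^ 2 := fun j => sq_nonneg _
    have e0 := hv 0
    have e1 := hv 1
    have e2 := hv 2
    have e3 := hv 3
    rw [Fin.sum_univ_four]
    fin_cases k
    · simp only [lin, hM, Fin.sum_univ_four]
      simpa using haux (hα' 0 0) (hα' 0 1) (show v 0 ^ 2 + v 1 ^ 2 ≤ _ by linarith)
    · simp only [lin, hM, Fin.sum_univ_four]
      simpa using haux (hα' 1 0) (hα' 1 1) (show v 2 ^ 2 + v 3 ^ 2 ≤ _ by linarith)
    · simp only [lin, hM, Fin.sum_univ_four]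
      simpa using haux (hβ' 0 0) (hβ' 1 0) (show v 0 ^ 2 + v 2 ^ 2 ≤ _ by linarith)
    · simp only [lin, hM, Fin.sum_univ_four]
      simpa using haux (hβ' 0 1) (hβ' 1 1) (show v 1 ^ 2 + v 3 ^ 2 ≤ _ by linarith)
  have hb0 : ∀ x, |bump ε x| ≤ (2 * ε)⁻¹ := fun x => by
    rw [abs_of_nonneg (bump_nonneg hε x)]; exact bump_le hε x
  have hlin2 : ∀ k, Integrable (fun ω => lin (c k) ω ^ 2) (stdG ι) := fun k =>
    (memLp_lin (c k) 2 (by simp)).integrable_sq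
  have hlin1 : ∀ k, Integrable (fun ω => |lin (c k) ω|) (stdG ι) := fun k =>
    (memLp_one_iff_integrable.1 (memLp_lin (c k) 1 (by simp))).abs
  have int12 : Integrable (fun ω => kac ε (lin (c 0) ω) (lin (c 1) ω)
      * kac ε (lin (c 2) ω) (lin (c 3) ω)) (stdG ι) := by
    refine Integrable.mono' (((hlin2 1).add (hlin2 3)).const_mul ((2 * ε)⁻¹ * (2 * ε)⁻¹))
      (by unfold kac; fun_prop) (Filter.Eventually.of_forall fun ω => ?_)
    simp only [kac, Real.norm_eq_abs, abs_mul, abs_abs, Pi.add_apply]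
    calc _ = |bump ε (lin (c 0) ω)| * |bump ε (lin (c 2) ω)|
          * (|lin (c 1) ω| * |lin (c 3) ω|) := by ring
      _ ≤ (2 * ε)⁻¹ * (2 * ε)⁻¹ * (lin (c 1) ω ^ 2 + lin (c 3) ω ^ 2) := by
          gcongr
          · exact hb0 _
          · exact hb0 _
          · rw [← sq_abs (lin (c 1) ω), ← sq_abs (lin (c 3) ω)]
            nlinarith [sq_nonneg (|lin (c 1) ω| - |lin (c 3) ω|), sq_nonneg (|lin (c 1) ω|),
              sq_nonneg (|lin (c 3) ω|)]
  have int1 : ∀ k l, Integrable (fun ω => kac ε (lin (c k) ω) (lin (c l) ω)) (stdG ι) := by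
    intro k l
    refine Integrable.mono' ((hlin1 l).const_mul ((2 * ε)⁻¹))
      (by unfold kac; fun_prop) (Filter.Eventually.of_forall fun ω => ?_)
    simp only [kac, Real.norm_eq_abs, abs_mul, abs_abs]
    gcongr
    exact hb0 _
  set h1 : (Fin 4 → ℝ) → ℝ := fun v =>
    gsmooth (bump ε) (a 0) (lin (M 0) v) * gsmooth abs (a 1) (lin (M 1) v) with hh1
  set h2 : (Fin 4 → ℝ) → ℝ := fun v =>
    gsmooth (bump ε) (a 2) (lin (M 2) v) * gsmooth abs (a 3) (lin (M 3) v) with hh2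
  have E12 : ∫ ω, kac ε (lin (c 0) ω) (lin (c 1) ω) * kac ε (lin (c 2) ω) (lin (c 3) ω)
      ∂(stdG ι) = ∫ v, h1 v * h2 v ∂(stdG (Fin 4)) := by
    have key := integral_prod_lin c M a hgram ![bump ε, abs, bump ε, abs] (by
      intro k; fin_cases k <;> simp <;> fun_prop) (by
      refine int12.congr (Filter.Eventually.of_forall fun ω => ?_)
      simp [Fin.prod_univ_four, kac, mul_assoc])
    simp only [Fin.prod_univ_four] at key
    simpa [kac, hh1, hh2, mul_assoc] using key
  have E1 : ∫ ω, kac ε (lin (c 0) ω) (lin (c 1) ω) ∂(stdG ι) = ∫ v, h1 v ∂(stdG (Fin 4)) := by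
    have key := integral_prod_lin c M a hgram ![bump ε, abs, fun _ => 1, fun _ => 1] (by
      intro k; fin_cases k <;> simp <;> fun_prop) (by
      refine (int1 0 1).congr (Filter.Eventually.of_forall fun ω => ?_)
      simp [Fin.prod_univ_four, kac])
    simp only [Fin.prod_univ_four] at key
    simpa [kac, hh1, gsmooth_one] using key
  have E2 : ∫ ω, kac ε (lin (c 2) ω) (lin (c 3) ω) ∂(stdG ι) = ∫ v, h2 v ∂(stdG (Fin 4)) := by
    have key := integral_prod_lin c M a hgram ![fun _ => 1, fun _ => 1, bump ε, abs] (by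
      intro k; fin_cases k <;> simp <;> fun_prop) (by
      refine (int1 2 3).congr (Filter.Eventually.of_forall fun ω => ?_)
      simp [Fin.prod_univ_four, kac])
    simp only [Fin.prod_univ_four] at key
    simpa [kac, hh2, gsmooth_one] using key
  rw [E12, E1, E2]
  set p1 : ℝ := gsmooth (bump ε) (a 0) 0 * gsmooth abs (a 1) 0
  set p2 : ℝ := gsmooth (bump ε) (a 2) 0 * gsmooth abs (a 3) 0
  have hAa : ∀ k, 1 / 2 ≤ a k ^ 2 ∧ a k ^ 2 ≤ 1 := fun k => by rw [ha2]; exact hA1 k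
  have D1 : ∀ v, |h1 v - p1| ≤ 6 * ρ * domQ v := fun v =>
    abs_gsmooth_kac_sub_le (hAa 0).1 (hAa 1).1 (hAa 1).2 hε hε' hρ hρ' v (hmb 0 v) (hmb 1 v)
  have D2 : ∀ v, |h2 v - p2| ≤ 6 * ρ * domQ v := fun v =>
    abs_gsmooth_kac_sub_le (hAa 2).1 (hAa 3).1 (hAa 3).2 hε hε' hρ hρ' v (hmb 2 v) (hmb 3 v)
  have hm1 : Measurable h1 := ((measurable_gsmooth (measurable_bump ε) _).comp
    (measurable_lin _)).mul ((measurable_gsmooth (by fun_prop) _).comp (measurable_lin _))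
  have hm2 : Measurable h2 := ((measurable_gsmooth (measurable_bump ε) _).comp
    (measurable_lin _)).mul ((measurable_gsmooth (by fun_prop) _).comp (measurable_lin _))
  have i1 : Integrable (fun v => h1 v - p1) (stdG (Fin 4)) :=
    Integrable.mono' (integrable_domQ.const_mul (6 * ρ)) (hm1.sub_const _).aestronglyMeasurable
      (Filter.Eventually.of_forall D1)
  have i2 : Integrable (fun v => h2 v - p2) (stdG (Fin 4)) :=
    Integrable.mono' (integrable_domQ.const_mul (6 * ρ)) (hm2.sub_const _).aestronglyMeasurable
      (Filter.Eventually.of_forall D2)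
  have D12 : ∀ v, |(h1 v - p1) * (h2 v - p2)| ≤ 36 * ρ ^ 2 * domQ2 v := fun v => by
    rw [abs_mul]
    have hq := domQ_nonneg v
    calc _ ≤ (6 * ρ * domQ v) * (6 * ρ * domQ v) := by
          gcongr
          · exact D1 v
          · exact D2 v
      _ = 36 * ρ ^ 2 * domQ v ^ 2 := by ring
      _ ≤ _ := by gcongr; exact domQ_sq_le v
  have i12 : Integrable (fun v => (h1 v - p1) * (h2 v - p2)) (stdG (Fin 4)) :=
    Integrable.mono' (integrable_domQ2.const_mul (36 * ρ ^ 2))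
      ((hm1.sub_const _).mul (hm2.sub_const _)).aestronglyMeasurable
      (Filter.Eventually.of_forall D12)
  have eq1 : ∫ v, h1 v ∂(stdG (Fin 4)) = ∫ v, (h1 v - p1) ∂(stdG (Fin 4)) + p1 := by
    have : ∫ v, ((h1 v - p1) + p1) ∂(stdG (Fin 4)) = _ := integral_add i1 (integrable_const p1)
    simpa using this
  have eq2 : ∫ v, h2 v ∂(stdG (Fin 4)) = ∫ v, (h2 v - p2) ∂(stdG (Fin 4)) + p2 := by
    have : ∫ v, ((h2 v - p2) + p2) ∂(stdG (Fin 4)) = _ := integral_add i2 (integrable_const p2)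
    simpa using this
  have eq12 : ∫ v, h1 v * h2 v ∂(stdG (Fin 4)) = ∫ v, (h1 v - p1) * (h2 v - p2) ∂(stdG (Fin 4))
      + p1 * ∫ v, (h2 v - p2) ∂(stdG (Fin 4)) + p2 * ∫ v, (h1 v - p1) ∂(stdG (Fin 4))
      + p1 * p2 := by
    have j1 : Integrable (fun v => (h1 v - p1) * (h2 v - p2) + p1 * (h2 v - p2))
      (stdG (Fin 4)) := i12.add (i2.const_mul p1)
    have j2 : Integrable (fun v => (h1 v - p1) * (h2 v - p2) + p1 * (h2 v - p2)
      + p2 * (h1 v - p1)) (stdG (Fin 4)) := j1.add (i1.const_mul p2)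
    have : ∫ v, (((h1 v - p1) * (h2 v - p2) + p1 * (h2 v - p2)) + p2 * (h1 v - p1) + p1 * p2)
        ∂(stdG (Fin 4)) = _ := integral_add j2 (integrable_const (p1 * p2))
    rw [integral_add j1 (i1.const_mul p2), integral_add i12 (i2.const_mul p1),
      integral_const_mul, integral_const_mul] at this
    simp only [integral_const, probReal_univ, one_smul] at this
    rw [← this]
    congr 1
    ext v
    ring
  have eqc : ∫ v, h1 v * h2 v ∂(stdG (Fin 4))
      - (∫ v, h1 v ∂(stdG (Fin 4))) * ∫ v, h2 v ∂(stdG (Fin 4))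
      = ∫ v, (h1 v - p1) * (h2 v - p2) ∂(stdG (Fin 4))
        - (∫ v, (h1 v - p1) ∂(stdG (Fin 4))) * ∫ v, (h2 v - p2) ∂(stdG (Fin 4)) := by
    rw [eq1, eq2, eq12]; ring
  rw [eqc]
  have B12 : |∫ v, (h1 v - p1) * (h2 v - p2) ∂(stdG (Fin 4))|
      ≤ 36 * ρ ^ 2 * ∫ v, domQ2 v ∂(stdG (Fin 4)) := by
    rw [← integral_const_mul]
    exact norm_integral_le_of_norm_le (f := fun v => (h1 v - p1) * (h2 v - p2))
      (integrable_domQ2.const_mul _) (Filter.Eventually.of_forall D12)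
  have B1 : |∫ v, (h1 v - p1) ∂(stdG (Fin 4))| ≤ 6 * ρ * ∫ v, domQ v ∂(stdG (Fin 4)) := by
    rw [← integral_const_mul]
    exact norm_integral_le_of_norm_le (f := fun v => h1 v - p1)
      (integrable_domQ.const_mul _) (Filter.Eventually.of_forall D1)
  have B2 : |∫ v, (h2 v - p2) ∂(stdG (Fin 4))| ≤ 6 * ρ * ∫ v, domQ v ∂(stdG (Fin 4)) := by
    rw [← integral_const_mul]
    exact norm_integral_le_of_norm_le (f := fun v => h2 v - p2)
      (integrable_domQ.const_mul _) (Filter.Eventually.of_forall D2)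
  have hQ0 : 0 ≤ ∫ v, domQ v ∂(stdG (Fin 4)) := integral_nonneg domQ_nonneg
  refine (abs_sub _ _).trans ?_
  rw [abs_mul]
  unfold covC
  calc _ ≤ 36 * ρ ^ 2 * ∫ v, domQ2 v ∂(stdG (Fin 4)) + (6 * ρ * ∫ v, domQ v ∂(stdG (Fin 4)))
        * (6 * ρ * ∫ v, domQ v ∂(stdG (Fin 4))) := by gcongr
    _ = _ := by ring

lemma lintegral_bump {ε : ℝ} (hε : 0 < ε) : ∫⁻ x, ENNReal.ofReal (bump ε x) = 1 := by
  have h : ∀ x, ENNReal.ofReal (bump ε x)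
      = Set.indicator (Set.Ioo (-ε) ε) (fun _ => ENNReal.ofReal (2 * ε)⁻¹) x := by
    intro x
    by_cases hx : |x| < ε
    · simp [bump, hx, (abs_lt.1 hx : -ε < x ∧ x < ε)]
    · have : x ∉ Set.Ioo (-ε) ε := fun h => hx (abs_lt.2 h)
      simp [bump, hx, this]
  simp_rw [h]
  rw [lintegral_indicator measurableSet_Ioo, setLIntegral_const, Real.volume_Ioo,
    ← ENNReal.ofReal_mul (by positivity), show (2 * ε)⁻¹ * (ε - -ε) = 1 by field_simp; ring]
  simp

lemma bump_abs_intervalIntegrable {f f' : ℝ → ℝ} (hf : Continuous f) (hc : Continuous f')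
    {ε : ℝ} (hε : 0 < ε) (a b : ℝ) :
    IntervalIntegrable (fun t => bump ε (f t) * |f' t|) volume a b := by
  refine IntervalIntegrable.mono_fun' (g := fun t => (2 * ε)⁻¹ * |f' t|)
    (by apply Continuous.intervalIntegrable; fun_prop)
    (Measurable.aestronglyMeasurable (by
      have := hf.measurable; have := hc.measurable; fun_prop)) ?_
  refine Filter.Eventually.of_forall fun t => ?_
  simp only [Real.norm_eq_abs, abs_mul, abs_abs, abs_of_nonneg (bump_nonneg hε _)]
  gcongr
  exact bump_le hε _

lemma integral_bump_abs_nonneg (f f' : ℝ → ℝ) {ε : ℝ} (hε : 0 < ε) {a b : ℝ} (hab : a ≤ b) :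
    0 ≤ ∫ t in a..b, bump ε (f t) * |f' t| :=
  intervalIntegral.integral_nonneg hab fun _ _ => mul_nonneg (bump_nonneg hε _) (abs_nonneg _)

lemma integral_bump_abs_le_one {f f' : ℝ → ℝ} (hf : ∀ t, HasDerivAt f (f' t) t)
    (hc : Continuous f') {ε : ℝ} (hε : 0 < ε) {a b : ℝ} (hab : a ≤ b)
    (h0 : ∀ t ∈ Set.Ioo a b, f' t ≠ 0) :
    ∫ t in a..b, bump ε (f t) * |f' t| ≤ 1 := by
  have hfc : Continuous f := continuous_iff_continuousAt.2 fun t => (hf t).continuousAt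
  have hinj : Set.InjOn f (Set.Ioo a b) := by
    have key : ∀ x ∈ Set.Ioo a b, ∀ y ∈ Set.Ioo a b, x < y → f x ≠ f y := by
      intro x hx y hy hxy h
      obtain ⟨c, hc1, hc2⟩ := exists_hasDerivAt_eq_zero hxy hfc.continuousOn h
        (fun t _ => hf t)
      exact h0 c ⟨hx.1.trans hc1.1, hc1.2.trans hy.2⟩ hc2
    intro x hx y hy h
    rcases lt_trichotomy x y with h1 | h1 | h1
    · exact absurd h (key x hx y hy h1)
    · exact h1
    · exact absurd h.symm (key y hy x hx h1)
  have hl := lintegral_image_eq_lintegral_abs_deriv_mul (s := Set.Ioo a b) measurableSet_Ioo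
    (fun x _ => (hf x).hasDerivWithinAt) hinj (fun y => ENNReal.ofReal (bump ε y))
  rw [intervalIntegral.integral_of_le hab, integral_Ioc_eq_integral_Ioo,
    integral_eq_lintegral_of_nonneg_ae
      (Filter.Eventually.of_forall fun t => mul_nonneg (bump_nonneg hε _) (abs_nonneg _))
      (Measurable.aestronglyMeasurable (by
      have := hfc.measurable; have := hc.measurable; fun_prop))]
  have h1 : ∫⁻ t in Set.Ioo a b, ENNReal.ofReal (bump ε (f t) * |f' t|) ≤ 1 := by
    calc _ = ∫⁻ t in Set.Ioo a b, ENNReal.ofReal |f' t| * ENNReal.ofReal (bump ε (f t)) := by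
          refine lintegral_congr fun t => ?_
          rw [mul_comm, ENNReal.ofReal_mul (abs_nonneg _)]
      _ = _ := hl.symm
      _ ≤ ∫⁻ y, ENNReal.ofReal (bump ε y) := setLIntegral_le_lintegral _ _
      _ = 1 := lintegral_bump hε
  exact ENNReal.toReal_le_of_le_ofReal zero_le_one (by simpa using h1)

/-- The smoothed number of zeros of `f` exceeds the number of zeros of `f'` by at most one. -/
lemma integral_bump_abs_le_card {f f' : ℝ → ℝ} (hf : ∀ t, HasDerivAt f (f' t) t)
    (hc : Continuous f') {ε : ℝ} (hε : 0 < ε) (n : ℕ) :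
    ∀ {a b : ℝ} (_ : a ≤ b) (S : Finset ℝ) (_ : S.card ≤ n)
      (_ : ∀ t ∈ Set.Ioo a b, f' t = 0 → t ∈ S),
    ∫ t in a..b, bump ε (f t) * |f' t| ≤ S.card + 1 := by
  have hfc : Continuous f := continuous_iff_continuousAt.2 fun t => (hf t).continuousAt
  induction n with
  | zero =>
    intro a b hab S hS h0
    have hS0 : S = ∅ := Finset.card_eq_zero.1 (by omega)
    subst hS0
    simpa using integral_bump_abs_le_one hf hc hε hab (fun t ht h => by simpa using h0 t ht h)
  | succ n ih =>
    intro a b hab S hS h0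
    by_cases hex : ∃ t ∈ S, t ∈ Set.Ioo a b
    · obtain ⟨t, htS, ht⟩ := hex
      have hsub : ((S.filter (· < t)).card + (S.filter (t < ·)).card) + 1 ≤ S.card := by
        have hdisj : Disjoint (S.filter (· < t)) (S.filter (t < ·)) := by
          rw [Finset.disjoint_filter]
          intro x _ h1 h2
          exact absurd (h1.trans h2) (lt_irrefl _)
        rw [← Finset.card_union_of_disjoint hdisj]
        refine Nat.succ_le_of_lt (Finset.card_lt_card ⟨?_, ?_⟩)
        · intro x hx
          simp only [Finset.mem_union, Finset.mem_filter] at hx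
          tauto
        · intro h
          have := h htS
          simp at this
      rw [← intervalIntegral.integral_add_adjacent_intervals
        (bump_abs_intervalIntegrable hfc hc hε a t) (bump_abs_intervalIntegrable hfc hc hε t b)]
      have h1 := ih ht.1.le (S.filter (· < t)) (by omega) (fun x hx hx0 =>
        Finset.mem_filter.2 ⟨h0 x ⟨hx.1, hx.2.trans ht.2⟩ hx0, hx.2⟩)
      have h2 := ih ht.2.le (S.filter (t < ·)) (by omega) (fun x hx hx0 =>
        Finset.mem_filter.2 ⟨h0 x ⟨ht.1.trans hx.1, hx.2⟩ hx0, hx.1⟩)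
      have h3 : (((S.filter (· < t)).card : ℝ) + (S.filter (t < ·)).card) + 1 ≤ S.card := by
        exact_mod_cast hsub
      linarith
    · have h1 := integral_bump_abs_le_one hf hc hε hab
        (fun t ht h => hex ⟨t, h0 t ht h, ht⟩)
      have : (0 : ℝ) ≤ S.card := by positivity
      linarith

/-- If the smoothed zero count is larger than `n + 1`, then `f'` has more than `n` zeros. -/
lemma exists_zeros_of_lt_integral {f f' : ℝ → ℝ} (hf : ∀ t, HasDerivAt f (f' t) t)
    (hc : Continuous f') {ε : ℝ} (hε : 0 < ε) (n : ℕ) {a b : ℝ} (hab : a ≤ b)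
    (h : (n + 1 : ℝ) < ∫ t in a..b, bump ε (f t) * |f' t|) :
    ∃ T : Finset ℝ, T.card = n + 1 ∧ ∀ t ∈ T, t ∈ Set.Icc a b ∧ f' t = 0 := by
  by_contra hno
  set Z : Set ℝ := {t | t ∈ Set.Ioo a b ∧ f' t = 0} with hZ
  have hfin : Z.Finite := by
    by_contra hinf
    obtain ⟨T, hT, hTc⟩ := Set.Infinite.exists_subset_card_eq hinf (n + 1)
    exact hno ⟨T, hTc, fun t ht => ⟨Set.Ioo_subset_Icc_self (hT ht).1, (hT ht).2⟩⟩
  have hcard : hfin.toFinset.card ≤ n := by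
    by_contra hlt
    obtain ⟨T, hT, hTc⟩ := Finset.exists_subset_card_eq (show n + 1 ≤ hfin.toFinset.card by omega)
    refine hno ⟨T, hTc, fun t ht => ?_⟩
    have := hfin.mem_toFinset.1 (hT ht)
    exact ⟨Set.Ioo_subset_Icc_self this.1, this.2⟩
  have h1 := integral_bump_abs_le_card hf hc hε n hab hfin.toFinset hcard
    (fun t ht h => hfin.mem_toFinset.2 ⟨ht, h⟩)
  have h2 : (hfin.toFinset.card : ℝ) ≤ n := by exact_mod_cast hcard
  linarith

/-- Rolle: between `n + 2` zeros of `f` there are `n + 1` zeros of `f'`. -/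
lemma exists_zeros_deriv {f f' : ℝ → ℝ} (hf : ∀ t, HasDerivAt f (f' t) t) {a b : ℝ} (n : ℕ)
    (T : Finset ℝ) (hT : T.card = n + 2) (h : ∀ t ∈ T, t ∈ Set.Icc a b ∧ f t = 0) :
    ∃ T' : Finset ℝ, T'.card = n + 1 ∧ ∀ t ∈ T', t ∈ Set.Icc a b ∧ f' t = 0 := by
  have hfc : Continuous f := continuous_iff_continuousAt.2 fun t => (hf t).continuousAt
  set e := T.orderEmbOfFin hT
  have he : ∀ i, e i ∈ T := fun i => T.orderEmbOfFin_mem hT i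
  have hr : ∀ i : Fin (n + 1), ∃ c ∈ Set.Ioo (e i.castSucc) (e i.succ), f' c = 0 := fun i =>
    exists_hasDerivAt_eq_zero (e.strictMono (Fin.castSucc_lt_succ)) hfc.continuousOn
      (by rw [(h _ (he _)).2, (h _ (he _)).2]) (fun t _ => hf t)
  choose c hc hc0 using hr
  have hmono : StrictMono c := by
    rw [Fin.strictMono_iff_lt_succ]
    intro i
    exact (hc _).2.trans (by
      have := (hc i.succ).1
      rwa [← Fin.succ_castSucc] at this)
  refine ⟨Finset.univ.map ⟨c, hmono.injective⟩, by simp, ?_⟩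
  intro t ht
  simp only [Finset.mem_map, Finset.mem_univ, true_and, Function.Embedding.coeFn_mk] at ht
  obtain ⟨i, rfl⟩ := ht
  exact ⟨⟨((h _ (he _)).1.1).trans (hc i).1.le, (hc i).2.le.trans (h _ (he _)).1.2⟩, hc0 i⟩

/-- Iterated Rolle. -/
lemma exists_zero_of_zeros {G : ℕ → ℝ → ℝ} (hG : ∀ k t, HasDerivAt (G k) (G (k + 1) t) t)
    {a b : ℝ} (n : ℕ) : ∀ (k : ℕ) (T : Finset ℝ) (_ : T.card = n + 1)
    (_ : ∀ t ∈ T, t ∈ Set.Icc a b ∧ G k t = 0), ∀ i ≤ n, ∃ t ∈ Set.Icc a b, G (k + i) t = 0 := by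
  induction n with
  | zero =>
    intro k T hT h i hi
    obtain ⟨t, ht⟩ := Finset.card_pos.1 (show 0 < T.card by omega)
    obtain rfl : i = 0 := by omega
    exact ⟨t, h t ht⟩
  | succ n ih =>
    intro k T hT h i hi
    rcases Nat.eq_zero_or_pos i with rfl | hpos
    · obtain ⟨t, ht⟩ := Finset.card_pos.1 (show 0 < T.card by omega)
      exact ⟨t, h t ht⟩
    · obtain ⟨T', hT', h'⟩ := exists_zeros_deriv (hG k) n T hT h
      obtain ⟨t, ht⟩ := ih (k + 1) T' hT' h' (i - 1) (by omega)
      refine ⟨t, ht.1, ?_⟩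
      rw [← ht.2]; congr 1; omega

/-- Bounds for derivatives which all vanish somewhere in an interval of length `H`. -/
lemma abs_le_of_zeros {G : ℕ → ℝ → ℝ} (hG : ∀ k t, HasDerivAt (G k) (G (k + 1) t) t)
    {a H K : ℝ} (hH : 0 ≤ H) (j : ℕ)
    (hK : ∫ s in a..(a + H), |G (j + 1) s| ≤ K) :
    ∀ n k, k + n = j → (∀ i, k ≤ i → i ≤ j → ∃ t ∈ Set.Icc a (a + H), G i t = 0) →
      ∀ t ∈ Set.Icc a (a + H), |G k t| ≤ H ^ n * K := by
  have hcont : ∀ k, Continuous (G k) := fun k =>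
    continuous_iff_continuousAt.2 fun t => (hG k t).continuousAt
  have hftc : ∀ k s t, G k t - G k s = ∫ x in s..t, G (k + 1) x := fun k s t =>
    (intervalIntegral.integral_eq_sub_of_hasDerivAt (fun x _ => hG k x)
      ((hcont _).intervalIntegrable _ _)).symm
  intro n
  induction n with
  | zero =>
    intro k hk hz t ht
    obtain rfl : k = j := by omega
    obtain ⟨s, hs, hs0⟩ := hz k le_rfl le_rfl
    have h1 := hftc k s t
    rw [hs0, sub_zero] at h1
    rw [h1, pow_zero, one_mul]
    refine le_trans ?_ hK
    have h2 := intervalIntegral.norm_integral_le_integral_norm_uIoc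
      (f := G (k + 1)) (a := s) (b := t) (μ := volume)
    refine h2.trans ?_
    rw [intervalIntegral.integral_of_le (by linarith)]
    refine setIntegral_mono_set ?_ (Filter.Eventually.of_forall fun x => abs_nonneg _)
      (LE.le.eventuallyLE ?_)
    · have : IntervalIntegrable (fun x => |G (k + 1) x|) volume a (a + H) :=
        (hcont _).abs.intervalIntegrable _ _
      exact (intervalIntegrable_iff_integrableOn_Ioc_of_le (by linarith)).1 this
    · rw [Set.uIoc]
      exact Set.Ioc_subset_Ioc (le_min hs.1 ht.1) (max_le hs.2 ht.2)
  | succ n ih =>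
    intro k hk hz t ht
    obtain ⟨s, hs, hs0⟩ := hz k le_rfl (by omega)
    have h1 := hftc k s t
    rw [hs0, sub_zero] at h1
    have h2 := ih (k + 1) (by omega) (fun i hi hi' => hz i (by omega) hi')
    have h0 : 0 ≤ H ^ n * K := (abs_nonneg _).trans (h2 t ht)
    rw [h1]
    have h3 := intervalIntegral.norm_integral_le_of_norm_le_const (a := s) (b := t)
      (f := G (k + 1)) (C := H ^ n * K) (by
        intro x hx
        refine h2 x ⟨?_, ?_⟩
        · exact (le_min hs.1 ht.1).trans hx.1.le
        · exact hx.2.trans (max_le hs.2 ht.2))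
    refine h3.trans ?_
    have h4 : |t - s| ≤ H := by
      rw [abs_le]; constructor <;> linarith [hs.1, hs.2, ht.1, ht.2]
    calc H ^ n * K * |t - s| ≤ H ^ n * K * H := by gcongr
      _ = H ^ (n + 1) * K := by ring

/-- The vector of `k`-th derivatives of the functions `u i` at `t`. -/
def dk {ι : Type} (u : ι → ℝ → ℝ) (k : ℕ) (t : ℝ) : ι → ℝ := fun i => iteratedDeriv k (u i) t

/-- The `k`-th derivative of the Gaussian process `t ↦ ∑ i, u i t * ω i`. -/
def proc {ι : Type} [Fintype ι] (u : ι → ℝ → ℝ) (k : ℕ) (t : ℝ) (ω : ι → ℝ) : ℝ :=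
  lin (dk u k t) ω

/-- A smooth Gaussian process on `[0, L]` with unit variance, constant speed `σ`, and controlled
higher derivatives. -/
structure IsProc {ι : Type} [Fintype ι] (u : ι → ℝ → ℝ) (L σ B : ℝ) : Prop where
  smooth : ∀ i, ContDiff ℝ (⊤ : ℕ∞) (u i)
  σ_pos : 0 < σ
  g00 : ∀ t ∈ Set.Icc 0 L, ∑ i, dk u 0 t i * dk u 0 t i = 1
  g01 : ∀ t ∈ Set.Icc 0 L, ∑ i, dk u 0 t i * dk u 1 t i = 0
  g11 : ∀ t ∈ Set.Icc 0 L, ∑ i, dk u 1 t i * dk u 1 t i = σ ^ 2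
  g12 : ∀ t ∈ Set.Icc 0 L, ∑ i, dk u 1 t i * dk u 2 t i = 0
  g22 : ∀ t ∈ Set.Icc 0 L, σ ^ 4 ≤ ∑ i, dk u 2 t i ^ 2
  gk : ∀ k ≤ 6, ∀ t ∈ Set.Icc 0 L, ∑ i, dk u k t i ^ 2 ≤ B ^ 2 * σ ^ (2 * k)

lemma hasDerivAt_proc {ι : Type} [Fintype ι] {u : ι → ℝ → ℝ}
    (hu : ∀ i, ContDiff ℝ (⊤ : ℕ∞) (u i)) (ω : ι → ℝ) (k : ℕ) (t : ℝ) :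
    HasDerivAt (fun t => proc u k t ω) (proc u (k + 1) t ω) t := by
  unfold proc lin
  refine HasDerivAt.fun_sum fun i _ => ?_
  refine HasDerivAt.mul_const ?_ _
  simp only [dk]
  rw [iteratedDeriv_succ]
  refine (((hu i).differentiable_iteratedDeriv k ?_) t).hasDerivAt
  exact_mod_cast WithTop.coe_lt_top _

lemma continuous_dk {ι : Type} {u : ι → ℝ → ℝ}
    (hu : ∀ i, ContDiff ℝ (⊤ : ℕ∞) (u i)) (k : ℕ) (i : ι) : Continuous (fun t => dk u k t i) :=
  (hu i).continuous_iteratedDeriv k (by exact_mod_cast le_top)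

lemma continuous_proc {ι : Type} [Fintype ι] {u : ι → ℝ → ℝ}
    (hu : ∀ i, ContDiff ℝ (⊤ : ℕ∞) (u i)) (k : ℕ) :
    Continuous (fun p : (ι → ℝ) × ℝ => proc u k p.2 p.1) := by
  unfold proc lin
  have := fun i => continuous_dk hu k i
  fun_prop

lemma continuous_proc_left {ι : Type} [Fintype ι] {u : ι → ℝ → ℝ}
    (hu : ∀ i, ContDiff ℝ (⊤ : ℕ∞) (u i)) (k : ℕ) (ω : ι → ℝ) :
    Continuous (fun t => proc u k t ω) :=
  (continuous_proc hu k).comp (by fun_prop : Continuous fun t : ℝ => (ω, t))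

/-- `∫ |f| ≤ K` if `∫ f² < K² / H`. -/
lemma integral_abs_le_of_sq {f : ℝ → ℝ} (hf : Continuous f) {a H K : ℝ} (hH : 0 < H) (hK : 0 < K)
    (h : ∫⁻ t in Set.Ioc a (a + H), ENNReal.ofReal (f t ^ 2) < ENNReal.ofReal (K ^ 2 / H)) :
    ∫ t in a..(a + H), |f t| ≤ K := by
  have hi : IntervalIntegrable (fun t => f t ^ 2) volume a (a + H) :=
    (hf.pow 2).intervalIntegrable _ _
  have h2 : ∫ t in a..(a + H), f t ^ 2 ≤ K ^ 2 / H := by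
    rw [intervalIntegral.integral_of_le (by linarith), integral_eq_lintegral_of_nonneg_ae
      (Filter.Eventually.of_forall fun t => sq_nonneg _)
      (hf.pow 2).measurable.aestronglyMeasurable]
    exact ENNReal.toReal_le_of_le_ofReal (by positivity) h.le
  have h3 : ∫ t in a..(a + H), |f t| ≤ ∫ t in a..(a + H), ((H / K / 2) * f t ^ 2 + K / H / 2) := by
    refine intervalIntegral.integral_mono_on (by linarith) (hf.abs.intervalIntegrable _ _)
      ((hi.const_mul _).add (by simp)) ?_
    intro t _
    rw [← sq_abs]
    have : 0 ≤ (H / K / 2) * (|f t| - K / H) ^ 2 := by positivity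
    have e : (H / K / 2) * (|f t| - K / H) ^ 2
        = (H / K / 2) * |f t| ^ 2 + K / H / 2 - |f t| := by field_simp; ring
    linarith
  rw [intervalIntegral.integral_add (hi.const_mul _) (by simp),
    intervalIntegral.integral_const_mul, intervalIntegral.integral_const, smul_eq_mul] at h3
  calc _ ≤ _ := h3
    _ ≤ (H / K / 2) * (K ^ 2 / H) + (a + H - a) * (K / H / 2) := by gcongr
    _ = K := by field_simp; ring

/-- Probability that all derivatives of orders `k, …, k + j` vanish in a short interval. -/
lemma proc_bad_le {ι : Type} [Fintype ι] {u : ι → ℝ → ℝ}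
    (hu : ∀ i, ContDiff ℝ (⊤ : ℕ∞) (u i)) (k j : ℕ) (hj : 1 ≤ j) {a H K s s' V : ℝ}
    (hH : 0 < H) (hK : 0 < K) (hs : 0 < s) (hs' : 0 < s')
    (h1 : ∑ i, dk u k a i ^ 2 = s ^ 2) (h2 : ∑ i, dk u (k + 1) a i ^ 2 = s' ^ 2)
    (h12 : ∑ i, dk u k a i * dk u (k + 1) a i = 0)
    (hV : ∀ t ∈ Set.Icc a (a + H), ∑ i, dk u (k + j + 1) t i ^ 2 ≤ V) :
    stdG ι {ω | ∀ i ≤ j, ∃ t ∈ Set.Icc a (a + H), proc u (k + i) t ω = 0}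
      ≤ ENNReal.ofReal (H ^ 2 * V / K ^ 2)
        + ENNReal.ofReal (H ^ j * K / s) * ENNReal.ofReal (H ^ (j - 1) * K / s') := by
  set M2 : (ι → ℝ) → ENNReal := fun ω =>
    ∫⁻ t in Set.Ioc a (a + H), ENNReal.ofReal (proc u (k + j + 1) t ω ^ 2) with hM2
  have hmeas : Measurable (fun p : (ι → ℝ) × ℝ =>
      ENNReal.ofReal (proc u (k + j + 1) p.2 p.1 ^ 2)) := by
    have := (continuous_proc hu (k + j + 1)).measurable
    fun_prop
  have hM2m : Measurable M2 := Measurable.lintegral_prod_right hmeas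
  have hM2i : ∫⁻ ω, M2 ω ∂(stdG ι) ≤ ENNReal.ofReal (H * V) := by
    rw [hM2, lintegral_lintegral_swap hmeas.aemeasurable]
    calc _ ≤ ∫⁻ t in Set.Ioc a (a + H), ENNReal.ofReal V := by
          refine setLIntegral_mono (by fun_prop) fun t ht => ?_
          unfold proc
          rw [lintegral_lin_sq]
          exact ENNReal.ofReal_le_ofReal (hV t (Set.Ioc_subset_Icc_self ht))
      _ = _ := by
          rw [setLIntegral_const, Real.volume_Ioc, mul_comm, ← ENNReal.ofReal_mul (by linarith)]
          congr 2; ring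
  have hsub : {ω | ∀ i ≤ j, ∃ t ∈ Set.Icc a (a + H), proc u (k + i) t ω = 0}
      ⊆ {ω | ENNReal.ofReal (K ^ 2 / H) ≤ M2 ω}
        ∪ {ω | |lin (dk u k a) ω| ≤ H ^ j * K ∧ |lin (dk u (k + 1) a) ω| ≤ H ^ (j - 1) * K} := by
    intro ω hω
    by_cases hM : ENNReal.ofReal (K ^ 2 / H) ≤ M2 ω
    · exact Or.inl hM
    · right
      have hint := integral_abs_le_of_sq (continuous_proc_left hu (k + j + 1) ω) hH hK
        (not_le.1 hM)
      have key := abs_le_of_zeros (G := fun n t => proc u n t ω)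
        (fun n t => hasDerivAt_proc hu ω n t) hH.le (k + j) hint
      have ha : a ∈ Set.Icc a (a + H) := ⟨le_rfl, by linarith⟩
      have hz : ∀ i, k ≤ i → i ≤ k + j → ∃ t ∈ Set.Icc a (a + H), proc u i t ω = 0 := by
        intro i hi hi'
        obtain ⟨t, ht⟩ := hω (i - k) (by omega)
        rw [show k + (i - k) = i by omega] at ht
        exact ⟨t, ht⟩
      exact ⟨key j k rfl hz a ha,
        key (j - 1) (k + 1) (by omega) (fun i hi hi' => hz i (by omega) hi') a ha⟩
  refine (measure_mono hsub).trans ((measure_union_le _ _).trans (add_le_add ?_ ?_))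
  · have hne : ENNReal.ofReal (K ^ 2 / H) ≠ 0 := by
      rw [Ne, ENNReal.ofReal_eq_zero, not_le]; positivity
    refine (meas_ge_le_lintegral_div hM2m.aemeasurable hne ENNReal.ofReal_ne_top).trans ?_
    refine (ENNReal.div_le_div_right hM2i _).trans ?_
    rw [← ENNReal.ofReal_div_of_pos (by positivity)]
    apply le_of_eq
    congr 1
    field_simp
  · exact stdG_small_ball _ _ hs hs' h1 h2 h12 _ _

/-- The smoothed zero count on `[a, b]`. -/
def smoothCount {ι : Type} [Fintype ι] (u : ι → ℝ → ℝ) (ε a b : ℝ) (ω : ι → ℝ) : ℝ :=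
  ∫ t in a..b, bump ε (proc u 0 t ω) * |proc u 1 t ω|

lemma measurable_kac_proc {ι : Type} [Fintype ι] {u : ι → ℝ → ℝ}
    (hu : ∀ i, ContDiff ℝ (⊤ : ℕ∞) (u i)) (ε : ℝ) :
    Measurable (fun p : (ι → ℝ) × ℝ => bump ε (proc u 0 p.2 p.1) * |proc u 1 p.2 p.1|) := by
  have h0 := (continuous_proc hu 0).measurable
  have h1 := (continuous_proc hu 1).measurable
  fun_prop

lemma measurable_smoothCount {ι : Type} [Fintype ι] {u : ι → ℝ → ℝ}
    (hu : ∀ i, ContDiff ℝ (⊤ : ℕ∞) (u i)) (ε : ℝ) {a b : ℝ} (hab : a ≤ b) :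
    Measurable (smoothCount u ε a b) := by
  unfold smoothCount
  simp_rw [intervalIntegral.integral_of_le hab]
  exact (StronglyMeasurable.integral_prod_right (ν := volume.restrict (Set.Ioc a b))
    (measurable_kac_proc hu ε).stronglyMeasurable).measurable

lemma smoothCount_nonneg {ι : Type} [Fintype ι] (u : ι → ℝ → ℝ) {ε a b : ℝ} (hε : 0 < ε)
    (hab : a ≤ b) (ω : ι → ℝ) : 0 ≤ smoothCount u ε a b ω :=
  integral_bump_abs_nonneg _ _ hε hab

lemma smoothCount_sum {ι : Type} [Fintype ι] {u : ι → ℝ → ℝ}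
    (hu : ∀ i, ContDiff ℝ (⊤ : ℕ∞) (u i)) {ε : ℝ} (hε : 0 < ε) (x : ℕ → ℝ) (n : ℕ) (ω : ι → ℝ) :
    ∑ i ∈ Finset.range n, smoothCount u ε (x i) (x (i + 1)) ω = smoothCount u ε (x 0) (x n) ω :=
  intervalIntegral.sum_integral_adjacent_intervals fun _ _ =>
    bump_abs_intervalIntegrable (continuous_proc_left hu 0 ω) (continuous_proc_left hu 1 ω) hε _ _

lemma piece_tail {ι : Type} [Fintype ι] {u : ι → ℝ → ℝ} {L σ B : ℝ} (hp : IsProc u L σ B)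
    {ε : ℝ} (hε : 0 < ε) {a H : ℝ} (hH : 0 < H) (ha : 0 ≤ a) (haH : a + H ≤ L)
    (hη : H * σ ≤ 1) :
    stdG ι {ω | 5 < smoothCount u ε a (a + H) ω} ≤ ENNReal.ofReal ((B ^ 2 + 1) * (H * σ) ^ 4) := by
  have hσ := hp.σ_pos
  have haI : a ∈ Set.Icc 0 L := ⟨ha, by linarith⟩
  have hsub : {ω | 5 < smoothCount u ε a (a + H) ω}
      ⊆ {ω | ∀ i ≤ 4, ∃ t ∈ Set.Icc a (a + H), proc u (1 + i) t ω = 0} := by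
    intro ω hω
    obtain ⟨T, hT, hT'⟩ := exists_zeros_of_lt_integral (f := fun t => proc u 0 t ω)
      (f' := fun t => proc u 1 t ω) (hasDerivAt_proc hp.smooth ω 0)
      (continuous_proc_left hp.smooth 1 ω) hε 4 (a := a) (b := a + H) (by linarith)
      (by
        have : (5 : ℝ) < smoothCount u ε a (a + H) ω := hω
        unfold smoothCount at this
        norm_num
        exact this)
    exact exists_zero_of_zeros (G := fun k t => proc u k t ω) (hasDerivAt_proc hp.smooth ω) 4 1 T
      hT hT'
  set s' := √(∑ i, dk u 2 a i ^ 2) with hs'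
  have hs'2 : ∑ i, dk u 2 a i ^ 2 = s' ^ 2 :=
    (Real.sq_sqrt (Finset.sum_nonneg fun i _ => sq_nonneg _)).symm
  have hs'σ : σ ^ 2 ≤ s' := by
    rw [hs']
    apply Real.le_sqrt_of_sq_le
    rw [← pow_mul]
    exact hp.g22 a haI
  have hs'0 : 0 < s' := lt_of_lt_of_le (by positivity) hs'σ
  have hη0 : 0 < H * σ := by positivity
  have hb := proc_bad_le hp.smooth 1 4 (by norm_num) hH (K := σ ^ 5 / (H * σ)) (s := σ) (s' := s')
    (V := B ^ 2 * σ ^ (2 * 6)) (by positivity) hσ hs'0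
    (by rw [← hp.g11 a haI]; simp only [sq]) hs'2 (hp.g12 a haI)
    (fun t ht => hp.gk 6 le_rfl t ⟨ha.trans ht.1, ht.2.trans haH⟩)
  refine (measure_mono hsub).trans (hb.trans ?_)
  rw [← ENNReal.ofReal_mul (by positivity), ← ENNReal.ofReal_add (by positivity) (by positivity)]
  apply ENNReal.ofReal_le_ofReal
  have e1 : H ^ 2 * (B ^ 2 * σ ^ (2 * 6)) / (σ ^ 5 / (H * σ)) ^ 2 = B ^ 2 * (H * σ) ^ 4 := by
    field_simp
  have e2 : H ^ 4 * (σ ^ 5 / (H * σ)) / σ * (H ^ (4 - 1) * (σ ^ 5 / (H * σ)) / s')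
      ≤ (H * σ) ^ 4 := by
    calc _ ≤ H ^ 4 * (σ ^ 5 / (H * σ)) / σ * (H ^ (4 - 1) * (σ ^ 5 / (H * σ)) / σ ^ 2) := by
          gcongr
      _ = (H * σ) ^ 4 * (H * σ) := by field_simp
      _ ≤ (H * σ) ^ 4 * 1 := by gcongr
      _ = _ := mul_one _
  rw [e1]
  linarith

lemma smoothCount_tail {ι : Type} [Fintype ι] {u : ι → ℝ → ℝ} {L σ B : ℝ} (hp : IsProc u L σ B)
    {ε : ℝ} (hε : 0 < ε) {a h : ℝ} (hh : 0 < h) (ha : 0 ≤ a) (hah : a + h ≤ L)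
    (hη : h * σ ≤ 1) {q : ℕ} (hq : 0 < q) :
    stdG ι {ω | 5 * (q : ℝ) < smoothCount u ε a (a + h) ω}
      ≤ ENNReal.ofReal ((B ^ 2 + 1) / q ^ 3) := by
  have hσ := hp.σ_pos
  have hq' : (0 : ℝ) < q := by exact_mod_cast hq
  have hq1 : (1 : ℝ) ≤ q := by exact_mod_cast hq
  set x : ℕ → ℝ := fun i => a + i * (h / q) with hx
  have hxs : ∀ i, x (i + 1) = x i + h / q := fun i => by simp only [hx]; push_cast; ring
  have hx0 : x 0 = a := by simp [hx]
  have hxq : x q = a + h := by simp only [hx]; field_simp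
  have hsub : {ω | 5 * (q : ℝ) < smoothCount u ε a (a + h) ω}
      ⊆ ⋃ i ∈ Finset.range q, {ω | 5 < smoothCount u ε (x i) (x i + h / q) ω} := by
    intro ω hω
    by_contra hno
    simp only [Set.mem_iUnion, Set.mem_ofPred_eq, not_exists, not_lt] at hno
    have hs := smoothCount_sum hp.smooth hε x q ω
    rw [hx0, hxq] at hs
    have : smoothCount u ε a (a + h) ω ≤ 5 * q := by
      rw [← hs]
      calc _ ≤ ∑ i ∈ Finset.range q, (5 : ℝ) := Finset.sum_le_sum fun i hi => by
              rw [hxs]; exact hno i hi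
        _ = 5 * q := by simp; ring
    exact absurd hω (not_lt.2 this)
  refine (measure_mono hsub).trans ((measure_biUnion_finset_le _ _).trans ?_)
  have hη' : h / q * σ ≤ 1 / q := by
    rw [div_mul_eq_mul_div]; gcongr
  calc _ ≤ ∑ i ∈ Finset.range q, ENNReal.ofReal ((B ^ 2 + 1) * (1 / q) ^ 4) := by
        refine Finset.sum_le_sum fun i hi => ?_
        have hiq : (i : ℝ) + 1 ≤ q := by exact_mod_cast Finset.mem_range.1 hi
        refine (piece_tail hp hε (by positivity) (by simp only [hx]; positivity) ?_ ?_).trans ?_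
        · rw [← hxs]
          refine le_trans ?_ hah
          rw [← hxq]
          simp only [hx]
          push_cast
          gcongr
        · refine hη'.trans ?_
          rw [div_le_one hq']; exact hq1
        · apply ENNReal.ofReal_le_ofReal
          gcongr
    _ = _ := by
        rw [Finset.sum_const, Finset.card_range, nsmul_eq_mul, ← ENNReal.ofReal_natCast,
          ← ENNReal.ofReal_mul (by positivity)]
        congr 1
        field_simp

/-- Uniform second moment bound for smoothed zero counts on short intervals. -/
lemma smoothCount_second_moment {ι : Type} [Fintype ι] {u : ι → ℝ → ℝ} {L σ B : ℝ}
    (hp : IsProc u L σ B) {ε : ℝ} (hε : 0 < ε) {a h : ℝ} (hh : 0 < h) (ha : 0 ≤ a)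
    (hah : a + h ≤ L) (hη : h * σ ≤ 1) :
    ∫⁻ ω, ENNReal.ofReal (smoothCount u ε a (a + h) ω ^ 2) ∂(stdG ι)
      ≤ ENNReal.ofReal (225 + 200 * B ^ 2) := by
  set Z := smoothCount u ε a (a + h) with hZ
  have hZm : Measurable Z := measurable_smoothCount hp.smooth ε (by linarith)
  have hZ0 : ∀ ω, 0 ≤ Z ω := smoothCount_nonneg u hε (by linarith)
  set A : ℕ → Set (ι → ℝ) := fun n => {ω | 5 * ((2 ^ n : ℕ) : ℝ) < Z ω} with hA
  have hAm : ∀ n, MeasurableSet (A n) := fun n => measurableSet_lt (by fun_prop) hZm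
  have hpt : ∀ ω, ENNReal.ofReal (Z ω ^ 2)
      ≤ 25 + ∑' n, Set.indicator (A n) (fun _ => ENNReal.ofReal (100 * 4 ^ n)) ω := by
    intro ω
    by_cases h5 : Z ω ≤ 5
    · refine le_trans ?_ le_self_add
      rw [show (25 : ENNReal) = ENNReal.ofReal 25 by simp]
      apply ENNReal.ofReal_le_ofReal
      nlinarith [hZ0 ω]
    · rw [not_le] at h5
      have hex : ∃ n : ℕ, Z ω ≤ 5 * 2 ^ n := by
        obtain ⟨n, hn⟩ := pow_unbounded_of_one_lt (Z ω) (one_lt_two)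
        exact ⟨n, by linarith [pow_pos (two_pos : (0:ℝ) < 2) n]⟩
      have hn := Nat.find_spec hex
      have hpos : Nat.find hex ≠ 0 := by
        intro h0
        rw [h0] at hn
        simp at hn
        linarith
      obtain ⟨n, hn'⟩ := Nat.exists_eq_succ_of_ne_zero hpos
      have hlt := Nat.find_min hex (m := n) (by omega)
      rw [hn'] at hn
      rw [not_le] at hlt
      have hmem : ω ∈ A n := by
        simp only [hA, Set.mem_ofPred_eq]; push_cast; exact hlt
      refine le_trans ?_ (le_trans (ENNReal.le_tsum n) le_add_self)
      rw [Set.indicator_of_mem hmem]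
      apply ENNReal.ofReal_le_ofReal
      calc Z ω ^ 2 ≤ (5 * 2 ^ (n + 1)) ^ 2 := by gcongr
        _ = 100 * 4 ^ n := by
          rw [mul_pow, ← pow_mul, show (4 : ℝ) = 2 ^ 2 by norm_num, ← pow_mul]; ring
  calc _ ≤ ∫⁻ ω, (25 + ∑' n, Set.indicator (A n) (fun _ => ENNReal.ofReal (100 * 4 ^ n)) ω)
        ∂(stdG ι) := lintegral_mono hpt
    _ = 25 + ∑' n, ENNReal.ofReal (100 * 4 ^ n) * stdG ι (A n) := by
        rw [lintegral_add_left measurable_const, lintegral_const, measure_univ, mul_one,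
          lintegral_tsum fun n => (measurable_const.indicator (hAm n)).aemeasurable]
        congr 2
        ext n
        rw [lintegral_indicator (hAm n), setLIntegral_const]
    _ ≤ 25 + ∑' n : ℕ, ENNReal.ofReal (100 * (B ^ 2 + 1) * (1 / 2) ^ n) := by
        gcongr with n
        refine (mul_le_mul_right (smoothCount_tail hp hε hh ha hah hη
          (show 0 < 2 ^ n by positivity)) _).trans ?_
        rw [← ENNReal.ofReal_mul (by positivity)]
        apply ENNReal.ofReal_le_ofReal
        apply le_of_eq
        push_cast
        rw [show (4 : ℝ) = 2 ^ 2 by norm_num, ← pow_mul, ← pow_mul, one_div, inv_pow]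
        field_simp
        ring
    _ = _ := by
        have hsum := (hasSum_geometric_two).mul_left (100 * (B ^ 2 + 1))
        rw [← ENNReal.ofReal_tsum_of_nonneg (fun n => by positivity) hsum.summable, hsum.tsum_eq,
          show (25 : ENNReal) = ENNReal.ofReal 25 by simp,
          ← ENNReal.ofReal_add (by norm_num) (by positivity)]
        congr 1
        ring

lemma ae_no_double_zero {ι : Type} [Fintype ι] {u : ι → ℝ → ℝ} {L σ B : ℝ}
    (hp : IsProc u L σ B) (hL : 0 < L) :
    ∀ᵐ ω ∂(stdG ι), ∀ t ∈ Set.Icc 0 L, ¬(proc u 0 t ω = 0 ∧ proc u 1 t ω = 0) := by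
  have hσ := hp.σ_pos
  set E : Set (ι → ℝ) := {ω | ∃ t ∈ Set.Icc 0 L, proc u 0 t ω = 0 ∧ proc u 1 t ω = 0} with hE
  set c : ℝ := B ^ 2 * (L * σ) ^ 2 + L * σ with hc
  have hc0 : 0 ≤ c := by positivity
  have hbound : ∀ n : ℕ, 0 < n → stdG ι E ≤ ENNReal.ofReal (c / n) := by
    intro n hn
    have hn' : (0 : ℝ) < n := by exact_mod_cast hn
    have hn1 : (1 : ℝ) ≤ n := by exact_mod_cast hn
    set H : ℝ := L / n ^ 3 with hH
    have hH0 : 0 < H := by positivity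
    have hnH : (n : ℝ) ^ 3 * H = L := by rw [hH]; field_simp
    have hsub : E ⊆ ⋃ i ∈ Finset.range (n ^ 3), {ω | ∀ j ≤ 1,
        ∃ t ∈ Set.Icc (i * H) (i * H + H), proc u (0 + j) t ω = 0} := by
      rintro ω ⟨t, ht, h0, h1⟩
      simp only [Set.mem_iUnion]
      have hpiece : ∃ i < n ^ 3, t ∈ Set.Icc (i * H) (i * H + H) := by
        rcases eq_or_lt_of_le ht.2 with h | h
        · refine ⟨n ^ 3 - 1, by have := pow_pos hn 3; omega, ?_⟩
          have : ((n ^ 3 - 1 : ℕ) : ℝ) = (n : ℝ) ^ 3 - 1 := by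
            rw [Nat.cast_sub (Nat.one_le_pow _ _ hn)]; simp
          rw [this, h]
          constructor <;> nlinarith
        · refine ⟨⌊t / H⌋₊, ?_, ?_, ?_⟩
          · rw [Nat.floor_lt (div_nonneg ht.1 hH0.le), div_lt_iff₀ hH0]
            push_cast
            rw [hnH]; exact h
          · have := Nat.floor_le (div_nonneg ht.1 hH0.le)
            rwa [le_div_iff₀ hH0] at this
          · have := Nat.lt_floor_add_one (t / H)
            rw [div_lt_iff₀ hH0] at this
            linarith
      obtain ⟨i, hi, hit⟩ := hpiece
      refine ⟨i, Finset.mem_range.2 hi, ?_⟩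
      intro j hj
      refine ⟨t, hit, ?_⟩
      interval_cases j
      · exact h0
      · exact h1
    refine (measure_mono hsub).trans ((measure_biUnion_finset_le _ _).trans ?_)
    calc _ ≤ ∑ i ∈ Finset.range (n ^ 3),
          ENNReal.ofReal (B ^ 2 * (H * σ) ^ 2 * n ^ 2 + (H * σ) / n ^ 2) := by
          refine Finset.sum_le_sum fun i hi => ?_
          have hi' : (i : ℝ) + 1 ≤ (n : ℝ) ^ 3 := by exact_mod_cast Finset.mem_range.1 hi
          have hiL : i * H + H ≤ L := by rw [← hnH]; nlinarith
          have hi0 : 0 ≤ i * H := by positivity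
          have hiI : (i * H) ∈ Set.Icc 0 L := ⟨hi0, by linarith⟩
          refine (proc_bad_le hp.smooth 0 1 le_rfl hH0 (K := σ / n) (s := 1) (s' := σ)
            (V := B ^ 2 * σ ^ (2 * 2)) (by positivity) one_pos hσ
            (by rw [one_pow, ← hp.g00 _ hiI]; simp only [sq])
            (by rw [← hp.g11 _ hiI]; simp only [sq]) (hp.g01 _ hiI)
            (fun t ht => hp.gk 2 (by norm_num) t
              ⟨hi0.trans ht.1, ht.2.trans hiL⟩)).trans ?_
          rw [← ENNReal.ofReal_mul (by positivity), ← ENNReal.ofReal_add (by positivity)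
            (by positivity)]
          apply ENNReal.ofReal_le_ofReal
          apply le_of_eq
          simp only [pow_one, Nat.sub_self, pow_zero]
          field_simp
          ring
      _ = ENNReal.ofReal (B ^ 2 * (L * σ) ^ 2 / n + (L * σ) / n ^ 2) := by
          rw [Finset.sum_const, Finset.card_range, nsmul_eq_mul, ← ENNReal.ofReal_natCast,
            ← ENNReal.ofReal_mul (by positivity)]
          congr 1
          push_cast
          rw [hH]
          field_simp
      _ ≤ ENNReal.ofReal (c / n) := by
          apply ENNReal.ofReal_le_ofReal
          rw [hc, add_div]
          gcongr
          nlinarith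
  have h0 : stdG ι E = 0 := by
    have hlim : Filter.Tendsto (fun n : ℕ => ENNReal.ofReal (c / n)) Filter.atTop (nhds 0) := by
      rw [← ENNReal.ofReal_zero]
      exact ENNReal.tendsto_ofReal (tendsto_const_div_atTop_nhds_zero_nat c)
    exact le_antisymm (ge_of_tendsto hlim ((Filter.eventually_gt_atTop 0).mono
      fun n hn => hbound n hn)) zero_le
  rw [ae_iff]
  convert h0 using 2
  ext ω
  simp [hE, and_assoc]

lemma ae_proc_ne_zero {ι : Type} [Fintype ι] {u : ι → ℝ → ℝ} {L σ B : ℝ}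
    (hp : IsProc u L σ B) {t : ℝ} (ht : t ∈ Set.Icc 0 L) :
    ∀ᵐ ω ∂(stdG ι), proc u 0 t ω ≠ 0 := by
  rw [ae_iff]
  have hsub : {ω | ¬ proc u 0 t ω ≠ 0}
      ⊆ ⋃ n : ℕ, {ω | |lin (dk u 0 t) ω| ≤ 0 ∧ |lin (dk u 1 t) ω| ≤ n} := by
    intro ω hω
    rw [Set.mem_iUnion]
    obtain ⟨n, hn⟩ := exists_nat_ge |lin (dk u 1 t) ω|
    refine ⟨n, ?_, hn⟩
    have : proc u 0 t ω = 0 := by simpa using hω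
    unfold proc at this
    rw [this, abs_zero]
  refine measure_mono_null hsub (measure_iUnion_null fun n => ?_)
  have := stdG_small_ball (dk u 0 t) (dk u 1 t) one_pos hp.σ_pos
    (by rw [one_pow, ← hp.g00 _ ht]; simp only [sq])
    (by rw [← hp.g11 _ ht]; simp only [sq]) (hp.g01 _ ht) 0 n
  simpa using this

lemma integral_bump_eq_zero {f f' : ℝ → ℝ} (hf : Continuous f) {a b : ℝ} (hab : a ≤ b)
    (h0 : ∀ t ∈ Set.Icc a b, f t ≠ 0) :
    ∀ᶠ ε in nhdsWithin (0 : ℝ) (Set.Ioi 0), ∫ t in a..b, bump ε (f t) * |f' t| = 0 := by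
  obtain ⟨x, hx, hmin⟩ := isCompact_Icc.exists_isMinOn (Set.nonempty_Icc.2 hab)
    hf.abs.continuousOn
  have hpos : 0 < |f x| := abs_pos.2 (h0 x hx)
  filter_upwards [Ioo_mem_nhdsGT hpos] with ε hε
  refine (intervalIntegral.integral_congr (g := fun _ => 0) ?_).trans (by simp)
  intro t ht
  rw [Set.uIcc_of_le hab] at ht
  have h1 : |f x| ≤ |f t| := hmin ht
  simp [bump, not_lt.2 (hε.2.le.trans h1)]

lemma integral_bump_eq_one {f f' : ℝ → ℝ} (hf : ∀ t, HasDerivAt f (f' t) t)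
    (hc : Continuous f') {z δ : ℝ} (hδ : 0 < δ) (hz : f z = 0)
    (h0 : ∀ t ∈ Set.Icc (z - δ) (z + δ), f' t ≠ 0) :
    ∀ᶠ ε in nhdsWithin (0 : ℝ) (Set.Ioi 0),
      ∫ t in (z - δ)..(z + δ), bump ε (f t) * |f' t| = 1 := by
  have hfc : Continuous f := continuous_iff_continuousAt.2 fun t => (hf t).continuousAt
  have hinj : Set.InjOn f (Set.Icc (z - δ) (z + δ)) := by
    have key : ∀ x ∈ Set.Icc (z - δ) (z + δ), ∀ y ∈ Set.Icc (z - δ) (z + δ),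
        x < y → f x ≠ f y := by
      intro x hx y hy hxy h
      obtain ⟨c, hc1, hc2⟩ := exists_hasDerivAt_eq_zero hxy hfc.continuousOn h
        (fun t _ => hf t)
      exact h0 c ⟨hx.1.trans hc1.1.le, hc1.2.le.trans hy.2⟩ hc2
    intro x hx y hy h
    rcases lt_trichotomy x y with h1 | h1 | h1
    · exact absurd h (key x hx y hy h1)
    · exact h1
    · exact absurd h.symm (key y hy x hx h1)
  have hl : z - δ ∈ Set.Icc (z - δ) (z + δ) := ⟨le_rfl, by linarith⟩
  have hm : z ∈ Set.Icc (z - δ) (z + δ) := ⟨by linarith, by linarith⟩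
  have hr : z + δ ∈ Set.Icc (z - δ) (z + δ) := ⟨by linarith, le_rfl⟩
  have hcover : ∃ e > 0, Set.Ioo (-e) e ⊆ f '' Set.Icc (z - δ) (z + δ) := by
    rcases hfc.continuousOn.strictMonoOn_of_injOn_Icc' (by linarith) hinj with hmono | hanti
    · have h1 := hmono hl hm (by linarith)
      have h2 := hmono hm hr (by linarith)
      rw [hz] at h1 h2
      refine ⟨min (-f (z - δ)) (f (z + δ)), lt_min (by linarith) h2, ?_⟩
      refine subset_trans ?_ (intermediate_value_Icc (by linarith) hfc.continuousOn)
      intro y hy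
      have := min_le_left (-f (z - δ)) (f (z + δ))
      have := min_le_right (-f (z - δ)) (f (z + δ))
      exact ⟨by linarith [hy.1], by linarith [hy.2]⟩
    · have h1 := hanti hl hm (by linarith)
      have h2 := hanti hm hr (by linarith)
      rw [hz] at h1 h2
      refine ⟨min (f (z - δ)) (-f (z + δ)), lt_min h1 (by linarith), ?_⟩
      refine subset_trans ?_ (intermediate_value_Icc' (by linarith) hfc.continuousOn)
      intro y hy
      have := min_le_left (f (z - δ)) (-f (z + δ))
      have := min_le_right (f (z - δ)) (-f (z + δ))
      exact ⟨by linarith [hy.1], by linarith [hy.2]⟩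
  obtain ⟨e, he, hsub⟩ := hcover
  filter_upwards [Ioo_mem_nhdsGT he] with ε hε
  have hε0 : 0 < ε := hε.1
  have hli := lintegral_image_eq_lintegral_abs_deriv_mul (s := Set.Icc (z - δ) (z + δ))
    measurableSet_Icc (fun x _ => (hf x).hasDerivWithinAt) hinj (fun y => ENNReal.ofReal (bump ε y))
  rw [intervalIntegral.integral_of_le (by linarith), ← integral_Icc_eq_integral_Ioc,
    integral_eq_lintegral_of_nonneg_ae
      (Filter.Eventually.of_forall fun t => mul_nonneg (bump_nonneg hε0 _) (abs_nonneg _))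
      (Measurable.aestronglyMeasurable (by
      have := hfc.measurable; have := hc.measurable; fun_prop))]
  have h1 : ∫⁻ t in Set.Icc (z - δ) (z + δ), ENNReal.ofReal (bump ε (f t) * |f' t|) = 1 := by
    calc _ = ∫⁻ t in Set.Icc (z - δ) (z + δ),
          ENNReal.ofReal |f' t| * ENNReal.ofReal (bump ε (f t)) := by
          refine lintegral_congr fun t => ?_
          rw [mul_comm, ENNReal.ofReal_mul (abs_nonneg _)]
      _ = _ := hli.symm
      _ = ∫⁻ y, ENNReal.ofReal (bump ε y) := by
          refine setLIntegral_eq_of_support_subset ?_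
          intro y hy
          apply hsub
          by_contra hno
          apply hy
          have : ¬ |y| < ε := fun h => hno ⟨by linarith [(abs_lt.1 h).1, hε.2],
            by linarith [(abs_lt.1 h).2, hε.2]⟩
          simp [bump, this]
      _ = 1 := lintegral_bump hε0
  rw [h1]; simp

/-- Kac's counting formula. -/
lemma kac_counting {f f' : ℝ → ℝ} (hf : ∀ t, HasDerivAt f (f' t) t) (hc : Continuous f') (n : ℕ) :
    ∀ {a b : ℝ} (_ : a ≤ b) (S : Finset ℝ) (_ : S.card = n)
      (_ : ∀ t, t ∈ S ↔ t ∈ Set.Icc a b ∧ f t = 0) (_ : f a ≠ 0) (_ : f b ≠ 0)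
      (_ : ∀ t ∈ S, f' t ≠ 0),
    ∀ᶠ ε in nhdsWithin (0 : ℝ) (Set.Ioi 0), ∫ t in a..b, bump ε (f t) * |f' t| = n := by
  have hfc : Continuous f := continuous_iff_continuousAt.2 fun t => (hf t).continuousAt
  induction n with
  | zero =>
    intro a b hab S hS hz _ _ _
    rw [Finset.card_eq_zero] at hS
    subst hS
    simpa using integral_bump_eq_zero (f' := f') hfc hab
      (fun t ht h => by simpa using (hz t).2 ⟨ht, h⟩)
  | succ n ih =>
    intro a b hab S hS hz ha hb hd
    have hne : S.Nonempty := Finset.card_pos.1 (by omega)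
    set z := S.min' hne with hzdef
    have hzS : z ∈ S := S.min'_mem hne
    obtain ⟨hzI, hz0⟩ := (hz z).1 hzS
    have haz : a < z := lt_of_le_of_ne hzI.1 (by rintro h; rw [h] at ha; exact ha hz0)
    have hzb : z < b := lt_of_le_of_ne hzI.2 (by rintro h; rw [← h] at hb; exact hb hz0)
    have hev : ∀ᶠ t in nhds z, f' t ≠ 0 ∧ (f t = 0 → t = z) ∧ a < t ∧ t < b := by
      have h1 : ∀ᶠ t in nhds z, f' t ≠ 0 := hc.continuousAt.eventually_ne (hd z hzS)
      have h2 := (hf z).eventually_ne (hd z hzS) (c := 0)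
      rw [eventually_nhdsWithin_iff] at h2
      filter_upwards [h1, h2, lt_mem_nhds haz, gt_mem_nhds hzb] with t h1 h2 h3 h4
      exact ⟨h1, fun h => by_contra fun hne => h2 hne h, h3, h4⟩
    obtain ⟨δ', hδ', hball⟩ := Metric.eventually_nhds_iff.1 hev
    set δ := δ' / 2 with hδdef
    have hδ : 0 < δ := by positivity
    have hnear : ∀ t ∈ Set.Icc (z - δ) (z + δ),
        f' t ≠ 0 ∧ (f t = 0 → t = z) ∧ a < t ∧ t < b := fun t ht => hball (by
      rw [Real.dist_eq, abs_lt]; constructor <;> linarith [ht.1, ht.2])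
    have hlI := hnear (z - δ) ⟨le_rfl, by linarith⟩
    have hrI := hnear (z + δ) ⟨by linarith, le_rfl⟩
    have e1 := integral_bump_eq_zero (f' := f') hfc hlI.2.2.1.le (fun t ht h => by
      have := S.min'_le t ((hz t).2 ⟨⟨ht.1, by linarith [ht.2]⟩, h⟩)
      have h2 := ht.2
      linarith)
    have e2 := integral_bump_eq_one hf hc hδ hz0 (fun t ht => (hnear t ht).1)
    have e3 := ih hrI.2.2.2.le (S.erase z) (by rw [Finset.card_erase_of_mem hzS]; omega) (by
        intro t
        rw [Finset.mem_erase, hz]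
        constructor
        · rintro ⟨hne, ht, h0⟩
          refine ⟨⟨?_, ht.2⟩, h0⟩
          by_contra hlt
          have hmin := S.min'_le t ((hz t).2 ⟨ht, h0⟩)
          exact hne ((hnear t ⟨by linarith, by linarith⟩).2.1 h0)
        · rintro ⟨ht, h0⟩
          exact ⟨by have := ht.1; intro h; rw [h] at this; linarith,
            ⟨by linarith [ht.1], ht.2⟩, h0⟩)
      (fun h => by linarith [hrI.2.1 h]) hb
      (fun t ht => hd t (Finset.mem_of_mem_erase ht))
    filter_upwards [e1, e2, e3, self_mem_nhdsWithin] with ε e1 e2 e3 hε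
    have hi := fun x y => bump_abs_intervalIntegrable hfc hc (ε := ε) hε x y
    rw [← intervalIntegral.integral_add_adjacent_intervals (hi a (z - δ)) (hi (z - δ) b),
      ← intervalIntegral.integral_add_adjacent_intervals (hi (z - δ) (z + δ)) (hi (z + δ) b),
      e1, e2, e3]
    push_cast; ring

/-- Kac's counting formula for functions without double zeros. -/
lemma kac_counting_ncard {f f' : ℝ → ℝ} (hf : ∀ t, HasDerivAt f (f' t) t) (hc : Continuous f')
    {a b : ℝ} (hab : a ≤ b) (ha : f a ≠ 0) (hb : f b ≠ 0)
    (hd : ∀ t ∈ Set.Icc a b, ¬(f t = 0 ∧ f' t = 0)) :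
    ∀ᶠ ε in nhdsWithin (0 : ℝ) (Set.Ioi 0), ∫ t in a..b, bump ε (f t) * |f' t|
      = (Set.ncard {t | t ∈ Set.Icc a b ∧ f t = 0} : ℝ) := by
  have hfc : Continuous f := continuous_iff_continuousAt.2 fun t => (hf t).continuousAt
  set Z := {t | t ∈ Set.Icc a b ∧ f t = 0} with hZ
  have hfin : Z.Finite := by
    by_contra hinf
    obtain ⟨x, hx, hacc⟩ := Set.Infinite.exists_accPt_of_subset_isCompact hinf
      (isCompact_Icc (a := a) (b := b)) (fun t ht => ht.1)
    have hcl : IsClosed Z := isClosed_Icc.inter (isClosed_eq hfc continuous_const)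
    have hxZ : x ∈ Z := by
      have := hacc.clusterPt
      exact hcl.closure_subset (mem_closure_iff_clusterPt.2 this)
    have h2 := (hf x).eventually_ne (fun h => hd x hx ⟨hxZ.2, h⟩) (c := 0)
    have h3 := accPt_iff_frequently_nhdsNE.1 hacc
    exact h3 (h2.mono fun t ht h => ht h.2)
  have := kac_counting hf hc _ hab hfin.toFinset rfl (fun t => by
    rw [hfin.mem_toFinset]; rfl) ha hb (fun t ht h => by
      rw [hfin.mem_toFinset] at ht
      exact hd t ht.1 ⟨ht.2, h⟩)
  rw [Set.ncard_eq_toFinset_card _ hfin]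
  exact this

lemma ae_prod_of_ae_of_ae {α β : Type*} [MeasurableSpace α] [MeasurableSpace β] {μ : Measure α}
    {ν : Measure β} [SFinite μ] [SFinite ν] {p : α → Prop} {q : β → Prop} (hp : ∀ᵐ x ∂μ, p x)
    (hq : ∀ᵐ y ∂ν, q y) : ∀ᵐ z ∂(μ.prod ν), p z.1 ∧ q z.2 :=
  (Measure.quasiMeasurePreserving_fst.ae hp).and (Measure.quasiMeasurePreserving_snd.ae hq)

/-- The covariance of two integrals of a random field is the double integral of covariances. -/
lemma cov_integral {Ω : Type*} [MeasurableSpace Ω] {P : Measure Ω} [IsProbabilityMeasure P]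
    {G : Ω → ℝ → ℝ} (hG : Measurable (Function.uncurry G)) {ν ν' : Measure ℝ} [IsFiniteMeasure ν]
    [IsFiniteMeasure ν'] {V : ℝ}
    (h : ∀ᵐ t ∂ν, Integrable (fun ω => G ω t ^ 2) P ∧ ∫ ω, G ω t ^ 2 ∂P ≤ V)
    (h' : ∀ᵐ t ∂ν', Integrable (fun ω => G ω t ^ 2) P ∧ ∫ ω, G ω t ^ 2 ∂P ≤ V) :
    (∫ ω, (∫ t, G ω t ∂ν) * (∫ s, G ω s ∂ν') ∂P)
      - (∫ ω, ∫ t, G ω t ∂ν ∂P) * (∫ ω, ∫ s, G ω s ∂ν' ∂P)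
      = ∫ z, (∫ ω, G ω z.1 * G ω z.2 ∂P
        - (∫ ω, G ω z.1 ∂P) * ∫ ω, G ω z.2 ∂P) ∂(ν.prod ν') := by
  have hGt : ∀ t, Measurable (fun ω => G ω t) := fun t => hG.comp measurable_prodMk_right
  have hmG : Measurable (fun p : Ω × ℝ × ℝ => G p.1 p.2.1 * G p.1 p.2.2) :=
    (hG.comp (by fun_prop : Measurable fun p : Ω × ℝ × ℝ => (p.1, p.2.1))).mul
      (hG.comp (by fun_prop : Measurable fun p : Ω × ℝ × ℝ => (p.1, p.2.2)))
  have hi2 : Integrable (fun p : Ω × ℝ × ℝ => G p.1 p.2.1 * G p.1 p.2.2)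
      (P.prod (ν.prod ν')) := by
    rw [integrable_prod_iff' hmG.aestronglyMeasurable]
    have hb : ∀ᵐ z ∂(ν.prod ν'), Integrable (fun ω => G ω z.1 * G ω z.2) P ∧
        ∫ ω, ‖G ω z.1 * G ω z.2‖ ∂P ≤ V := by
      filter_upwards [ae_prod_of_ae_of_ae h h'] with z hz
      obtain ⟨⟨h1, h2⟩, h3, h4⟩ := hz
      have hle : ∀ ω, ‖G ω z.1 * G ω z.2‖ ≤ G ω z.1 ^ 2 / 2 + G ω z.2 ^ 2 / 2 := fun ω => by
        rw [Real.norm_eq_abs, abs_le]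
        constructor <;> nlinarith [sq_nonneg (G ω z.1 + G ω z.2), sq_nonneg (G ω z.1 - G ω z.2)]
      have hs := (h1.div_const 2).add (h3.div_const 2)
      have hint : Integrable (fun ω => G ω z.1 * G ω z.2) P :=
        hs.mono' ((hGt _).mul (hGt _)).aestronglyMeasurable (Filter.Eventually.of_forall hle)
      refine ⟨hint, (integral_mono hint.norm hs hle).trans ?_⟩
      simp only [Pi.add_apply]
      rw [integral_add (h1.div_const 2) (h3.div_const 2), integral_div, integral_div]
      linarith
    refine ⟨hb.mono fun z hz => hz.1, ?_⟩
    refine Integrable.of_bound ?_ V (hb.mono fun z hz => ?_)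
    · exact (hmG.comp measurable_swap).aestronglyMeasurable.norm.integral_prod_right'
    · rw [Real.norm_of_nonneg (integral_nonneg fun _ => norm_nonneg _)]; exact hz.2
  have hone : ∀ {η : Measure ℝ} [IsFiniteMeasure η],
      (∀ᵐ t ∂η, Integrable (fun ω => G ω t ^ 2) P ∧ ∫ ω, G ω t ^ 2 ∂P ≤ V) →
      Integrable (Function.uncurry G) (P.prod η) := by
    intro η _ hη
    rw [integrable_prod_iff' hG.aestronglyMeasurable]
    have hb : ∀ᵐ t ∂η, Integrable (fun ω => G ω t) P ∧ ∫ ω, ‖G ω t‖ ∂P ≤ 1 + V := by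
      filter_upwards [hη] with t ht
      have hle : ∀ ω, ‖G ω t‖ ≤ 1 + G ω t ^ 2 := fun ω => by
        rw [Real.norm_eq_abs, abs_le]
        constructor <;> nlinarith [sq_nonneg (G ω t + 1), sq_nonneg (G ω t - 1)]
      have hs := (integrable_const (μ := P) (1 : ℝ)).add ht.1
      have hint : Integrable (fun ω => G ω t) P :=
        hs.mono' (hGt _).aestronglyMeasurable (Filter.Eventually.of_forall hle)
      refine ⟨hint, (integral_mono hint.norm hs hle).trans ?_⟩
      simp only [Pi.add_apply]
      rw [integral_add (integrable_const _) ht.1]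
      simp; linarith [ht.2]
    refine ⟨hb.mono fun z hz => hz.1, ?_⟩
    refine Integrable.of_bound ?_ (1 + V) (hb.mono fun z hz => ?_)
    · exact (hG.comp measurable_swap).aestronglyMeasurable.norm.integral_prod_right'
    · rw [Real.norm_of_nonneg (integral_nonneg fun _ => norm_nonneg _)]; exact hz.2
  have e1 : ∫ ω, (∫ t, G ω t ∂ν) * (∫ s, G ω s ∂ν') ∂P
      = ∫ z, ∫ ω, G ω z.1 * G ω z.2 ∂P ∂(ν.prod ν') := by
    simp_rw [← integral_prod_mul]
    exact integral_integral_swap (f := fun ω (z : ℝ × ℝ) => G ω z.1 * G ω z.2) hi2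
  have e2 : (∫ ω, ∫ t, G ω t ∂ν ∂P) * (∫ ω, ∫ s, G ω s ∂ν' ∂P)
      = ∫ z, (∫ ω, G ω z.1 ∂P) * ∫ ω, G ω z.2 ∂P ∂(ν.prod ν') := by
    rw [integral_integral_swap (f := G) (hone h), integral_integral_swap (f := G) (hone h'),
      ← integral_prod_mul]
  rw [e1, e2, integral_sub]
  · exact hi2.integral_prod_right
  · exact (hone h).integral_prod_right.mul_prod (hone h').integral_prod_right

/-- The normalised covariances of the derivatives. -/
def corr {ι : Type} [Fintype ι] (u : ι → ℝ → ℝ) (σ : ℝ) (a b : Fin 2) (t s : ℝ) : ℝ :=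
  (∑ i, dk u a t i * dk u b s i) / σ ^ ((a : ℕ) + b)

/-- The total size of the normalised covariances. -/
def corrSq {ι : Type} [Fintype ι] (u : ι → ℝ → ℝ) (σ t s : ℝ) : ℝ :=
  ∑ a : Fin 2, ∑ b : Fin 2, corr u σ a b t s ^ 2

lemma continuous_corrSq {ι : Type} [Fintype ι] {u : ι → ℝ → ℝ}
    (hu : ∀ i, ContDiff ℝ (⊤ : ℕ∞) (u i)) (σ : ℝ) :
    Continuous (fun z : ℝ × ℝ => corrSq u σ z.1 z.2) := by
  have := fun k i => continuous_dk hu k i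
  unfold corrSq corr
  fun_prop

lemma corrSq_nonneg {ι : Type} [Fintype ι] (u : ι → ℝ → ℝ) (σ t s : ℝ) : 0 ≤ corrSq u σ t s :=
  Finset.sum_nonneg fun _ _ => Finset.sum_nonneg fun _ _ => sq_nonneg _

lemma corr_sq_le_corrSq {ι : Type} [Fintype ι] (u : ι → ℝ → ℝ) (σ : ℝ) (a b : Fin 2) (t s : ℝ) :
    corr u σ a b t s ^ 2 ≤ corrSq u σ t s :=
  (Finset.single_le_sum (f := fun b => corr u σ a b t s ^ 2) (fun _ _ => sq_nonneg _)
    (Finset.mem_univ b)).trans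
  (Finset.single_le_sum (f := fun a => ∑ b, corr u σ a b t s ^ 2)
    (fun _ _ => Finset.sum_nonneg fun _ _ => sq_nonneg _) (Finset.mem_univ a))

lemma cov_kac_le {ι : Type} [Fintype ι] {u : ι → ℝ → ℝ} {L σ B : ℝ} (hp : IsProc u L σ B)
    {ε : ℝ} (hε : 0 < ε) (hε' : ε ≤ 1 / 2) {t s : ℝ} (ht : t ∈ Set.Icc 0 L) (hs : s ∈ Set.Icc 0 L)
    (hS : corrSq u σ t s ≤ 1 / 16) :
    |∫ ω, kac ε (proc u 0 t ω) (proc u 1 t ω) * kac ε (proc u 0 s ω) (proc u 1 s ω) ∂(stdG ι)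
      - (∫ ω, kac ε (proc u 0 t ω) (proc u 1 t ω) ∂(stdG ι))
        * ∫ ω, kac ε (proc u 0 s ω) (proc u 1 s ω) ∂(stdG ι)|
      ≤ covC * σ ^ 2 * corrSq u σ t s := by
  have hσ := hp.σ_pos
  set c : Fin 4 → ι → ℝ := ![dk u 0 t, fun i => dk u 1 t i / σ, dk u 0 s,
    fun i => dk u 1 s i / σ] with hc
  have key := kac_cov_le c (fun a b => corr u σ a b t s) (ρ := √(corrSq u σ t s))
    (Real.sqrt_nonneg _) (by
      rw [Real.sqrt_le_left (by norm_num)]; norm_num at hS ⊢; exact hS) hε hε'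
    (by simp [hc, hp.g00 t ht])
    (by
      simp only [hc, Matrix.cons_val_one, Matrix.cons_val_zero, div_mul_div_comm,
        ← Finset.sum_div, hp.g11 t ht]
      field_simp)
    (by
      simp only [hc, Matrix.cons_val_one, Matrix.cons_val_zero, mul_div_assoc',
        ← Finset.sum_div, hp.g01 t ht]
      simp)
    (by simp [hc, hp.g00 s hs])
    (by
      simp only [hc, Matrix.cons_val, div_mul_div_comm,
        ← Finset.sum_div, hp.g11 s hs]
      field_simp)
    (by
      simp only [hc, Matrix.cons_val, mul_div_assoc',
        ← Finset.sum_div, hp.g01 s hs]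
      simp)
    (by simp [hc, corr])
    (by simp [hc, corr, mul_div_assoc', ← Finset.sum_div])
    (by simp [hc, corr, div_mul_eq_mul_div, ← Finset.sum_div])
    (by
      simp only [hc, corr, Matrix.cons_val, div_mul_div_comm, ← Finset.sum_div]
      norm_num [pow_succ])
    (fun a b => by
      rw [← Real.sqrt_sq_eq_abs]
      exact Real.sqrt_le_sqrt (corr_sq_le_corrSq u σ a b t s))
  rw [Real.sq_sqrt (corrSq_nonneg _ _ _ _)] at key
  have hdiv : ∀ r ω, lin (fun i => dk u 1 r i / σ) ω = proc u 1 r ω / σ := by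
    intro r ω
    simp only [proc, lin, Finset.sum_div, div_mul_eq_mul_div]
  have hk : ∀ x y, kac ε x (y / σ) = σ⁻¹ * kac ε x y := by
    intro x y
    simp only [kac, abs_div, abs_of_pos hσ]; ring
  simp only [hc, Matrix.cons_val, hdiv, hk, integral_const_mul] at key
  have e : ∀ ω, σ⁻¹ * kac ε (lin (dk u 0 t) ω) (proc u 1 t ω)
      * (σ⁻¹ * kac ε (lin (dk u 0 s) ω) (proc u 1 s ω))
      = σ⁻¹ ^ 2 * (kac ε (proc u 0 t ω) (proc u 1 t ω) * kac ε (proc u 0 s ω) (proc u 1 s ω)) := by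
    intro ω; simp only [proc]; ring
  simp only [e, integral_const_mul] at key
  have e2 : ∀ X Y Z : ℝ, σ⁻¹ ^ 2 * X - σ⁻¹ * Y * (σ⁻¹ * Z) = (σ ^ 2)⁻¹ * (X - Y * Z) := by
    intro X Y Z; field_simp
  rw [e2, abs_mul, abs_of_pos (by positivity), inv_mul_le_iff₀ (by positivity)] at key
  refine le_trans key (le_of_eq ?_)
  ring

lemma covC_nonneg : 0 ≤ covC := by
  unfold covC
  have : 0 ≤ ∫ v, domQ2 v ∂(stdG (Fin 4)) := integral_nonneg fun v => domQ2_nonneg v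
  positivity

lemma abs_sum_mul_le {ι : Type*} [Fintype ι] (x y : ι → ℝ) {X Y : ℝ} (hX : 0 ≤ X) (hY : 0 ≤ Y)
    (hx : ∑ i, x i ^ 2 ≤ X ^ 2) (hy : ∑ i, y i ^ 2 ≤ Y ^ 2) : |∑ i, x i * y i| ≤ X * Y := by
  apply abs_le_of_sq_le_sq _ (by positivity)
  rw [mul_pow]
  exact (Finset.sum_mul_sq_le_sq_mul_sq _ _ _).trans
    (mul_le_mul hx hy (Finset.sum_nonneg fun _ _ => sq_nonneg _) (sq_nonneg _))

lemma hasDerivAt_dk {ι : Type} {u : ι → ℝ → ℝ}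
    (hu : ∀ i, ContDiff ℝ (⊤ : ℕ∞) (u i)) (k : ℕ) (i : ι) (t : ℝ) :
    HasDerivAt (fun t => dk u k t i) (dk u (k + 1) t i) t := by
  simp only [dk]
  rw [iteratedDeriv_succ]
  exact (((hu i).differentiable_iteratedDeriv k
    (by exact_mod_cast WithTop.coe_lt_top _)) t).hasDerivAt

lemma corr_symm {ι : Type} [Fintype ι] (u : ι → ℝ → ℝ) (σ : ℝ) (a b : Fin 2) (t s : ℝ) :
    corr u σ a b t s = corr u σ b a s t := by
  simp only [corr, mul_comm, add_comm]

lemma corr_lipschitz_left {ι : Type} [Fintype ι] {u : ι → ℝ → ℝ} {L σ B : ℝ}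
    (hp : IsProc u L σ B) (hB : 0 ≤ B) (a b : Fin 2) {t t' s : ℝ} (ht : t ∈ Set.Icc 0 L)
    (ht' : t' ∈ Set.Icc 0 L) (hs : s ∈ Set.Icc 0 L) :
    |corr u σ a b t s - corr u σ a b t' s| ≤ B ^ 2 * σ * |t - t'| := by
  have hσ := hp.σ_pos
  have hd : ∀ r, HasDerivAt (fun r => corr u σ a b r s)
      ((∑ i, dk u (a + 1) r i * dk u b s i) / σ ^ ((a : ℕ) + b)) r := by
    intro r
    unfold corr
    exact (HasDerivAt.fun_sum fun i _ => (hasDerivAt_dk hp.smooth a i r).mul_const _).div_const _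
  refine (convex_Icc 0 L).norm_image_sub_le_of_norm_hasDerivWithin_le
    (fun r _ => (hd r).hasDerivWithinAt) (fun r hr => ?_) ht' ht
  rw [Real.norm_eq_abs, abs_div, abs_of_pos (pow_pos hσ _), div_le_iff₀ (pow_pos hσ _)]
  have hga := hp.gk (a + 1) (by omega) r hr
  have hgb := hp.gk b (by omega) s hs
  refine (abs_sum_mul_le _ _ (X := B * σ ^ ((a : ℕ) + 1)) (Y := B * σ ^ (b : ℕ)) (by positivity)
    (by positivity) (hga.trans (le_of_eq (by ring))) (hgb.trans (le_of_eq (by ring)))).trans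
    (le_of_eq (by ring))

lemma corr_lipschitz {ι : Type} [Fintype ι] {u : ι → ℝ → ℝ} {L σ B : ℝ}
    (hp : IsProc u L σ B) (hB : 0 ≤ B) (a b : Fin 2) {t t' s s' : ℝ} (ht : t ∈ Set.Icc 0 L)
    (ht' : t' ∈ Set.Icc 0 L) (hs : s ∈ Set.Icc 0 L) (hs' : s' ∈ Set.Icc 0 L) :
    |corr u σ a b t s - corr u σ a b t' s'| ≤ B ^ 2 * σ * (|t - t'| + |s - s'|) := by
  have h1 := corr_lipschitz_left hp hB a b ht ht' hs
  have h2 := corr_lipschitz_left hp hB b a hs hs' ht'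
  rw [corr_symm, corr_symm u σ b a s' t'] at h2
  calc _ = |(corr u σ a b t s - corr u σ a b t' s)
        + (corr u σ a b t' s - corr u σ a b t' s')| := by ring_nf
    _ ≤ _ := abs_add_le _ _
    _ ≤ _ := by linarith

lemma memLp_smoothCount {ι : Type} [Fintype ι] {u : ι → ℝ → ℝ} {L σ B : ℝ}
    (hp : IsProc u L σ B) {ε : ℝ} (hε : 0 < ε) {a h : ℝ} (hh : 0 < h) (ha : 0 ≤ a)
    (hah : a + h ≤ L) (hη : h * σ ≤ 1) :
    MemLp (smoothCount u ε a (a + h)) 2 (stdG ι) ∧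
      ∫ ω, smoothCount u ε a (a + h) ω ^ 2 ∂(stdG ι) ≤ 225 + 200 * B ^ 2 := by
  have hm := measurable_smoothCount hp.smooth ε (show a ≤ a + h by linarith)
  have h2 := smoothCount_second_moment hp hε hh ha hah hη
  have hi : Integrable (fun ω => smoothCount u ε a (a + h) ω ^ 2) (stdG ι) := by
    refine ⟨(hm.pow_const 2).aestronglyMeasurable, ?_⟩
    rw [hasFiniteIntegral_iff_ofReal (Filter.Eventually.of_forall fun _ => sq_nonneg _)]
    exact lt_of_le_of_lt h2 ENNReal.ofReal_lt_top
  refine ⟨(memLp_two_iff_integrable_sq hm.aestronglyMeasurable).2 hi, ?_⟩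
  rw [integral_eq_lintegral_of_nonneg_ae (Filter.Eventually.of_forall fun _ => sq_nonneg _)
    hi.aestronglyMeasurable]
  exact ENNReal.toReal_le_of_le_ofReal (by positivity) h2

lemma abs_cov_le_of_sq {Ω : Type*} [MeasurableSpace Ω] {P : Measure Ω} [IsProbabilityMeasure P]
    {X Y : Ω → ℝ} (hX : MemLp X 2 P) (hY : MemLp Y 2 P) {M : ℝ} (hXM : ∫ ω, X ω ^ 2 ∂P ≤ M)
    (hYM : ∫ ω, Y ω ^ 2 ∂P ≤ M) :
    |∫ ω, X ω * Y ω ∂P - (∫ ω, X ω ∂P) * ∫ ω, Y ω ∂P| ≤ 2 * M := by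
  have h1 : |∫ ω, X ω * Y ω ∂P| ≤ M := by
    have hi := (hX.integrable_sq.div_const 2).add (hY.integrable_sq.div_const 2)
    rw [← Real.norm_eq_abs]
    refine (norm_integral_le_of_norm_le hi (Filter.Eventually.of_forall fun ω => ?_)).trans ?_
    · simp only [Pi.add_apply, Real.norm_eq_abs]
      rw [abs_le]
      constructor <;> nlinarith [sq_nonneg (X ω + Y ω), sq_nonneg (X ω - Y ω)]
    · simp only [Pi.add_apply]
      rw [integral_add (hX.integrable_sq.div_const 2) (hY.integrable_sq.div_const 2),
        integral_div, integral_div]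
      linarith
  have hsq : ∀ {Z : Ω → ℝ}, MemLp Z 2 P → (∫ ω, Z ω ∂P) ^ 2 ≤ ∫ ω, Z ω ^ 2 ∂P := by
    intro Z hZ
    have := variance_nonneg Z P
    rw [variance_eq_sub hZ] at this
    simp only [Pi.pow_apply] at this
    linarith
  have h2 : |(∫ ω, X ω ∂P) * ∫ ω, Y ω ∂P| ≤ M := by
    have h3 := hsq hX
    have h4 := hsq hY
    rw [abs_le]
    constructor <;> nlinarith [sq_nonneg (∫ ω, X ω ∂P + ∫ ω, Y ω ∂P),
      sq_nonneg (∫ ω, X ω ∂P - ∫ ω, Y ω ∂P)]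
  exact (abs_sub _ _).trans (by linarith)

lemma integral_prod_Ioc_eq {f : ℝ × ℝ → ℝ} (hf : Continuous f) {a b c d : ℝ} (hab : a ≤ b)
    (hcd : c ≤ d) :
    Integrable f ((volume.restrict (Set.Ioc a b)).prod (volume.restrict (Set.Ioc c d))) ∧
    ∫ z, f z ∂((volume.restrict (Set.Ioc a b)).prod (volume.restrict (Set.Ioc c d)))
      = ∫ t in a..b, ∫ s in c..d, f (t, s) := by
  have hi : Integrable f
      ((volume.restrict (Set.Ioc a b)).prod (volume.restrict (Set.Ioc c d))) := by
    rw [Measure.prod_restrict]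
    refine (hf.continuousOn.integrableOn_compact
      (isCompact_Icc.prod isCompact_Icc : IsCompact (Set.Icc a b ×ˢ Set.Icc c d))).mono_set ?_
    exact Set.prod_mono Set.Ioc_subset_Icc_self Set.Ioc_subset_Icc_self
  refine ⟨hi, ?_⟩
  rw [integral_prod _ hi, intervalIntegral.integral_of_le hab]
  simp_rw [intervalIntegral.integral_of_le hcd]

lemma cov_square_le {ι : Type} [Fintype ι] {u : ι → ℝ → ℝ} {L σ B : ℝ} (hp : IsProc u L σ B)
    (hB : 0 ≤ B) {ε : ℝ} (hε : 0 < ε) (hε' : ε ≤ 1 / 2) {a a' h η : ℝ} (hh : 0 < h) (ha : 0 ≤ a)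
    (hah : a + h ≤ L) (ha' : 0 ≤ a') (hah' : a' + h ≤ L) (hhσ : h * σ ≤ 1)
    (hhB : B ^ 2 * (h * σ) ≤ 1 / 32) (hη : 0 < η) (hηh : η ≤ h * σ) :
    |∫ ω, smoothCount u ε a (a + h) ω * smoothCount u ε a' (a' + h) ω ∂(stdG ι)
      - (∫ ω, smoothCount u ε a (a + h) ω ∂(stdG ι))
        * ∫ ω, smoothCount u ε a' (a' + h) ω ∂(stdG ι)|
      ≤ (covC + 512 * (225 + 200 * B ^ 2) / η ^ 2) * σ ^ 2
        * ∫ t in a..(a + h), ∫ s in a'..(a' + h), corrSq u σ t s := by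
  have hσ := hp.σ_pos
  have hcC := covC_nonneg
  set S : ℝ × ℝ → ℝ := fun z => corrSq u σ z.1 z.2 with hS
  have hSc : Continuous S := continuous_corrSq hp.smooth σ
  obtain ⟨hSi, hSe⟩ := integral_prod_Ioc_eq hSc (show a ≤ a + h by linarith)
    (show a' ≤ a' + h by linarith)
  have hI : ∀ {t}, t ∈ Set.Icc a (a + h) → t ∈ Set.Icc 0 L := fun ht =>
    ⟨ha.trans ht.1, ht.2.trans hah⟩
  have hI' : ∀ {t}, t ∈ Set.Icc a' (a' + h) → t ∈ Set.Icc 0 L := fun ht =>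
    ⟨ha'.trans ht.1, ht.2.trans hah'⟩
  change _ ≤ _ * ∫ t in a..(a + h), ∫ s in a'..(a' + h), S (t, s)
  have hint0 : 0 ≤ ∫ t in a..(a + h), ∫ s in a'..(a' + h), S (t, s) :=
    intervalIntegral.integral_nonneg (by linarith) fun _ _ =>
      intervalIntegral.integral_nonneg (by linarith) fun _ _ => corrSq_nonneg _ _ _ _
  by_cases hns : ∀ t ∈ Set.Icc a (a + h), ∀ s ∈ Set.Icc a' (a' + h), corrSq u σ t s ≤ 1 / 16
  · have hV : ∀ b, 0 ≤ b → b + h ≤ L → ∀ᵐ t ∂(volume.restrict (Set.Ioc b (b + h))),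
        Integrable (fun ω => kac ε (proc u 0 t ω) (proc u 1 t ω) ^ 2) (stdG ι) ∧
        ∫ ω, kac ε (proc u 0 t ω) (proc u 1 t ω) ^ 2 ∂(stdG ι) ≤ (2 * ε)⁻¹ ^ 2 * σ ^ 2 := by
      intro b hb hbh
      filter_upwards [ae_restrict_mem measurableSet_Ioc] with t ht
      have htI : t ∈ Set.Icc 0 L := ⟨by linarith [ht.1], by linarith [ht.2]⟩
      have hle : ∀ ω, kac ε (proc u 0 t ω) (proc u 1 t ω) ^ 2
          ≤ (2 * ε)⁻¹ ^ 2 * proc u 1 t ω ^ 2 := by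
        intro ω
        rw [kac, mul_pow, sq_abs]
        gcongr
        · exact bump_nonneg hε _
        · exact bump_le hε _
      have hd : Integrable (fun ω => (2 * ε)⁻¹ ^ 2 * proc u 1 t ω ^ 2) (stdG ι) :=
        (memLp_lin (dk u 1 t) 2 (by simp)).integrable_sq.const_mul _
      have hm : Measurable (fun ω => kac ε (proc u 0 t ω) (proc u 1 t ω) ^ 2) :=
        ((measurable_kac_proc hp.smooth ε).comp measurable_prodMk_right).pow_const 2
      have hint := hd.mono' hm.aestronglyMeasurable (Filter.Eventually.of_forall fun ω => by
        rw [Real.norm_of_nonneg (sq_nonneg _)]; exact hle ω)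
      refine ⟨hint, (integral_mono hint hd hle).trans ?_⟩
      rw [integral_const_mul]
      have := integral_lin_sq (dk u 1 t)
      have e : ∑ i, dk u 1 t i ^ 2 = σ ^ 2 := by rw [← hp.g11 t htI]; simp only [sq]
      rw [e] at this
      unfold proc
      rw [this]
    have hcov := cov_integral (P := stdG ι)
      (G := fun ω t => kac ε (proc u 0 t ω) (proc u 1 t ω))
      (measurable_kac_proc hp.smooth ε) (hV a ha hah) (hV a' ha' hah')
    have hz : ∀ b ω, smoothCount u ε b (b + h) ω
        = ∫ t in Set.Ioc b (b + h), kac ε (proc u 0 t ω) (proc u 1 t ω) := fun b ω => by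
      rw [smoothCount, intervalIntegral.integral_of_le (by linarith)]; rfl
    simp_rw [hz]
    rw [hcov, ← hSe]
    calc _ ≤ ∫ z, covC * σ ^ 2 * S z ∂((volume.restrict (Set.Ioc a (a + h))).prod
          (volume.restrict (Set.Ioc a' (a' + h)))) := by
          rw [← Real.norm_eq_abs]
          refine norm_integral_le_of_norm_le (hSi.const_mul _) ?_
          filter_upwards [ae_prod_of_ae_of_ae (ae_restrict_mem (μ := volume)
            (measurableSet_Ioc (a := a) (b := a + h))) (ae_restrict_mem (μ := volume)
            (measurableSet_Ioc (a := a') (b := a' + h)))] with z hz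
          have h1 := Set.Ioc_subset_Icc_self hz.1
          have h2 := Set.Ioc_subset_Icc_self hz.2
          exact cov_kac_le hp hε hε' (hI h1) (hI' h2) (hns _ h1 _ h2)
      _ = covC * σ ^ 2 * ∫ z, S z ∂((volume.restrict (Set.Ioc a (a + h))).prod
          (volume.restrict (Set.Ioc a' (a' + h)))) := integral_const_mul _ _
      _ ≤ _ := by
          rw [← hSe] at hint0
          gcongr
          have : 0 ≤ 512 * (225 + 200 * B ^ 2) / η ^ 2 := by positivity
          linarith
  · push Not at hns
    obtain ⟨t₀, ht₀, s₀, hs₀, hlt⟩ := hns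
    have hex : ∃ x y : Fin 2, 1 / 8 < |corr u σ x y t₀ s₀| := by
      by_contra hno
      push Not at hno
      have : corrSq u σ t₀ s₀ ≤ ∑ a : Fin 2, ∑ b : Fin 2, (1 / 8 : ℝ) ^ 2 := by
        refine Finset.sum_le_sum fun x _ => Finset.sum_le_sum fun y _ => ?_
        rw [← sq_abs]
        have := hno x y
        gcongr
      norm_num at this
      linarith
    obtain ⟨x, y, hxy⟩ := hex
    have hlow : ∀ t ∈ Set.Icc a (a + h), ∀ s ∈ Set.Icc a' (a' + h), 1 / 256 ≤ S (t, s) := by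
      intro t ht s hs
      have h1 := corr_lipschitz hp hB x y (hI ht₀) (hI ht) (hI' hs₀) (hI' hs)
      have h2 : |t₀ - t| ≤ h := by
        rw [abs_le]; constructor <;> linarith [ht.1, ht.2, ht₀.1, ht₀.2]
      have h3 : |s₀ - s| ≤ h := by
        rw [abs_le]; constructor <;> linarith [hs.1, hs.2, hs₀.1, hs₀.2]
      have h4 : B ^ 2 * σ * (|t₀ - t| + |s₀ - s|) ≤ 1 / 16 := by
        calc _ ≤ B ^ 2 * σ * (h + h) := by gcongr
          _ ≤ _ := by linarith
      have h5 := abs_sub_abs_le_abs_sub (corr u σ x y t₀ s₀) (corr u σ x y t s)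
      have h6 : 1 / 16 ≤ |corr u σ x y t s| := by linarith
      calc (1 / 256 : ℝ) = (1 / 16) ^ 2 := by norm_num
        _ ≤ |corr u σ x y t s| ^ 2 := by gcongr
        _ = corr u σ x y t s ^ 2 := sq_abs _
        _ ≤ _ := corr_sq_le_corrSq _ _ _ _ _ _
    have hintlow : h ^ 2 / 256 ≤ ∫ t in a..(a + h), ∫ s in a'..(a' + h), S (t, s) := by
      have hin : ∀ t ∈ Set.Icc a (a + h), h / 256 ≤ ∫ s in a'..(a' + h), S (t, s) := by
        intro t ht
        calc h / 256 = ∫ s in a'..(a' + h), (1 / 256 : ℝ) := by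
              rw [intervalIntegral.integral_const, smul_eq_mul]; ring
          _ ≤ _ := intervalIntegral.integral_mono_on (by linarith) (by simp)
            ((hSc.comp (by fun_prop : Continuous fun s : ℝ => (t, s))).intervalIntegrable _ _)
            (hlow t ht)
      calc h ^ 2 / 256 = ∫ t in a..(a + h), h / 256 := by
            rw [intervalIntegral.integral_const, smul_eq_mul]; ring
        _ ≤ _ := intervalIntegral.integral_mono_on (by linarith) (by simp)
          ((intervalIntegral.continuous_parametric_intervalIntegral_of_continuous'
            (f := fun t s => S (t, s)) hSc _ _).intervalIntegrable _ _) hin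
    obtain ⟨m1, m2⟩ := memLp_smoothCount hp hε hh ha hah hhσ
    obtain ⟨m3, m4⟩ := memLp_smoothCount hp hε hh ha' hah' hhσ
    refine (abs_cov_le_of_sq m1 m3 m2 m4).trans ?_
    calc 2 * (225 + 200 * B ^ 2)
        ≤ 512 * (225 + 200 * B ^ 2) / η ^ 2 * σ ^ 2 * (h ^ 2 / 256) := by
          have : 1 ≤ (h * σ) ^ 2 / η ^ 2 := by
            rw [one_le_div (by positivity)]; gcongr
          calc _ = 2 * (225 + 200 * B ^ 2) * 1 := by ring
            _ ≤ 2 * (225 + 200 * B ^ 2) * ((h * σ) ^ 2 / η ^ 2) := by gcongr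
            _ = _ := by ring
      _ ≤ _ := by
          gcongr
          linarith

/-- The length scale on which the process behaves like a polynomial. -/
def scaleC (B : ℝ) : ℝ := 1 / (32 * B ^ 2 + 1)

/-- The constant in the general variance bound. -/
def varC (B L : ℝ) : ℝ :=
  covC + 512 * (225 + 200 * B ^ 2) / (L * scaleC B / (L + scaleC B)) ^ 2

lemma scaleC_pos (B : ℝ) : 0 < scaleC B := by unfold scaleC; positivity

lemma sum_double_integral {S : ℝ × ℝ → ℝ} (hS : Continuous S) (x : ℕ → ℝ) (n : ℕ) :
    ∑ p ∈ Finset.range n, ∑ q ∈ Finset.range n,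
      ∫ t in (x p)..(x (p + 1)), ∫ s in (x q)..(x (q + 1)), S (t, s)
      = ∫ t in (x 0)..(x n), ∫ s in (x 0)..(x n), S (t, s) := by
  have hc : ∀ a b, Continuous (fun t => ∫ s in a..b, S (t, s)) := fun a b =>
    intervalIntegral.continuous_parametric_intervalIntegral_of_continuous'
      (f := fun t s => S (t, s)) hS a b
  rw [← intervalIntegral.sum_integral_adjacent_intervals
    (f := fun t => ∫ s in (x 0)..(x n), S (t, s)) fun k _ => (hc _ _).intervalIntegrable _ _]
  refine Finset.sum_congr rfl fun p _ => ?_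
  rw [← intervalIntegral.integral_finsetSum fun q _ => (hc _ _).intervalIntegrable _ _]
  refine intervalIntegral.integral_congr fun t _ => ?_
  exact intervalIntegral.sum_integral_adjacent_intervals fun k _ =>
    (hS.comp (by fun_prop : Continuous fun s : ℝ => (t, s))).intervalIntegrable _ _

lemma variance_smoothCount_le {ι : Type} [Fintype ι] {u : ι → ℝ → ℝ} {L σ B : ℝ}
    (hp : IsProc u L σ B) (hB : 0 ≤ B) (hL : 0 < L) (hσ1 : 1 ≤ σ) :
    ∃ M : ℝ, ∀ ε, 0 < ε → ε ≤ 1 / 2 → MemLp (smoothCount u ε 0 L) 2 (stdG ι) ∧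
      ∫ ω, smoothCount u ε 0 L ω ^ 2 ∂(stdG ι) ≤ M ∧
      variance (smoothCount u ε 0 L) (stdG ι)
        ≤ varC B L * σ ^ 2 * ∫ t in (0)..L, ∫ s in (0)..L, corrSq u σ t s := by
  have hσ := hp.σ_pos
  have hη := scaleC_pos B
  set η := scaleC B with hηdef
  set K := ⌈L * σ / η⌉₊ with hK
  have hKpos : 0 < K := Nat.ceil_pos.2 (by positivity)
  have hK0 : (0 : ℝ) < K := by exact_mod_cast hKpos
  have hKge : L * σ / η ≤ K := Nat.le_ceil _
  have hKle : (K : ℝ) ≤ L * σ / η + 1 := (Nat.ceil_lt_add_one (by positivity)).le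
  set h := L / K with hh
  have hh0 : 0 < h := by positivity
  have hKh : K * h = L := by rw [hh]; field_simp
  have hhη : h * σ ≤ η := by
    rw [hh, div_mul_eq_mul_div, div_le_iff₀ hK0]
    rwa [div_le_iff₀ hη, mul_comm (K : ℝ)] at hKge
  have hη1 : η ≤ 1 := by
    rw [hηdef, scaleC, div_le_one (by positivity)]
    nlinarith [sq_nonneg B]
  have hBη : B ^ 2 * η ≤ 1 / 32 := by
    rw [hηdef, scaleC, mul_one_div, div_le_div_iff₀ (by positivity) (by norm_num)]
    linarith
  have hlow : L * η / (L + η) ≤ h * σ := by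
    rw [hh, div_mul_eq_mul_div, div_le_div_iff₀ (by positivity) hK0]
    calc L * η * K ≤ L * η * (L * σ / η + 1) := by gcongr
      _ = L * (L * σ + η * 1) := by field_simp
      _ ≤ L * (L * σ + η * σ) := by gcongr
      _ = _ := by ring
  set x : ℕ → ℝ := fun i => i * h with hx
  have hxs : ∀ i, x (i + 1) = x i + h := fun i => by simp only [hx]; push_cast; ring
  have hx0 : x 0 = 0 := by simp [hx]
  have hxK : x K = L := hKh
  have hxn : ∀ i, 0 ≤ x i := fun i => by positivity
  have hxL : ∀ i ∈ Finset.range K, x i + h ≤ L := fun i hi => by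
    rw [← hxs, ← hKh]
    have : ((i + 1 : ℕ) : ℝ) ≤ K := by exact_mod_cast Finset.mem_range.1 hi
    simp only [hx]; gcongr
  have hhσ : h * σ ≤ 1 := hhη.trans hη1
  have hhB : B ^ 2 * (h * σ) ≤ 1 / 32 := le_trans (by gcongr) hBη
  refine ⟨K * (K * (225 + 200 * B ^ 2)), fun ε hε hε' => ?_⟩
  have hsum : ∀ ω, smoothCount u ε 0 L ω
      = ∑ i ∈ Finset.range K, smoothCount u ε (x i) (x i + h) ω := by
    intro ω
    have := smoothCount_sum hp.smooth hε x K ω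
    rw [hx0, hxK] at this
    rw [← this]
    simp only [hxs]
  have hmem := fun i hi => memLp_smoothCount hp hε hh0 (hxn i) (hxL i hi) hhσ
  have hfun : smoothCount u ε 0 L
      = fun ω => ∑ i ∈ Finset.range K, smoothCount u ε (x i) (x i + h) ω := funext hsum
  have hm2 : MemLp (smoothCount u ε 0 L) 2 (stdG ι) := by
    rw [hfun]
    exact memLp_finsetSum _ fun i hi => (hmem i hi).1
  refine ⟨hm2, ?_, ?_⟩
  · calc ∫ ω, smoothCount u ε 0 L ω ^ 2 ∂(stdG ι)
        ≤ ∫ ω, K * ∑ i ∈ Finset.range K, smoothCount u ε (x i) (x i + h) ω ^ 2 ∂(stdG ι) := by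
          refine integral_mono hm2.integrable_sq ((integrable_finsetSum _ fun i hi =>
            (hmem i hi).1.integrable_sq).const_mul _) fun ω => ?_
          simp only [hsum]
          simpa using sq_sum_le_card_mul_sum_sq (s := Finset.range K)
            (f := fun i => smoothCount u ε (x i) (x i + h) ω)
      _ = K * ∑ i ∈ Finset.range K, ∫ ω, smoothCount u ε (x i) (x i + h) ω ^ 2 ∂(stdG ι) := by
          rw [integral_const_mul, integral_finsetSum _ fun i hi => (hmem i hi).1.integrable_sq]
      _ ≤ K * ∑ i ∈ Finset.range K, (225 + 200 * B ^ 2) := by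
          gcongr with i hi
          exact (hmem i hi).2
      _ = _ := by rw [Finset.sum_const, Finset.card_range, nsmul_eq_mul]
  · rw [hfun, variance_fun_sum' fun i hi => (hmem i hi).1]
    calc _ ≤ ∑ p ∈ Finset.range K, ∑ q ∈ Finset.range K, varC B L * σ ^ 2 *
          ∫ t in (x p)..(x (p + 1)), ∫ s in (x q)..(x (q + 1)), corrSq u σ t s := by
          refine Finset.sum_le_sum fun p hp' => Finset.sum_le_sum fun q hq => ?_
          rw [covariance_eq_sub (hmem p hp').1 (hmem q hq).1, hxs, hxs]
          exact (le_abs_self _).trans (cov_square_le hp hB hε hε' hh0 (hxn p) (hxL p hp') (hxn q)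
            (hxL q hq) hhσ hhB (by positivity) hlow)
      _ = _ := by
          simp_rw [← Finset.mul_sum]
          rw [sum_double_integral (S := fun z => corrSq u σ z.1 z.2)
            (continuous_corrSq hp.smooth σ) x K, hx0, hxK]

/-- Variance bound for the number of zeros of a Gaussian process on an interval. -/
lemma variance_ncard_zeros_le {ι : Type} [Fintype ι] {u : ι → ℝ → ℝ} {L σ B : ℝ}
    (hp : IsProc u L σ B) (hB : 0 ≤ B) (hL : 0 < L) (hσ1 : 1 ≤ σ) :
    variance (fun ω => (Set.ncard {t | t ∈ Set.Icc 0 L ∧ proc u 0 t ω = 0} : ℝ)) (stdG ι)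
      ≤ varC B L * σ ^ 2 * ∫ t in (0)..L, ∫ s in (0)..L, corrSq u σ t s := by
  obtain ⟨M, hM⟩ := variance_smoothCount_le hp hB hL hσ1
  set D := varC B L * σ ^ 2 * ∫ t in (0)..L, ∫ s in (0)..L, corrSq u σ t s with hD
  set Z : (ι → ℝ) → ℝ := fun ω => (Set.ncard {t | t ∈ Set.Icc 0 L ∧ proc u 0 t ω = 0} : ℝ)
    with hZ
  have hev : ∀ᵐ ω ∂(stdG ι), ∀ᶠ ε in nhdsWithin 0 (Set.Ioi 0), smoothCount u ε 0 L ω = Z ω := by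
    filter_upwards [ae_no_double_zero hp hL, ae_proc_ne_zero hp (t := 0) ⟨le_rfl, hL.le⟩,
      ae_proc_ne_zero hp (t := L) ⟨hL.le, le_rfl⟩] with ω h1 h2 h3
    exact kac_counting_ncard (fun t => hasDerivAt_proc hp.smooth ω 0 t)
      (continuous_proc_left hp.smooth 1 ω) hL.le h2 h3 h1
  set e : ℕ → ℝ := fun n => 1 / (n + 2) with he
  have he0 : ∀ n, 0 < e n := fun n => by positivity
  have he1 : ∀ n, e n ≤ 1 / 2 := fun n => by
    simp only [he]; gcongr; linarith [(Nat.cast_nonneg n : (0 : ℝ) ≤ n)]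
  have het : Filter.Tendsto e Filter.atTop (nhdsWithin 0 (Set.Ioi 0)) := by
    refine tendsto_nhdsWithin_iff.2 ⟨?_, Filter.Eventually.of_forall he0⟩
    have := (Filter.tendsto_add_atTop_iff_nat 1).2 (tendsto_one_div_add_atTop_nhds_zero_nat (𝕜 := ℝ))
    refine this.congr fun n => ?_
    simp only [he]; push_cast; congr 1; ring
  set a : ℕ → ℝ := fun n => ∫ ω, smoothCount u (e n) 0 L ω ∂(stdG ι) with ha
  have hab : ∀ n, a n ∈ Metric.closedBall (0 : ℝ) (√M) := by
    intro n
    obtain ⟨h1, h2, -⟩ := hM (e n) (he0 n) (he1 n)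
    rw [mem_closedBall_zero_iff, Real.norm_eq_abs]
    apply Real.abs_le_sqrt
    have := variance_nonneg (smoothCount u (e n) 0 L) (stdG ι)
    rw [variance_eq_sub h1] at this
    simp only [Pi.pow_apply] at this
    linarith
  obtain ⟨α, -, φ, hφ, hα⟩ := tendsto_subseq_of_bounded Metric.isBounded_closedBall hab
  have hmeas : ∀ n, Measurable (smoothCount u (e n) 0 L) := fun n =>
    measurable_smoothCount hp.smooth _ hL.le
  have hlim : ∀ᵐ ω ∂(stdG ι), Filter.Tendsto (fun n => smoothCount u (e (φ n)) 0 L ω)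
      Filter.atTop (nhds (Z ω)) := by
    filter_upwards [hev] with ω hω
    have := (het.comp hφ.tendsto_atTop).eventually hω
    exact tendsto_const_nhds.congr' (this.mono fun n hn => hn.symm)
  have hZm : AEMeasurable Z (stdG ι) :=
    aemeasurable_of_tendsto_metrizable_ae Filter.atTop (fun n => (hmeas (φ n)).aemeasurable) hlim
  have hD0 : 0 ≤ D := by
    obtain ⟨-, -, h3⟩ := hM (1 / 2) (by norm_num) le_rfl
    exact (variance_nonneg _ _).trans h3
  have hvar : ∀ n, ∫⁻ ω, ENNReal.ofReal ((smoothCount u (e n) 0 L ω - a n) ^ 2) ∂(stdG ι)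
      ≤ ENNReal.ofReal D := by
    intro n
    obtain ⟨h1, -, h3⟩ := hM (e n) (he0 n) (he1 n)
    rw [variance_eq_integral (hmeas n).aemeasurable] at h3
    have hi : Integrable (fun ω => (smoothCount u (e n) 0 L ω - a n) ^ 2) (stdG ι) :=
      (h1.sub (memLp_const (a n))).integrable_sq
    rw [← ofReal_integral_eq_lintegral_ofReal hi
      (Filter.Eventually.of_forall fun _ => sq_nonneg _)]
    exact ENNReal.ofReal_le_ofReal h3
  have hfatou : ∫⁻ ω, ENNReal.ofReal ((Z ω - α) ^ 2) ∂(stdG ι) ≤ ENNReal.ofReal D := by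
    calc _ = ∫⁻ ω, Filter.liminf (fun n =>
          ENNReal.ofReal ((smoothCount u (e (φ n)) 0 L ω - a (φ n)) ^ 2)) Filter.atTop
          ∂(stdG ι) := by
          refine lintegral_congr_ae ?_
          filter_upwards [hlim] with ω hω
          exact (ENNReal.tendsto_ofReal ((hω.sub hα).pow 2)).liminf_eq.symm
      _ ≤ Filter.liminf (fun n => ∫⁻ ω,
          ENNReal.ofReal ((smoothCount u (e (φ n)) 0 L ω - a (φ n)) ^ 2) ∂(stdG ι))
          Filter.atTop := lintegral_liminf_le fun n => by
            have := hmeas (φ n)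
            fun_prop
      _ ≤ Filter.liminf (fun _ : ℕ => ENNReal.ofReal D) Filter.atTop :=
          Filter.liminf_le_liminf (Filter.Eventually.of_forall fun n => hvar (φ n))
      _ = _ := Filter.liminf_const _
  have hZs : AEStronglyMeasurable Z (stdG ι) := hZm.aestronglyMeasurable
  rw [← variance_sub_const hZs α]
  refine (variance_le_expectation_sq (hZs.sub aestronglyMeasurable_const)).trans ?_
  simp only [Pi.pow_apply, Pi.sub_apply]
  have hsq : AEStronglyMeasurable (fun ω => (Z ω - α) ^ 2) (stdG ι) :=
    (hZs.sub aestronglyMeasurable_const).pow 2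
  rw [integral_eq_lintegral_of_nonneg_ae (Filter.Eventually.of_forall fun _ => sq_nonneg _) hsq]
  exact ENNReal.toReal_le_of_le_ofReal hD0 hfatou

/-- The constant in the stationary phase estimate. -/
def vdcC (L c B₁ B₂ : ℝ) : ℝ := 2 + (2 + 3 * B₁) * ((L + 4 * B₁ + 2 * L * B₂) / c ^ 2)

lemma integral_inv_sq_add_sq_le {θ θ' θ'' : ℝ → ℝ} (h1 : ∀ t, HasDerivAt θ (θ' t) t)
    (h2 : ∀ t, HasDerivAt θ' (θ'' t) t) (h3 : Continuous θ'') {L δ c B₁ B₂ : ℝ} (hL : 0 ≤ L)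
    (hδ : 0 < δ) (hδ1 : δ ≤ 1) (hc : 0 < c) (hB₁ : ∀ t ∈ Set.Icc 0 L, |θ' t| ≤ B₁)
    (hB₂ : ∀ t ∈ Set.Icc 0 L, |θ'' t| ≤ B₂)
    (hcurv : ∀ t ∈ Set.Icc 0 L, c ^ 2 ≤ θ t ^ 2 + θ' t ^ 2) :
    ∫ t in (0)..L, 1 / (θ t ^ 2 + δ ^ 2) ≤ (L + 4 * B₁ + 2 * L * B₂) / c ^ 2 / δ := by
  have hθ : Continuous θ := continuous_iff_continuousAt.2 fun t => (h1 t).continuousAt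
  have hθ' : Continuous θ' := continuous_iff_continuousAt.2 fun t => (h2 t).continuousAt
  have hq : ∀ t, 0 < θ t ^ 2 + δ ^ 2 := fun t => by positivity
  have h0I : (0 : ℝ) ∈ Set.Icc 0 L := ⟨le_rfl, hL⟩
  have hLI : L ∈ Set.Icc 0 L := ⟨hL, le_rfl⟩
  have hB₁0 : 0 ≤ B₁ := (abs_nonneg _).trans (hB₁ 0 h0I)
  have hB₂0 : 0 ≤ B₂ := (abs_nonneg _).trans (hB₂ 0 h0I)
  have harc : ∀ x, |arctan x| ≤ 2 := fun x => by
    rw [abs_le]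
    constructor <;> linarith [neg_pi_div_two_lt_arctan x, arctan_lt_pi_div_two x, pi_lt_four]
  have hd : ∀ t, HasDerivAt (fun t => θ' t * (arctan (θ t / δ) / δ))
      (θ'' t * (arctan (θ t / δ) / δ) + θ' t ^ 2 / (θ t ^ 2 + δ ^ 2)) t := by
    intro t
    have := (h2 t).mul ((((h1 t).div_const δ).arctan).div_const δ)
    refine this.congr_deriv ?_
    have := hq t
    have h4 : 0 < 1 + (θ t / δ) ^ 2 := by positivity
    field_simp
    ring
  have hc1 : Continuous (fun t => θ'' t * (arctan (θ t / δ) / δ)) :=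
    h3.mul ((continuous_arctan.comp (hθ.div_const _)).div_const _)
  have hc2 : Continuous (fun t => θ' t ^ 2 / (θ t ^ 2 + δ ^ 2)) :=
    (hθ'.pow 2).div (by fun_prop) fun t => (hq t).ne'
  have hc3 : Continuous (fun t => 1 / (θ t ^ 2 + δ ^ 2)) :=
    continuous_const.div (by fun_prop) fun t => (hq t).ne'
  have hftc := intervalIntegral.integral_eq_sub_of_hasDerivAt (a := 0) (b := L) (fun t _ => hd t)
    ((hc1.add hc2).intervalIntegrable _ _)
  rw [intervalIntegral.integral_add (hc1.intervalIntegrable _ _) (hc2.intervalIntegrable _ _)]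
    at hftc
  have hbd : ∀ t ∈ Set.Icc 0 L, |θ' t * (arctan (θ t / δ) / δ)| ≤ B₁ * (2 / δ) := by
    intro t ht
    rw [abs_mul, abs_div, abs_of_pos hδ]
    have := hB₁ t ht
    have := harc (θ t / δ)
    gcongr
  have hI1 : |∫ t in (0)..L, θ'' t * (arctan (θ t / δ) / δ)| ≤ B₂ * (2 / δ) * |L - 0| := by
    rw [← Real.norm_eq_abs]
    refine intervalIntegral.norm_integral_le_of_norm_le_const fun t ht => ?_
    rw [Set.uIoc_of_le hL] at ht
    rw [Real.norm_eq_abs, abs_mul, abs_div, abs_of_pos hδ]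
    have := hB₂ t (Set.Ioc_subset_Icc_self ht)
    have := harc (θ t / δ)
    gcongr
  rw [sub_zero, abs_of_nonneg hL] at hI1
  have hI2 : ∫ t in (0)..L, θ' t ^ 2 / (θ t ^ 2 + δ ^ 2) ≤ (4 * B₁ + 2 * L * B₂) / δ := by
    have e0 := (abs_le.1 (hbd 0 h0I)).1
    have eL := (abs_le.1 (hbd L hLI)).2
    have eI := (abs_le.1 hI1).1
    have : (4 * B₁ + 2 * L * B₂) / δ = 2 * (B₁ * (2 / δ)) + B₂ * (2 / δ) * L := by ring
    linarith
  have hI3 : c ^ 2 * ∫ t in (0)..L, 1 / (θ t ^ 2 + δ ^ 2)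
      ≤ L + ∫ t in (0)..L, θ' t ^ 2 / (θ t ^ 2 + δ ^ 2) := by
    have e : L + ∫ t in (0)..L, θ' t ^ 2 / (θ t ^ 2 + δ ^ 2)
        = ∫ t in (0)..L, (1 + θ' t ^ 2 / (θ t ^ 2 + δ ^ 2)) := by
      rw [intervalIntegral.integral_add (by simp) (hc2.intervalIntegrable _ _)]
      simp
    rw [e, ← intervalIntegral.integral_const_mul]
    refine intervalIntegral.integral_mono_on hL ((hc3.const_mul _).intervalIntegrable _ _)
      ((continuous_const.add hc2).intervalIntegrable _ _) fun t ht => ?_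
    have := hq t
    rw [← sub_nonneg]
    have e2 : 1 + θ' t ^ 2 / (θ t ^ 2 + δ ^ 2) - c ^ 2 * (1 / (θ t ^ 2 + δ ^ 2))
        = (θ t ^ 2 + θ' t ^ 2 - c ^ 2 + δ ^ 2) / (θ t ^ 2 + δ ^ 2) := by field_simp; ring
    rw [e2]
    have := hcurv t ht
    exact div_nonneg (by nlinarith [sq_nonneg δ]) (hq t).le
  rw [div_div, le_div_iff₀ (by positivity)]
  have hLδ : L * δ ≤ L := by nlinarith
  have h5 : (∫ t in (0)..L, θ' t ^ 2 / (θ t ^ 2 + δ ^ 2)) * δ ≤ 4 * B₁ + 2 * L * B₂ := by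
    rwa [le_div_iff₀ hδ] at hI2
  nlinarith [mul_le_mul_of_nonneg_right hI3 hδ.le]

/-- A uniform second derivative test for oscillatory integrals. -/
lemma abs_integral_mul_cos_le {Φ θ θ' θ'' a a' : ℝ → ℝ} {L δ c A B₁ B₂ : ℝ}
    (h0 : ∀ t, HasDerivAt Φ (θ t / δ ^ 2) t) (h1 : ∀ t, HasDerivAt θ (θ' t) t)
    (h2 : ∀ t, HasDerivAt θ' (θ'' t) t) (h3 : Continuous θ'')
    (ha : ∀ t, HasDerivAt a (a' t) t) (ha' : Continuous a') (hL : 0 ≤ L)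
    (hδ : 0 < δ) (hδ1 : δ ≤ 1) (hc : 0 < c) (hA : ∀ t ∈ Set.Icc 0 L, |a t| ≤ A)
    (hA' : ∀ t ∈ Set.Icc 0 L, |a' t| ≤ A) (hθ1 : ∀ t ∈ Set.Icc 0 L, |θ t| ≤ 1)
    (hB₁ : ∀ t ∈ Set.Icc 0 L, |θ' t| ≤ B₁) (hB₂ : ∀ t ∈ Set.Icc 0 L, |θ'' t| ≤ B₂)
    (hcurv : ∀ t ∈ Set.Icc 0 L, c ^ 2 ≤ θ t ^ 2 + θ' t ^ 2) :
    |∫ t in (0)..L, a t * cos (Φ t)| ≤ vdcC L c B₁ B₂ * A * δ := by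
  have hI := integral_inv_sq_add_sq_le h1 h2 h3 hL hδ hδ1 hc hB₁ hB₂ hcurv
  have hΦ : Continuous Φ := continuous_iff_continuousAt.2 fun t => (h0 t).continuousAt
  have hθ : Continuous θ := continuous_iff_continuousAt.2 fun t => (h1 t).continuousAt
  have hθ' : Continuous θ' := continuous_iff_continuousAt.2 fun t => (h2 t).continuousAt
  have hac : Continuous a := continuous_iff_continuousAt.2 fun t => (ha t).continuousAt
  have hq : ∀ t, 0 < θ t ^ 2 + δ ^ 2 := fun t => by positivity
  have h0I : (0 : ℝ) ∈ Set.Icc 0 L := ⟨le_rfl, hL⟩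
  have hLI : L ∈ Set.Icc 0 L := ⟨hL, le_rfl⟩
  have hB₁0 : 0 ≤ B₁ := (abs_nonneg _).trans (hB₁ 0 h0I)
  have hA0 : 0 ≤ A := (abs_nonneg _).trans (hA 0 h0I)
  set g : ℝ → ℝ := fun t => a t * θ t / (θ t ^ 2 + δ ^ 2) with hg
  set g' : ℝ → ℝ := fun t => ((a' t * θ t + a t * θ' t) * (θ t ^ 2 + δ ^ 2)
    - a t * θ t * (2 * θ t * θ' t)) / (θ t ^ 2 + δ ^ 2) ^ 2 with hg'
  have hgd : ∀ t, HasDerivAt g (g' t) t := by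
    intro t
    have := ((ha t).mul (h1 t)).div (((h1 t).pow 2).add_const (δ ^ 2)) (hq t).ne'
    refine this.congr_deriv ?_
    simp [hg']
  have hgc : Continuous g := continuous_iff_continuousAt.2 fun t => (hgd t).continuousAt
  have hg'c : Continuous g' :=
    Continuous.div (by fun_prop) (by fun_prop) fun t => (pow_pos (hq t) 2).ne'
  have hc3 : Continuous (fun t => 1 / (θ t ^ 2 + δ ^ 2)) :=
    continuous_const.div (by fun_prop) fun t => (hq t).ne'
  have hgb : ∀ t ∈ Set.Icc 0 L, |g t| ≤ A / δ := by
    intro t ht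
    rw [hg]
    simp only
    rw [abs_div, abs_of_pos (hq t), abs_mul, div_le_div_iff₀ (hq t) hδ]
    have h4 : |θ t| * δ ≤ θ t ^ 2 + δ ^ 2 := by
      rw [← sq_abs (θ t)]; nlinarith [sq_nonneg (|θ t| - δ), abs_nonneg (θ t)]
    calc |a t| * |θ t| * δ = |a t| * (|θ t| * δ) := by ring
      _ ≤ A * (θ t ^ 2 + δ ^ 2) := by
        have := hA t ht
        gcongr
  have hg'b : ∀ t ∈ Set.Icc 0 L, |g' t| ≤ A * (1 + 3 * B₁) * (1 / (θ t ^ 2 + δ ^ 2)) := by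
    intro t ht
    have hqt := hq t
    have e : g' t = (a' t * θ t + a t * θ' t
        - a t * θ' t * (2 * (θ t ^ 2 / (θ t ^ 2 + δ ^ 2)))) * (1 / (θ t ^ 2 + δ ^ 2)) := by
      simp only [hg']; field_simp
    rw [e, abs_mul, abs_of_pos (by positivity : 0 < 1 / (θ t ^ 2 + δ ^ 2))]
    gcongr
    have hr0 : 0 ≤ θ t ^ 2 / (θ t ^ 2 + δ ^ 2) := by positivity
    have hr1 : θ t ^ 2 / (θ t ^ 2 + δ ^ 2) ≤ 1 := by
      rw [div_le_one hqt]; nlinarith [sq_nonneg δ]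
    have e1 : |a' t * θ t| ≤ A * 1 := by
      rw [abs_mul]; exact mul_le_mul (hA' t ht) (hθ1 t ht) (abs_nonneg _) hA0
    have e2 : |a t * θ' t| ≤ A * B₁ := by
      rw [abs_mul]; exact mul_le_mul (hA t ht) (hB₁ t ht) (abs_nonneg _) hA0
    have e3 : |a t * θ' t * (2 * (θ t ^ 2 / (θ t ^ 2 + δ ^ 2)))| ≤ A * B₁ * (2 * 1) := by
      rw [abs_mul, abs_of_nonneg (by positivity : 0 ≤ 2 * (θ t ^ 2 / (θ t ^ 2 + δ ^ 2)))]
      gcongr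
    have := abs_sub (a' t * θ t + a t * θ' t)
      (a t * θ' t * (2 * (θ t ^ 2 / (θ t ^ 2 + δ ^ 2))))
    have := abs_add_le (a' t * θ t) (a t * θ' t)
    linarith
  have hsin : ∀ t, HasDerivAt (fun t => g t * (δ ^ 2 * sin (Φ t)))
      (g' t * (δ ^ 2 * sin (Φ t)) + g t * θ t * cos (Φ t)) t := by
    intro t
    have := (hgd t).mul (((h0 t).sin).const_mul (δ ^ 2))
    refine this.congr_deriv ?_
    field_simp
  have hc4 : Continuous (fun t => g' t * (δ ^ 2 * sin (Φ t))) := by fun_prop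
  have hc5 : Continuous (fun t => g t * θ t * cos (Φ t)) := by fun_prop
  have hc6 : Continuous (fun t => a t * δ ^ 2 * cos (Φ t) * (1 / (θ t ^ 2 + δ ^ 2))) := by fun_prop
  have hftc := intervalIntegral.integral_eq_sub_of_hasDerivAt (a := 0) (b := L)
    (fun t _ => hsin t) ((hc4.add hc5).intervalIntegrable _ _)
  rw [intervalIntegral.integral_add (hc4.intervalIntegrable _ _) (hc5.intervalIntegrable _ _)]
    at hftc
  have hsplit : ∫ t in (0)..L, a t * cos (Φ t) = (∫ t in (0)..L, g t * θ t * cos (Φ t))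
      + ∫ t in (0)..L, a t * δ ^ 2 * cos (Φ t) * (1 / (θ t ^ 2 + δ ^ 2)) := by
    rw [← intervalIntegral.integral_add (hc5.intervalIntegrable _ _)
      (hc6.intervalIntegrable _ _)]
    refine intervalIntegral.integral_congr fun t _ => ?_
    have := hq t
    simp only [hg]
    field_simp
  set I := ∫ t in (0)..L, 1 / (θ t ^ 2 + δ ^ 2) with hIdef
  have b1 : |∫ t in (0)..L, g' t * (δ ^ 2 * sin (Φ t))| ≤ δ ^ 2 * (A * (1 + 3 * B₁)) * I := by
    rw [hIdef, ← intervalIntegral.integral_const_mul]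
    rw [← Real.norm_eq_abs]
    refine intervalIntegral.norm_integral_le_of_norm_le hL (Filter.Eventually.of_forall
      fun t ht => ?_) ((hc3.const_mul _).intervalIntegrable _ _)
    rw [Real.norm_eq_abs, abs_mul, abs_mul, abs_of_nonneg (sq_nonneg δ)]
    have e1 := hg'b t (Set.Ioc_subset_Icc_self ht)
    have e2 := abs_sin_le_one (Φ t)
    calc |g' t| * (δ ^ 2 * |sin (Φ t)|)
        ≤ (A * (1 + 3 * B₁) * (1 / (θ t ^ 2 + δ ^ 2))) * (δ ^ 2 * 1) := by
          have := hq t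
          gcongr
      _ = _ := by ring
  have b2 : |∫ t in (0)..L, a t * δ ^ 2 * cos (Φ t) * (1 / (θ t ^ 2 + δ ^ 2))|
      ≤ δ ^ 2 * A * I := by
    rw [hIdef, ← intervalIntegral.integral_const_mul]
    rw [← Real.norm_eq_abs]
    refine intervalIntegral.norm_integral_le_of_norm_le hL (Filter.Eventually.of_forall
      fun t ht => ?_) ((hc3.const_mul _).intervalIntegrable _ _)
    have hqt := hq t
    rw [Real.norm_eq_abs, abs_mul, abs_mul, abs_mul, abs_of_nonneg (sq_nonneg δ),
      abs_of_pos (by positivity : 0 < 1 / (θ t ^ 2 + δ ^ 2))]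
    have e1 := hA t (Set.Ioc_subset_Icc_self ht)
    have e2 := abs_cos_le_one (Φ t)
    calc |a t| * δ ^ 2 * |cos (Φ t)| * (1 / (θ t ^ 2 + δ ^ 2))
        ≤ A * δ ^ 2 * 1 * (1 / (θ t ^ 2 + δ ^ 2)) := by gcongr
      _ = _ := by ring
  have b3 : ∀ t ∈ Set.Icc 0 L, |g t * (δ ^ 2 * sin (Φ t))| ≤ A * δ := by
    intro t ht
    rw [abs_mul, abs_mul, abs_of_nonneg (sq_nonneg δ)]
    have e1 := hgb t ht
    have e2 := abs_sin_le_one (Φ t)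
    calc |g t| * (δ ^ 2 * |sin (Φ t)|) ≤ A / δ * (δ ^ 2 * 1) := by gcongr
      _ = A * δ := by field_simp
  have hδI : δ ^ 2 * I ≤ (L + 4 * B₁ + 2 * L * B₂) / c ^ 2 * δ := by
    calc δ ^ 2 * I ≤ δ ^ 2 * ((L + 4 * B₁ + 2 * L * B₂) / c ^ 2 / δ) := by gcongr
      _ = _ := by field_simp
  have hfin : |∫ t in (0)..L, a t * cos (Φ t)|
      ≤ 2 * (A * δ) + A * (2 + 3 * B₁) * (δ ^ 2 * I) := by
    have e0 := abs_le.1 (b3 0 h0I)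
    have eL := abs_le.1 (b3 L hLI)
    have e1 := abs_le.1 b1
    have e2 := abs_le.1 b2
    rw [hsplit, abs_le]
    constructor <;> nlinarith
  calc _ ≤ _ := hfin
    _ ≤ 2 * (A * δ) + A * (2 + 3 * B₁) * ((L + 4 * B₁ + 2 * L * B₂) / c ^ 2 * δ) := by gcongr
    _ = _ := by unfold vdcC; ring

/-- Three distinct lattice points on a circle of radius `√m` cannot be too close together. -/
lemma four_mul_le_of_three_points {m : ℕ} {a b c : ℤ × ℤ} (ha : a.1 ^ 2 + a.2 ^ 2 = m)
    (hb : b.1 ^ 2 + b.2 ^ 2 = m) (hc : c.1 ^ 2 + c.2 ^ 2 = m) (hab : a ≠ b) (hac : a ≠ c)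
    (hbc : b ≠ c) {D : ℝ} (h1 : (((b.1 - a.1) ^ 2 + (b.2 - a.2) ^ 2 : ℤ) : ℝ) ≤ D)
    (h2 : (((c.1 - a.1) ^ 2 + (c.2 - a.2) ^ 2 : ℤ) : ℝ) ≤ D)
    (h3 : (((c.1 - b.1) ^ 2 + (c.2 - b.2) ^ 2 : ℤ) : ℝ) ≤ D) : 4 * (m : ℝ) ≤ D ^ 3 := by
  obtain ⟨a1, a2⟩ := a
  obtain ⟨b1, b2⟩ := b
  obtain ⟨c1, c2⟩ := c
  simp only at *
  have pos : ∀ x y z w : ℤ, (x, y) ≠ (z, w) → 0 < (z - x) ^ 2 + (w - y) ^ 2 := by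
    intro x y z w h
    by_contra hcon
    have e1 : (z - x) ^ 2 = 0 := by nlinarith [sq_nonneg (z - x), sq_nonneg (w - y)]
    have e2 : (w - y) ^ 2 = 0 := by nlinarith [sq_nonneg (z - x), sq_nonneg (w - y)]
    have e3 := pow_eq_zero_iff (two_ne_zero) |>.1 e1
    have e4 := pow_eq_zero_iff (two_ne_zero) |>.1 e2
    exact h (by ext <;> simp <;> omega)
  have pU := pos _ _ _ _ hab
  have pW := pos _ _ _ _ hac
  have pV := pos _ _ _ _ hbc
  set d : ℤ := (b1 - a1) * (c2 - a2) - (b2 - a2) * (c1 - a1) with hd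
  have key : 4 * (m : ℤ) * d ^ 2 = ((b1 - a1) ^ 2 + (b2 - a2) ^ 2) *
      ((c1 - a1) ^ 2 + (c2 - a2) ^ 2) * ((c1 - b1) ^ 2 + (c2 - b2) ^ 2) := by
    have hP : 2 * (a1 * (b1 - a1) + a2 * (b2 - a2)) = -((b1 - a1) ^ 2 + (b2 - a2) ^ 2) := by
      linarith
    have hQ : 2 * (a1 * (c1 - a1) + a2 * (c2 - a2)) = -((c1 - a1) ^ 2 + (c2 - a2) ^ 2) := by
      linarith
    have hV : (c1 - b1) ^ 2 + (c2 - b2) ^ 2 = ((b1 - a1) ^ 2 + (b2 - a2) ^ 2)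
      + ((c1 - a1) ^ 2 + (c2 - a2) ^ 2)
      - 2 * ((b1 - a1) * (c1 - a1) + (b2 - a2) * (c2 - a2)) := by ring
    rw [hV, ← ha, hd]
    generalize b1 - a1 = u1 at *
    generalize b2 - a2 = u2 at *
    generalize c1 - a1 = w1 at *
    generalize c2 - a2 = w2 at *
    have e : 4 * (a1 ^ 2 + a2 ^ 2) * (u1 * w2 - u2 * w1) ^ 2
        = (2 * (a1 * u1 + a2 * u2)) ^ 2 * (w1 ^ 2 + w2 ^ 2)
        + (2 * (a1 * w1 + a2 * w2)) ^ 2 * (u1 ^ 2 + u2 ^ 2)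
        - 2 * (2 * (a1 * u1 + a2 * u2)) * (2 * (a1 * w1 + a2 * w2)) * (u1 * w1 + u2 * w2) := by
      ring
    rw [e, hP, hQ]
    ring
  have hd1 : 1 ≤ d ^ 2 := by
    have : 0 < 4 * (m : ℤ) * d ^ 2 := by rw [key]; positivity
    have h0 : d ≠ 0 := by rintro h; simp [h] at this
    have := sq_pos_of_ne_zero h0
    omega
  have hkey : 4 * (m : ℝ) ≤ (((b1 - a1) ^ 2 + (b2 - a2) ^ 2 : ℤ) : ℝ) *
      (((c1 - a1) ^ 2 + (c2 - a2) ^ 2 : ℤ) : ℝ) * (((c1 - b1) ^ 2 + (c2 - b2) ^ 2 : ℤ) : ℝ) := by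
    have : 4 * (m : ℤ) ≤ ((b1 - a1) ^ 2 + (b2 - a2) ^ 2) *
      ((c1 - a1) ^ 2 + (c2 - a2) ^ 2) * ((c1 - b1) ^ 2 + (c2 - b2) ^ 2) := by
      rw [← key]; nlinarith
    exact_mod_cast this
  have q1 : (0 : ℝ) < (((b1 - a1) ^ 2 + (b2 - a2) ^ 2 : ℤ) : ℝ) := by exact_mod_cast pU
  have q2 : (0 : ℝ) < (((c1 - a1) ^ 2 + (c2 - a2) ^ 2 : ℤ) : ℝ) := by exact_mod_cast pW
  have q3 : (0 : ℝ) < (((c1 - b1) ^ 2 + (c2 - b2) ^ 2 : ℤ) : ℝ) := by exact_mod_cast pV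
  have hD : 0 < D := q1.trans_le h1
  calc _ ≤ _ := hkey
    _ ≤ D * D * D := by gcongr
    _ = D ^ 3 := by ring

/-- The summable majorant for reciprocal distances on a circle. -/
def latMajor (k : ℤ) : ℝ := (if k ∈ Finset.Icc (-1 : ℤ) 1 then 1 else 0)
  + 5 * |(k : ℝ)| ^ (-(3 / 2) : ℝ)

lemma summable_latMajor : Summable latMajor := by
  refine Summable.add ?_ ((Real.summable_abs_int_rpow (by norm_num)).mul_left 5)
  refine summable_of_ne_finset_zero (s := Finset.Icc (-1) 1) fun k hk => by simp [hk]

lemma latMajor_nonneg (k : ℤ) : 0 ≤ latMajor k := by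
  unfold latMajor; split_ifs <;> positivity

/-- The Euclidean norm of an integer vector. -/
def latNorm (v : ℤ × ℤ) : ℝ := √((v.1 : ℝ) ^ 2 + (v.2 : ℝ) ^ 2)

lemma one_le_latNorm {v : ℤ × ℤ} (hv : v ≠ 0) : 1 ≤ latNorm v := by
  unfold latNorm
  rw [Real.one_le_sqrt]
  have : 0 < v.1 ^ 2 + v.2 ^ 2 := by
    by_contra hcon
    have e1 : v.1 ^ 2 = 0 := by nlinarith [sq_nonneg v.1, sq_nonneg v.2]
    have e2 : v.2 ^ 2 = 0 := by nlinarith [sq_nonneg v.1, sq_nonneg v.2]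
    exact hv (Prod.ext (by simpa using e1) (by simpa using e2))
  exact_mod_cast this

lemma sum_inv_latNorm_quarter_le {m : ℕ} (hm : 0 < m) (S : Finset (ℤ × ℤ))
    (hS : ∀ v ∈ S, v.1 ^ 2 + v.2 ^ 2 = m) (X Y : ℤ × ℤ → ℤ)
    (hXY : ∀ v, X v ^ 2 + Y v ^ 2 = v.1 ^ 2 + v.2 ^ 2)
    (hXYd : ∀ v w, (X v - X w) ^ 2 + (Y v - Y w) ^ 2 = (v.1 - w.1) ^ 2 + (v.2 - w.2) ^ 2)
    (hq : ∀ v ∈ S, |Y v| ≤ X v) {w : ℤ × ℤ} (hw : w.1 ^ 2 + w.2 ^ 2 = m) (hwS : w ∉ S) :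
    ∑ v ∈ S, 1 / latNorm (w - v) ≤ 2 * ∑' k, latMajor k := by
  have hm1 : (1 : ℝ) ≤ m := by exact_mod_cast hm
  obtain ⟨s, hs, hs6⟩ : ∃ s : ℝ, 0 < s ∧ s ^ 6 = m / 4 :=
    ⟨((m : ℝ) / 4) ^ ((1 : ℝ) / 6), by positivity, by
      rw [← Real.rpow_natCast, ← Real.rpow_mul (by positivity)]; norm_num⟩
  set j : ℤ × ℤ → ℤ := fun v => ⌊(Y v : ℝ) / s⌋ - ⌊(Y w : ℝ) / s⌋ with hj
  have hYb : ∀ v : ℤ × ℤ, v.1 ^ 2 + v.2 ^ 2 = m → |(Y v : ℝ)| ≤ 2 * s ^ 3 := by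
    intro v hv
    refine abs_le_of_sq_le_sq ?_ (by positivity)
    have h1 : Y v ^ 2 ≤ m := by rw [← hv, ← hXY]; nlinarith [sq_nonneg (X v)]
    have h2 : (Y v : ℝ) ^ 2 ≤ m := by exact_mod_cast h1
    nlinarith
  have hs1 : s ≤ 2 * s ^ 3 := by
    have : 1 / 2 ≤ s ^ 2 := by
      by_contra hcon
      push Not at hcon
      have : (s ^ 2) ^ 3 < (1 / 2) ^ 3 := by gcongr
      nlinarith
    nlinarith
  have hterm : ∀ v ∈ S, 1 / latNorm (w - v) ≤ latMajor (j v) := by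
    intro v hv
    have hne : w - v ≠ 0 := fun h => hwS (by rw [sub_eq_zero.1 h]; exact hv)
    have h1 := one_le_latNorm hne
    by_cases hjm : j v ∈ Finset.Icc (-1 : ℤ) 1
    · have : 1 / latNorm (w - v) ≤ 1 := by rw [div_le_one (by linarith)]; exact h1
      have h5 : 0 ≤ |(j v : ℝ)| ^ (-(3 / 2) : ℝ) := by positivity
      unfold latMajor
      rw [if_pos hjm]
      linarith
    · have hj2 : 2 ≤ |j v| := by
        simp only [Finset.mem_Icc, not_and_or, not_le] at hjm
        rcases hjm with h | h
        · rw [abs_of_neg (by omega)]; omega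
        · rw [abs_of_pos (by omega)]; omega
      have hj2' : (2 : ℝ) ≤ |(j v : ℝ)| := by exact_mod_cast hj2
      set J := |(j v : ℝ)| with hJ
      have f1 := Int.floor_le ((Y v : ℝ) / s)
      have f2 := Int.lt_floor_add_one ((Y v : ℝ) / s)
      have f3 := Int.floor_le ((Y w : ℝ) / s)
      have f4 := Int.lt_floor_add_one ((Y w : ℝ) / s)
      have hjc : (j v : ℝ) = (⌊(Y v : ℝ) / s⌋ : ℝ) - ⌊(Y w : ℝ) / s⌋ := by simp [hj]
      have hdiff : |(j v : ℝ) - ((Y v : ℝ) / s - (Y w : ℝ) / s)| ≤ 1 := by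
        rw [abs_le, hjc]; constructor <;> linarith
      have hdiv : (Y v : ℝ) / s - (Y w : ℝ) / s = ((Y v : ℝ) - Y w) / s := by ring
      rw [hdiv] at hdiff
      set y : ℝ := |(Y v : ℝ) - Y w| with hy
      have hd1 : J - 1 ≤ y / s := by
        have := abs_sub_abs_le_abs_sub (j v : ℝ) (((Y v : ℝ) - Y w) / s)
        rw [abs_div, abs_of_pos hs] at this
        linarith
      have hd2 : s * J ≤ 2 * y := by
        rw [le_div_iff₀ hs] at hd1; nlinarith
      have hd3 : J ≤ 6 * s ^ 2 := by
        have e1 := hYb v (hS v hv)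
        have e2 := hYb w hw
        have e3 : y ≤ 4 * s ^ 3 := by
          have := abs_sub (Y v : ℝ) (Y w)
          linarith
        rw [le_div_iff₀ hs] at hd1
        have : J * s ≤ 6 * s ^ 2 * s := by nlinarith
        exact le_of_mul_le_mul_right this hs
      have hyn : y ≤ latNorm (w - v) := by
        unfold latNorm
        rw [hy]
        apply Real.abs_le_sqrt
        have := hXYd w v
        have h' : (Y v - Y w) ^ 2 ≤ (w.1 - v.1) ^ 2 + (w.2 - v.2) ^ 2 := by
          nlinarith [sq_nonneg (X w - X v)]
        simp only [Prod.fst_sub, Prod.snd_sub]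
        exact_mod_cast h'
      unfold latMajor
      rw [if_neg hjm, zero_add, ← hJ]
      have hJ0 : 0 < J := by linarith
      have e : J ^ (-(3 / 2) : ℝ) = 1 / (J * √J) := by
        rw [Real.rpow_neg hJ0.le, one_div, Real.sqrt_eq_rpow]
        congr 1
        nth_rewrite 2 [← Real.rpow_one J]
        rw [← Real.rpow_add hJ0]; norm_num
      rw [e, mul_one_div, div_le_div_iff₀ (by linarith) (by positivity)]
      have hsq : √J ≤ 5 / 2 * s := by
        rw [Real.sqrt_le_left (by positivity)]; nlinarith
      calc 1 * (J * √J) ≤ J * (5 / 2 * s) := by rw [one_mul]; gcongr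
        _ ≤ 5 * latNorm (w - v) := by nlinarith
  have hfib : ∀ k ∈ S.image j, (S.filter fun v => j v = k).card ≤ 2 := by
    intro k _
    by_contra hcon
    push Not at hcon
    obtain ⟨a, ha, b, hb, c, hc, hab, hac, hbc⟩ := Finset.two_lt_card.1 hcon
    rw [Finset.mem_filter] at ha hb hc
    have hclose : ∀ p q : ℤ × ℤ, p ∈ S ∧ j p = k → q ∈ S ∧ j q = k →
        (((p.1 - q.1) ^ 2 + (p.2 - q.2) ^ 2 : ℤ) : ℝ) ≤ 2 * s ^ 2 := by
      rintro p q ⟨hp, hpk⟩ ⟨hq', hqk⟩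
      have hfl : ⌊(Y p : ℝ) / s⌋ = ⌊(Y q : ℝ) / s⌋ := by
        have := hpk.trans hqk.symm
        simp only [hj] at this
        omega
      have hY := Int.abs_sub_lt_one_of_floor_eq_floor hfl
      have hdiv : (Y p : ℝ) / s - (Y q : ℝ) / s = ((Y p : ℝ) - Y q) / s := by ring
      rw [hdiv, abs_div, abs_of_pos hs, div_lt_one hs] at hY
      have hYsq : ((Y p : ℝ) - Y q) ^ 2 ≤ s ^ 2 := by
        rw [← sq_abs]; gcongr
      have hX : (X p - X q) ^ 2 ≤ (Y p - Y q) ^ 2 := by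
        have g1 := hq p hp
        have g2 := hq q hq'
        have g3 : X p ^ 2 + Y p ^ 2 = X q ^ 2 + Y q ^ 2 := by
          rw [hXY, hXY, hS p hp, hS q hq']
        rcases (abs_nonneg (Y p)).trans g1 |>.eq_or_lt with h0 | h0
        · have : X q ^ 2 + Y q ^ 2 ≤ 0 := by
            rw [← g3, ← h0]
            have : Y p = 0 := abs_eq_zero.1 (le_antisymm (by rw [h0]; exact g1) (abs_nonneg _))
            simp [this]
          have hq0 : X q = 0 := by nlinarith [sq_nonneg (X q), sq_nonneg (Y q)]
          rw [← h0, hq0]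
          nlinarith [sq_nonneg (Y p - Y q)]
        · have hsum : 0 < X p + X q := by
            have := (abs_nonneg (Y q)).trans g2; omega
          have hyy : (Y p + Y q) ^ 2 ≤ (X p + X q) ^ 2 := by
            apply sq_le_sq'
            · have := neg_abs_le (Y p); have := neg_abs_le (Y q); linarith
            · have := le_abs_self (Y p); have := le_abs_self (Y q); linarith
          have hprod : (X p - X q) * (X p + X q) = (Y q - Y p) * (Y p + Y q) := by linarith
          have h4 : (X p - X q) ^ 2 * (X p + X q) ^ 2 ≤ (Y p - Y q) ^ 2 * (X p + X q) ^ 2 := by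
            calc (X p - X q) ^ 2 * (X p + X q) ^ 2 = ((X p - X q) * (X p + X q)) ^ 2 := by ring
              _ = (Y p - Y q) ^ 2 * (Y p + Y q) ^ 2 := by rw [hprod]; ring
              _ ≤ _ := by gcongr
          exact le_of_mul_le_mul_right h4 (by positivity)
      have hX' : ((X p : ℝ) - X q) ^ 2 ≤ ((Y p : ℝ) - Y q) ^ 2 := by exact_mod_cast hX
      rw [← hXYd p q]
      push_cast
      linarith
    have := four_mul_le_of_three_points (hS a ha.1) (hS b hb.1) (hS c hc.1) hab hac hbc
      (hclose b a hb ha) (hclose c a hc ha) (hclose c b hc hb)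
    nlinarith
  calc ∑ v ∈ S, 1 / latNorm (w - v) ≤ ∑ v ∈ S, latMajor (j v) := Finset.sum_le_sum hterm
    _ = ∑ k ∈ S.image j, ((S.filter fun v => j v = k).card : ℝ) * latMajor k := by
        rw [Finset.sum_comp latMajor j]
        simp
    _ ≤ ∑ k ∈ S.image j, 2 * latMajor k := by
        refine Finset.sum_le_sum fun k hk => ?_
        have : ((S.filter fun v => j v = k).card : ℝ) ≤ 2 := by exact_mod_cast hfib k hk
        have := latMajor_nonneg k
        gcongr
    _ = 2 * ∑ k ∈ S.image j, latMajor k := by rw [Finset.mul_sum]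
    _ ≤ 2 * ∑' k, latMajor k := by
        have := summable_latMajor.sum_le_tsum (S.image j) fun k _ => latMajor_nonneg k
        linarith

/-- The sum of reciprocal distances between lattice points on a circle is bounded. -/
lemma sum_inv_latNorm_le {m : ℕ} (hm : 0 < m) {w : ℤ × ℤ} (hw : w.1 ^ 2 + w.2 ^ 2 = m) :
    ∑ v ∈ (latticeSet m).erase w, 1 / latNorm (w - v) ≤ 8 * ∑' k, latMajor k := by
  set S := (latticeSet m).erase w with hSdef
  have hS : ∀ v ∈ S, v.1 ^ 2 + v.2 ^ 2 = m := fun v hv =>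
    (Finset.mem_filter.1 (Finset.mem_of_mem_erase hv)).2
  have hwS : w ∉ S := Finset.notMem_erase _ _
  have hpos : ∀ v, 0 ≤ 1 / latNorm (w - v) := fun v => by unfold latNorm; positivity
  have hsub : ∀ X Y : ℤ × ℤ → ℤ, (∀ v, X v ^ 2 + Y v ^ 2 = v.1 ^ 2 + v.2 ^ 2) →
      (∀ v w, (X v - X w) ^ 2 + (Y v - Y w) ^ 2 = (v.1 - w.1) ^ 2 + (v.2 - w.2) ^ 2) →
      ∑ v ∈ S.filter (fun v => |Y v| ≤ X v), 1 / latNorm (w - v) ≤ 2 * ∑' k, latMajor k :=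
    fun X Y h1 h2 => sum_inv_latNorm_quarter_le hm _
      (fun v hv => hS v (Finset.mem_filter.1 hv).1) X Y h1 h2
      (fun v hv => (Finset.mem_filter.1 hv).2) hw fun h => hwS (Finset.mem_filter.1 h).1
  have h1 := hsub (fun v => v.1) (fun v => v.2) (fun v => rfl) (fun v w => rfl)
  have h2 := hsub (fun v => -v.1) (fun v => v.2) (fun v => by ring) (fun v w => by ring)
  have h3 := hsub (fun v => v.2) (fun v => v.1) (fun v => by ring) (fun v w => by ring)
  have h4 := hsub (fun v => -v.2) (fun v => v.1) (fun v => by ring) (fun v w => by ring)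
  rw [Finset.sum_filter] at h1 h2 h3 h4
  have : ∑ v ∈ S, 1 / latNorm (w - v) ≤ ∑ v ∈ S, (
      (if |v.2| ≤ v.1 then 1 / latNorm (w - v) else 0)
      + (if |v.2| ≤ -v.1 then 1 / latNorm (w - v) else 0)
      + (if |v.1| ≤ v.2 then 1 / latNorm (w - v) else 0)
      + (if |v.1| ≤ -v.2 then 1 / latNorm (w - v) else 0)) := by
    refine Finset.sum_le_sum fun v _ => ?_
    have hp := hpos v
    have hcase : |v.2| ≤ v.1 ∨ |v.2| ≤ -v.1 ∨ |v.1| ≤ v.2 ∨ |v.1| ≤ -v.2 := by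
      rcases abs_cases v.1 with h | h <;> rcases abs_cases v.2 with h' | h' <;> omega
    rcases hcase with h | h | h | h <;> rw [if_pos h] <;> split_ifs <;> linarith
  rw [Finset.sum_add_distrib, Finset.sum_add_distrib, Finset.sum_add_distrib] at this
  linarith

lemma mem_latticeSet {m : ℕ} {v : ℤ × ℤ} : v ∈ latticeSet m ↔ v.1 ^ 2 + v.2 ^ 2 = m := by
  refine ⟨fun h => (Finset.mem_filter.1 h).2, fun h => Finset.mem_filter.2 ⟨?_, h⟩⟩
  have key : ∀ a b : ℤ, a ^ 2 + b ^ 2 = m → a ∈ Finset.Icc (-(m : ℤ)) m := by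
    intro a b hab
    have h1 : |a| ≤ a ^ 2 := by
      rw [← sq_abs]
      nlinarith [abs_nonneg a, Int.le_self_sq |a|]
    have h2 : |a| ≤ m := by nlinarith [sq_nonneg b]
    exact Finset.mem_Icc.2 (abs_le.1 h2)
  exact Finset.mem_product.2 ⟨key _ _ h, key _ _ (by rw [add_comm]; exact h)⟩

lemma sum_latticeSet_swap (m : ℕ) (f : ℤ × ℤ → ℝ) :
    ∑ v ∈ latticeSet m, f v = ∑ v ∈ latticeSet m, f (v.2, v.1) :=
  Finset.sum_nbij' (fun v => (v.2, v.1)) (fun v => (v.2, v.1))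
    (fun v hv => by rw [mem_latticeSet] at *; simpa [add_comm] using hv)
    (fun v hv => by rw [mem_latticeSet] at *; simpa [add_comm] using hv)
    (fun _ _ => rfl) (fun _ _ => rfl) (fun _ _ => rfl)

lemma sum_latticeSet_refl (m : ℕ) (f : ℤ × ℤ → ℝ) :
    ∑ v ∈ latticeSet m, f v = ∑ v ∈ latticeSet m, f (-v.1, v.2) :=
  Finset.sum_nbij' (fun v => (-v.1, v.2)) (fun v => (-v.1, v.2))
    (fun v hv => by rw [mem_latticeSet] at *; simpa using hv)
    (fun v hv => by rw [mem_latticeSet] at *; simpa using hv)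
    (fun _ _ => by simp) (fun _ _ => by simp) (fun _ _ => by simp)

lemma sum_latticeSet_neg (m : ℕ) (f : ℤ × ℤ → ℝ) :
    ∑ v ∈ latticeSet m, f v = ∑ v ∈ latticeSet m, f (-v) :=
  Finset.sum_nbij' (fun v => -v) (fun v => -v)
    (fun v hv => by rw [mem_latticeSet] at *; simpa using hv)
    (fun v hv => by rw [mem_latticeSet] at *; simpa using hv)
    (fun _ _ => by simp) (fun _ _ => by simp) (fun _ _ => by simp)

/-- The second moments of the lattice points are isotropic. -/
lemma sum_latticeSet_mul (m : ℕ) (a b c d : ℝ) :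
    ∑ v ∈ latticeSet m, ((v.1 : ℝ) * a + v.2 * b) * (v.1 * c + v.2 * d)
      = latN m * m / 2 * (a * c + b * d) := by
  have h1 : ∑ v ∈ latticeSet m, (v.1 : ℝ) ^ 2 = ∑ v ∈ latticeSet m, (v.2 : ℝ) ^ 2 :=
    sum_latticeSet_swap m fun v => (v.1 : ℝ) ^ 2
  have h2 : ∑ v ∈ latticeSet m, (v.1 : ℝ) ^ 2 + ∑ v ∈ latticeSet m, (v.2 : ℝ) ^ 2
      = latN m * m := by
    rw [← Finset.sum_add_distrib, latN, ← nsmul_eq_mul]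
    refine Finset.sum_eq_card_nsmul fun v hv => ?_
    exact_mod_cast mem_latticeSet.1 hv
  have h3 : ∑ v ∈ latticeSet m, (v.1 : ℝ) * v.2 = 0 := by
    have := sum_latticeSet_refl m fun v => (v.1 : ℝ) * v.2
    simp only [Int.cast_neg, neg_mul, Finset.sum_neg_distrib] at this
    linarith
  have e : ∑ v ∈ latticeSet m, ((v.1 : ℝ) * a + v.2 * b) * (v.1 * c + v.2 * d)
      = (a * c) * ∑ v ∈ latticeSet m, (v.1 : ℝ) ^ 2 + (b * d) * ∑ v ∈ latticeSet m, (v.2 : ℝ) ^ 2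
        + (a * d + b * c) * ∑ v ∈ latticeSet m, (v.1 : ℝ) * v.2 := by
    simp only [Finset.mul_sum, ← Finset.sum_add_distrib]
    exact Finset.sum_congr rfl fun v _ => by ring
  rw [e, h3, ← h1]
  have : ∑ v ∈ latticeSet m, (v.1 : ℝ) ^ 2 = latN m * m / 2 := by linarith
  rw [this]
  ring

/-- The phase of the plane wave of frequency `v` along the curve `(x, y)`. -/
def arcPhase (x y : ℝ → ℝ) (v : ℤ × ℤ) (t : ℝ) : ℝ := 2 * π * (v.1 * x t + v.2 * y t)

/-- The index set of the Gaussian coefficients of the arithmetic random wave. -/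
abbrev latIdx (m : ℕ) : Type := ↥(latticeSet m) ⊕ ↥(latticeSet m)

/-- The frequency attached to an index. -/
def latPt {m : ℕ} (i : latIdx m) : ℤ × ℤ := Sum.elim (fun v => v.1) (fun v => v.1) i

/-- The phase shift attached to an index. -/
def latPh {m : ℕ} (i : latIdx m) : ℝ := Sum.elim (fun _ => 0) (fun _ => π / 2) i

/-- The coefficient functions of the arithmetic random wave along the curve `(x, y)`. -/
def arcU (m : ℕ) (x y : ℝ → ℝ) (i : latIdx m) (t : ℝ) : ℝ :=
  (√(latN m))⁻¹ * cos (arcPhase x y (latPt i) t - latPh i)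

lemma latPt_mem {m : ℕ} (i : latIdx m) : latPt i ∈ latticeSet m := by
  rcases i with v | v <;> exact v.2

lemma sum_latIdx {m : ℕ} (F : ℤ × ℤ → ℝ → ℝ) :
    ∑ i : latIdx m, F (latPt i) (latPh i) = ∑ v ∈ latticeSet m, (F v 0 + F v (π / 2)) := by
  rw [Fintype.sum_sum_type, Finset.sum_add_distrib]
  congr 1
  · exact Finset.sum_coe_sort (latticeSet m) fun v => F v 0
  · exact Finset.sum_coe_sort (latticeSet m) fun v => F v (π / 2)

lemma hasDerivAt_arcPhase {x y x' y' : ℝ → ℝ} {t : ℝ} (hx : HasDerivAt x (x' t) t)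
    (hy : HasDerivAt y (y' t) t) (v : ℤ × ℤ) :
    HasDerivAt (arcPhase x y v) (arcPhase x' y' v t) t :=
  ((hx.const_mul _).add (hy.const_mul _)).const_mul _

lemma contDiff_arcPhase {x y : ℝ → ℝ} (hx : ContDiff ℝ (⊤ : ℕ∞) x) (hy : ContDiff ℝ (⊤ : ℕ∞) y)
    (v : ℤ × ℤ) : ContDiff ℝ (⊤ : ℕ∞) (arcPhase x y v) := by
  unfold arcPhase; fun_prop

lemma contDiff_arcU {m : ℕ} {x y : ℝ → ℝ} (hx : ContDiff ℝ (⊤ : ℕ∞) x)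
    (hy : ContDiff ℝ (⊤ : ℕ∞) y) (i : latIdx m) : ContDiff ℝ (⊤ : ℕ∞) (arcU m x y i) := by
  have := contDiff_arcPhase hx hy (latPt i)
  unfold arcU
  exact contDiff_const.mul (Real.contDiff_cos.comp (this.sub contDiff_const))

lemma hasDerivAt_deriv_of_contDiff {x : ℝ → ℝ} (hx : ContDiff ℝ (⊤ : ℕ∞) x) (t : ℝ) :
    HasDerivAt x (deriv x t) t :=
  ((hx.differentiable (by simp)) t).hasDerivAt

lemma contDiff_deriv_top {x : ℝ → ℝ} (hx : ContDiff ℝ (⊤ : ℕ∞) x) :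
    ContDiff ℝ (⊤ : ℕ∞) (deriv x) :=
  ((contDiff_infty_iff_deriv).1 hx).2

lemma iteratedDeriv_arcPhase (k : ℕ) {x y : ℝ → ℝ} (hx : ContDiff ℝ (⊤ : ℕ∞) x)
    (hy : ContDiff ℝ (⊤ : ℕ∞) y) (v : ℤ × ℤ) :
    iteratedDeriv k (arcPhase x y v) = arcPhase (iteratedDeriv k x) (iteratedDeriv k y) v := by
  induction k generalizing x y with
  | zero => simp
  | succ k ih =>
    have hd : deriv (arcPhase x y v) = arcPhase (deriv x) (deriv y) v :=
      funext fun t => (hasDerivAt_arcPhase (hasDerivAt_deriv_of_contDiff hx t)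
        (hasDerivAt_deriv_of_contDiff hy t) v).deriv
    rw [iteratedDeriv_succ', iteratedDeriv_succ', iteratedDeriv_succ', hd,
      ih (contDiff_deriv_top hx) (contDiff_deriv_top hy)]

lemma abs_arcPhase_le {m : ℕ} {x y : ℝ → ℝ} {v : ℤ × ℤ} (hv : v ∈ latticeSet m) {M t : ℝ}
    (hx : |x t| ≤ M) (hy : |y t| ≤ M) : |arcPhase x y v t| ≤ 2 * M * (√2 * π * √m) := by
  have hM : 0 ≤ M := (abs_nonneg _).trans hx
  have hvm : (v.1 : ℝ) ^ 2 + (v.2 : ℝ) ^ 2 = m := by exact_mod_cast mem_latticeSet.1 hv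
  have h1 : |(v.1 : ℝ) * x t + v.2 * y t| ≤ √2 * M * √m := by
    refine abs_le_of_sq_le_sq ?_ (by positivity)
    have e : (√2 * M * √m) ^ 2 = 2 * M ^ 2 * m := by
      rw [mul_pow, mul_pow, Real.sq_sqrt (by norm_num), Real.sq_sqrt (by positivity)]
    rw [e, ← hvm]
    have h2 : x t ^ 2 ≤ M ^ 2 := sq_le_sq' (abs_le.1 hx).1 (abs_le.1 hx).2
    have h3 : y t ^ 2 ≤ M ^ 2 := sq_le_sq' (abs_le.1 hy).1 (abs_le.1 hy).2
    have h4 : ((v.1 : ℝ) * x t + v.2 * y t) ^ 2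
        ≤ ((v.1 : ℝ) ^ 2 + (v.2 : ℝ) ^ 2) * (x t ^ 2 + y t ^ 2) := by
      nlinarith [sq_nonneg ((v.1 : ℝ) * y t - v.2 * x t)]
    calc _ ≤ _ := h4
      _ ≤ ((v.1 : ℝ) ^ 2 + (v.2 : ℝ) ^ 2) * (M ^ 2 + M ^ 2) := by gcongr
      _ = _ := by ring
  rw [arcPhase, abs_mul, abs_of_pos (by positivity : 0 < 2 * π)]
  calc _ ≤ 2 * π * (√2 * M * √m) := by gcongr
    _ = _ := by ring

/-- The speed of the arithmetic random wave. -/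
def arcσ (m : ℕ) : ℝ := √2 * π * √m

lemma arcσ_sq (m : ℕ) : arcσ m ^ 2 = 2 * π ^ 2 * m := by
  rw [arcσ, mul_pow, mul_pow, Real.sq_sqrt (by norm_num), Real.sq_sqrt (by positivity)]

lemma one_le_arcσ {m : ℕ} (hm : 0 < m) : 1 ≤ arcσ m := by
  have h0 : 0 ≤ arcσ m := by unfold arcσ; positivity
  have h1 : (1 : ℝ) ≤ m := by exact_mod_cast hm
  have h2 := arcσ_sq m
  have : 1 ≤ arcσ m ^ 2 := by
    rw [h2]; nlinarith [pi_gt_three, mul_le_mul pi_gt_three.le pi_gt_three.le (by norm_num) pi_pos.le]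
  nlinarith

lemma dk_arcU_zero {m : ℕ} (x y : ℝ → ℝ) (t : ℝ) (i : latIdx m) :
    dk (arcU m x y) 0 t i = (√(latN m))⁻¹ * cos (arcPhase x y (latPt i) t - latPh i) := by
  simp [dk, arcU]

lemma dk_arcU_one {m : ℕ} {x y : ℝ → ℝ} (hx : ContDiff ℝ (⊤ : ℕ∞) x)
    (hy : ContDiff ℝ (⊤ : ℕ∞) y) (t : ℝ) (i : latIdx m) :
    dk (arcU m x y) 1 t i = (√(latN m))⁻¹ * (-sin (arcPhase x y (latPt i) t - latPh i)
      * arcPhase (deriv x) (deriv y) (latPt i) t) := by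
  rw [dk, iteratedDeriv_one]
  exact ((((hasDerivAt_arcPhase (hasDerivAt_deriv_of_contDiff hx t)
    (hasDerivAt_deriv_of_contDiff hy t) (latPt i)).sub_const _).cos).const_mul _).deriv

lemma dk_arcU_two {m : ℕ} {x y : ℝ → ℝ} (hx : ContDiff ℝ (⊤ : ℕ∞) x)
    (hy : ContDiff ℝ (⊤ : ℕ∞) y) (t : ℝ) (i : latIdx m) :
    dk (arcU m x y) 2 t i = (√(latN m))⁻¹ * (-cos (arcPhase x y (latPt i) t - latPh i)
      * arcPhase (deriv x) (deriv y) (latPt i) t ^ 2 - sin (arcPhase x y (latPt i) t - latPh i)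
      * arcPhase (deriv (deriv x)) (deriv (deriv y)) (latPt i) t) := by
  have h1 : iteratedDeriv 1 (arcU m x y i) = fun t => (√(latN m))⁻¹ *
      (-sin (arcPhase x y (latPt i) t - latPh i) * arcPhase (deriv x) (deriv y) (latPt i) t) :=
    funext fun t => dk_arcU_one hx hy t i
  have e1 := (hasDerivAt_arcPhase (hasDerivAt_deriv_of_contDiff hx t)
    (hasDerivAt_deriv_of_contDiff hy t) (latPt i)).sub_const (latPh i)
  have e2 := hasDerivAt_arcPhase (hasDerivAt_deriv_of_contDiff (contDiff_deriv_top hx) t)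
    (hasDerivAt_deriv_of_contDiff (contDiff_deriv_top hy) t) (latPt i)
  rw [dk, iteratedDeriv_succ, h1]
  refine (((e1.sin.neg.mul e2).const_mul _).congr_deriv ?_).deriv
  simp only [Pi.neg_apply]
  ring

lemma abs_dk_arcU_le {m : ℕ} (hm : 0 < m) {x y : ℝ → ℝ} (hx : ContDiff ℝ (⊤ : ℕ∞) x)
    (hy : ContDiff ℝ (⊤ : ℕ∞) y) {M : ℝ} (hM : 1 ≤ M) {t : ℝ} {k : ℕ} (hk : k ≤ 6)
    (hxM : ∀ j ≤ 6, |iteratedDeriv j x t| ≤ M) (hyM : ∀ j ≤ 6, |iteratedDeriv j y t| ≤ M)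
    (i : latIdx m) : |dk (arcU m x y) k t i| ≤ (√(latN m))⁻¹ * (720 * (2 * M) ^ 6 * arcσ m ^ k) := by
  set f : ℝ → ℝ := fun t => arcPhase x y (latPt i) t - latPh i with hf
  have hfs : ContDiff ℝ (⊤ : ℕ∞) f := (contDiff_arcPhase hx hy _).sub contDiff_const
  have hσ := one_le_arcσ hm
  have hD : ∀ j, 1 ≤ j → j ≤ k → ‖iteratedFDeriv ℝ j f t‖ ≤ (2 * M * arcσ m) ^ j := by
    intro j hj hjk
    obtain ⟨j, rfl⟩ : ∃ l, j = l + 1 := ⟨j - 1, by omega⟩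
    have hd : deriv f = deriv (arcPhase x y (latPt i)) := funext fun t => by simp [hf]
    rw [norm_iteratedFDeriv_eq_norm_iteratedDeriv, Real.norm_eq_abs, iteratedDeriv_succ', hd,
      ← iteratedDeriv_succ', iteratedDeriv_arcPhase _ hx hy]
    have h1 := abs_arcPhase_le (latPt_mem i) (hxM (j + 1) (by omega)) (hyM (j + 1) (by omega))
    refine h1.trans ?_
    rw [← arcσ]
    exact le_self_pow₀ (by nlinarith) (by omega)
  have hC : ∀ j, j ≤ k → ‖iteratedFDeriv ℝ j cos (f t)‖ ≤ 1 := fun j _ => by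
    rw [norm_iteratedFDeriv_eq_norm_iteratedDeriv, Real.norm_eq_abs]
    exact Real.abs_iteratedDeriv_cos_le_one j _
  have h := norm_iteratedFDeriv_comp_le (N := (⊤ : ℕ∞)) Real.contDiff_cos hfs
    (by exact_mod_cast le_top) t hC hD
  rw [norm_iteratedFDeriv_eq_norm_iteratedDeriv, Real.norm_eq_abs] at h
  have e : dk (arcU m x y) k t i = (√(latN m))⁻¹ * iteratedDeriv k (cos ∘ f) t := by
    rw [dk, ← iteratedDeriv_const_mul_field]
    rfl
  rw [e, abs_mul, abs_of_nonneg (by positivity : 0 ≤ (√(latN m : ℝ))⁻¹)]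
  gcongr
  refine h.trans ?_
  have h6 : (k.factorial : ℝ) ≤ 720 := by
    have := Nat.factorial_le hk
    exact_mod_cast this
  have h7 : (2 * M) ^ k ≤ (2 * M) ^ 6 := pow_le_pow_right₀ (by linarith) hk
  rw [mul_one, mul_pow, ← mul_assoc]
  have : 0 ≤ M := by linarith
  have : 0 ≤ arcσ m := by linarith
  gcongr

lemma latN_pos {m : ℕ} (h : ∃ a b : ℤ, a ^ 2 + b ^ 2 = (m : ℤ)) : (0 : ℝ) < latN m := by
  obtain ⟨a, b, hab⟩ := h
  have : 0 < latN m := Finset.card_pos.2 ⟨(a, b), mem_latticeSet.2 hab⟩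
  exact_mod_cast this

/-- The arithmetic random wave along a unit-speed curve is a Gaussian process of constant speed. -/
lemma isProc_arcU {m : ℕ} (hm : 0 < m) (hN : (0 : ℝ) < latN m) {x y : ℝ → ℝ}
    (hx : ContDiff ℝ (⊤ : ℕ∞) x) (hy : ContDiff ℝ (⊤ : ℕ∞) y) {L M : ℝ} (hM : 1 ≤ M)
    (hxM : ∀ j ≤ 6, ∀ t ∈ Set.Icc 0 L, |iteratedDeriv j x t| ≤ M)
    (hyM : ∀ j ≤ 6, ∀ t ∈ Set.Icc 0 L, |iteratedDeriv j y t| ≤ M)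
    (hunit : ∀ t ∈ Set.Icc 0 L, deriv x t ^ 2 + deriv y t ^ 2 = 1)
    (horth : ∀ t ∈ Set.Icc 0 L, deriv x t * deriv (deriv x) t + deriv y t * deriv (deriv y) t = 0) :
    IsProc (arcU m x y) L (arcσ m) (2 * (720 * (2 * M) ^ 6)) := by
  have hw : ((√(latN m : ℝ))⁻¹) ^ 2 = (latN m : ℝ)⁻¹ := by
    rw [inv_pow, Real.sq_sqrt hN.le]
  have hw' : (√(latN m : ℝ))⁻¹ * (√(latN m : ℝ))⁻¹ = (latN m : ℝ)⁻¹ := by rw [← sq, hw]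
  have hσ := one_le_arcσ hm
  have h00 : ∀ t, ∑ i, dk (arcU m x y) 0 t i * dk (arcU m x y) 0 t i = 1 := by
    intro t
    simp only [dk_arcU_zero]
    rw [sum_latIdx (fun v p => (√(latN m))⁻¹ * cos (arcPhase x y v t - p)
      * ((√(latN m))⁻¹ * cos (arcPhase x y v t - p)))]
    simp only [cos_sub_pi_div_two, sub_zero]
    have : ∀ v ∈ latticeSet m, (√(latN m : ℝ))⁻¹ * cos (arcPhase x y v t)
        * ((√(latN m))⁻¹ * cos (arcPhase x y v t)) + (√(latN m))⁻¹ * sin (arcPhase x y v t)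
        * ((√(latN m))⁻¹ * sin (arcPhase x y v t)) = (latN m : ℝ)⁻¹ := fun v _ => by
      rw [← hw]; linear_combination ((√(latN m : ℝ))⁻¹) ^ 2 * cos_sq_add_sin_sq (arcPhase x y v t)
    rw [Finset.sum_eq_card_nsmul this, nsmul_eq_mul, ← latN]
    field_simp
  have hquad : ∀ (f g f' g' : ℝ → ℝ) (t : ℝ), ∑ v ∈ latticeSet m,
      (latN m : ℝ)⁻¹ * (arcPhase f g v t * arcPhase f' g' v t)
      = arcσ m ^ 2 * (f t * f' t + g t * g' t) := by
    intro f g f' g' t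
    have := sum_latticeSet_mul m (f t) (g t) (f' t) (g' t)
    rw [← Finset.mul_sum, arcσ_sq]
    have e : ∑ v ∈ latticeSet m, arcPhase f g v t * arcPhase f' g' v t
        = (2 * π) ^ 2 * ∑ v ∈ latticeSet m,
          ((v.1 : ℝ) * f t + v.2 * g t) * (v.1 * f' t + v.2 * g' t) := by
      rw [Finset.mul_sum]; exact Finset.sum_congr rfl fun v _ => by unfold arcPhase; ring
    rw [e, this]
    field_simp
  have h02 : ∀ t ∈ Set.Icc 0 L, ∑ i, dk (arcU m x y) 0 t i * dk (arcU m x y) 2 t i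
      = -arcσ m ^ 2 := by
    intro t ht
    simp only [dk_arcU_zero, dk_arcU_two hx hy]
    rw [sum_latIdx (fun v p => (√(latN m))⁻¹ * cos (arcPhase x y v t - p)
      * ((√(latN m))⁻¹ * (-cos (arcPhase x y v t - p) * arcPhase (deriv x) (deriv y) v t ^ 2
        - sin (arcPhase x y v t - p) * arcPhase (deriv (deriv x)) (deriv (deriv y)) v t)))]
    simp only [cos_sub_pi_div_two, sin_sub_pi_div_two, sub_zero]
    have h := hquad (deriv x) (deriv y) (deriv x) (deriv y) t
    rw [← sq, ← sq, hunit t ht, mul_one] at h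
    rw [← h, ← Finset.sum_neg_distrib]
    refine Finset.sum_congr rfl fun v _ => ?_
    rw [← hw]
    linear_combination -((√(latN m : ℝ))⁻¹) ^ 2 * arcPhase (deriv x) (deriv y) v t ^ 2
      * cos_sq_add_sin_sq (arcPhase x y v t)
  refine ⟨contDiff_arcU hx hy, by linarith, fun t _ => h00 t, ?_, ?_, ?_, ?_, ?_⟩
  · intro t ht
    simp only [dk_arcU_zero, dk_arcU_one hx hy]
    rw [sum_latIdx (fun v p => (√(latN m))⁻¹ * cos (arcPhase x y v t - p)
      * ((√(latN m))⁻¹ * (-sin (arcPhase x y v t - p) * arcPhase (deriv x) (deriv y) v t)))]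
    simp only [cos_sub_pi_div_two, sin_sub_pi_div_two, sub_zero]
    exact Finset.sum_eq_zero fun v _ => by ring
  · intro t ht
    simp only [dk_arcU_one hx hy]
    rw [sum_latIdx (fun v p => (√(latN m))⁻¹ *
        (-sin (arcPhase x y v t - p) * arcPhase (deriv x) (deriv y) v t)
      * ((√(latN m))⁻¹ * (-sin (arcPhase x y v t - p) * arcPhase (deriv x) (deriv y) v t)))]
    simp only [sin_sub_pi_div_two, sub_zero]
    have h := hquad (deriv x) (deriv y) (deriv x) (deriv y) t
    rw [← sq, ← sq, hunit t ht, mul_one] at h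
    rw [← h]
    refine Finset.sum_congr rfl fun v _ => ?_
    rw [← hw]
    linear_combination ((√(latN m : ℝ))⁻¹) ^ 2 * arcPhase (deriv x) (deriv y) v t ^ 2
      * cos_sq_add_sin_sq (arcPhase x y v t)
  · intro t ht
    simp only [dk_arcU_one hx hy, dk_arcU_two hx hy]
    rw [sum_latIdx (fun v p => (√(latN m))⁻¹ *
        (-sin (arcPhase x y v t - p) * arcPhase (deriv x) (deriv y) v t)
      * ((√(latN m))⁻¹ * (-cos (arcPhase x y v t - p) * arcPhase (deriv x) (deriv y) v t ^ 2
        - sin (arcPhase x y v t - p) * arcPhase (deriv (deriv x)) (deriv (deriv y)) v t)))]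
    simp only [cos_sub_pi_div_two, sin_sub_pi_div_two, sub_zero]
    have h := hquad (deriv x) (deriv y) (deriv (deriv x)) (deriv (deriv y)) t
    rw [horth t ht, mul_zero] at h
    rw [← h]
    refine Finset.sum_congr rfl fun v _ => ?_
    rw [← hw]
    linear_combination ((√(latN m : ℝ))⁻¹) ^ 2 * arcPhase (deriv x) (deriv y) v t
      * arcPhase (deriv (deriv x)) (deriv (deriv y)) v t * cos_sq_add_sin_sq (arcPhase x y v t)
  · intro t ht
    have := Finset.sum_mul_sq_le_sq_mul_sq Finset.univ (dk (arcU m x y) 0 t) (dk (arcU m x y) 2 t)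
    rw [h02 t ht] at this
    have h0 := h00 t
    simp only [← sq] at h0
    rw [h0, one_mul] at this
    calc arcσ m ^ 4 = (-arcσ m ^ 2) ^ 2 := by ring
      _ ≤ _ := this
  · intro k hk t ht
    have hb := fun i => abs_dk_arcU_le hm hx hy hM hk (fun j hj => hxM j hj t ht)
      (fun j hj => hyM j hj t ht) i
    have hcard : (Fintype.card (latIdx m) : ℝ) = 2 * latN m := by
      simp [latN, two_mul]
    calc ∑ i, dk (arcU m x y) k t i ^ 2
        ≤ ∑ _i : latIdx m, ((√(latN m : ℝ))⁻¹ * (720 * (2 * M) ^ 6 * arcσ m ^ k)) ^ 2 := by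
          refine Finset.sum_le_sum fun i _ => ?_
          rw [← sq_abs]
          exact pow_le_pow_left₀ (abs_nonneg _) (hb i) 2
      _ = 2 * (720 * (2 * M) ^ 6 * arcσ m ^ k) ^ 2 := by
          rw [Finset.sum_const, nsmul_eq_mul, Finset.card_univ, hcard, mul_pow, hw]
          field_simp
      _ ≤ 4 * (720 * (2 * M) ^ 6 * arcσ m ^ k) ^ 2 := by
          nlinarith [sq_nonneg (720 * (2 * M) ^ 6 * arcσ m ^ k)]
      _ = _ := by rw [mul_comm 2 k, pow_mul]; ring

/-- The variance of the nodal count in terms of the coefficient functions. -/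
lemma variance_nodalCount_eq (m : ℕ) (γ : ℝ → ℝ × ℝ) (L : ℝ) :
    variance (fun ω => (nodalCount m γ L ω : ℝ)) (waveMeasure m)
      = variance (fun ω => (Set.ncard {t | t ∈ Set.Icc 0 L ∧
        proc (arcU m (fun t => (γ t).1) (fun t => (γ t).2)) 0 t ω = 0} : ℝ)) (stdG (latIdx m)) := by
  have h := measurePreserving_sumPiEquivProdPi (ι := ↥(latticeSet m)) (ι' := ↥(latticeSet m))
    (X := fun _ => ℝ) fun _ => gaussianReal 0 1
  rw [waveMeasure, ← h.map_eq, variance_map_equiv]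
  congr 1
  funext ω
  simp only [Function.comp, nodalCount]
  congr 3
  ext t
  suffices wave m (MeasurableEquiv.sumPiEquivProdPi (fun _ => ℝ) ω) (γ t)
    = proc (arcU m (fun t => (γ t).1) (fun t => (γ t).2)) 0 t ω by
    rw [this]
  simp only [wave, proc, lin, dk_arcU_zero, Fintype.sum_sum_type, latPt, latPh, Sum.elim_inl,
    Sum.elim_inr, cos_sub_pi_div_two, sub_zero]
  rw [← Finset.sum_add_distrib, Finset.mul_sum]
  refine Finset.sum_congr rfl fun v _ => ?_
  simp only [arcPhase, MeasurableEquiv.coe_sumPiEquivProdPi, Equiv.sumPiEquivProdPi]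
  simp only [Equiv.coe_fn_mk]
  ring

/-- The Gram matrix of the normalised `a`-th derivatives of the coefficient functions. -/
def gramU {ι : Type} (u : ι → ℝ → ℝ) (σ L : ℝ) (a : ℕ) (i j : ι) : ℝ :=
  ∫ t in (0)..L, dk u a t i / σ ^ a * (dk u a t j / σ ^ a)

lemma integral_sum_sum {ι κ : Type} [Fintype ι] [Fintype κ] {f : ι → κ → ℝ → ℝ}
    (hf : ∀ i j, Continuous (f i j)) (a b : ℝ) :
    ∫ t in a..b, ∑ i, ∑ j, f i j t = ∑ i, ∑ j, ∫ t in a..b, f i j t := by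
  rw [intervalIntegral.integral_finsetSum fun i _ => Continuous.intervalIntegrable
    (continuous_finsetSum _ fun j _ => hf i j) _ _]
  refine Finset.sum_congr rfl fun i _ => ?_
  rw [intervalIntegral.integral_finsetSum fun j _ => (hf i j).intervalIntegrable _ _]

lemma integral_integral_corr_sq {ι : Type} [Fintype ι] {u : ι → ℝ → ℝ}
    (hu : ∀ i, ContDiff ℝ (⊤ : ℕ∞) (u i)) (σ L : ℝ) (a b : Fin 2) :
    ∫ t in (0)..L, ∫ s in (0)..L, corr u σ a b t s ^ 2
      = ∑ i, ∑ j, gramU u σ L a i j * gramU u σ L b i j := by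
  have hc : ∀ (k : ℕ) (i j : ι), Continuous fun t => dk u k t i / σ ^ k * (dk u k t j / σ ^ k) :=
    fun k i j => ((continuous_dk hu k i).div_const _).mul ((continuous_dk hu k j).div_const _)
  have e : ∀ t s, corr u σ a b t s ^ 2 = ∑ i, ∑ j,
      (dk u a t i / σ ^ (a : ℕ) * (dk u a t j / σ ^ (a : ℕ)))
        * (dk u b s i / σ ^ (b : ℕ) * (dk u b s j / σ ^ (b : ℕ))) := by
    intro t s
    rw [corr, sq, Finset.sum_div, Finset.sum_mul_sum]
    refine Finset.sum_congr rfl fun i _ => Finset.sum_congr rfl fun j _ => ?_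
    rw [pow_add]
    simp only [div_eq_mul_inv, mul_inv]
    ring
  simp only [e]
  have e1 : ∀ t, ∫ s in (0)..L, ∑ i, ∑ j,
      (dk u a t i / σ ^ (a : ℕ) * (dk u a t j / σ ^ (a : ℕ)))
        * (dk u b s i / σ ^ (b : ℕ) * (dk u b s j / σ ^ (b : ℕ)))
      = ∑ i, ∑ j, (dk u a t i / σ ^ (a : ℕ) * (dk u a t j / σ ^ (a : ℕ))) * gramU u σ L b i j := by
    intro t
    rw [integral_sum_sum (f := fun i j s => (dk u a t i / σ ^ (a : ℕ) * (dk u a t j / σ ^ (a : ℕ)))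
      * (dk u b s i / σ ^ (b : ℕ) * (dk u b s j / σ ^ (b : ℕ)))) fun i j => (hc b i j).const_mul _]
    refine Finset.sum_congr rfl fun i _ => Finset.sum_congr rfl fun j _ => ?_
    rw [intervalIntegral.integral_const_mul, gramU]
  simp only [e1]
  rw [integral_sum_sum (f := fun i j t => (dk u a t i / σ ^ (a : ℕ) * (dk u a t j / σ ^ (a : ℕ)))
    * gramU u σ L b i j) fun i j => (hc a i j).mul_const _]
  refine Finset.sum_congr rfl fun i _ => Finset.sum_congr rfl fun j _ => ?_
  rw [intervalIntegral.integral_mul_const]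
  rfl

lemma continuous_corr {ι : Type} [Fintype ι] {u : ι → ℝ → ℝ}
    (hu : ∀ i, ContDiff ℝ (⊤ : ℕ∞) (u i)) (σ : ℝ) (a b : Fin 2) :
    Continuous fun p : ℝ × ℝ => corr u σ a b p.1 p.2 :=
  (continuous_finsetSum _ fun i _ => ((continuous_dk hu a i).comp continuous_fst).mul
    ((continuous_dk hu b i).comp continuous_snd)).div_const _

lemma integral_integral_corrSq_le {ι : Type} [Fintype ι] {u : ι → ℝ → ℝ}
    (hu : ∀ i, ContDiff ℝ (⊤ : ℕ∞) (u i)) (σ L : ℝ) {K : ℝ}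
    (hK : ∀ a : Fin 2, ∑ i, ∑ j, gramU u σ L a i j ^ 2 ≤ K) :
    ∫ t in (0)..L, ∫ s in (0)..L, corrSq u σ t s ≤ 4 * K := by
  have hc : ∀ a b : Fin 2, Continuous fun p : ℝ × ℝ => corr u σ a b p.1 p.2 ^ 2 := fun a b =>
    (continuous_corr hu σ a b).pow 2
  have hin : ∀ (t : ℝ) (a b : Fin 2), Continuous fun s => corr u σ a b t s ^ 2 := fun t a b =>
    Continuous.comp (g := fun p : ℝ × ℝ => corr u σ a b p.1 p.2 ^ 2) (f := fun s : ℝ => (t, s))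
      (hc a b) (by fun_prop)
  have hout : ∀ a b : Fin 2, Continuous fun t => ∫ s in (0)..L, corr u σ a b t s ^ 2 := fun a b =>
    intervalIntegral.continuous_parametric_intervalIntegral_of_continuous'
      (f := fun t s => corr u σ a b t s ^ 2) (hc a b) 0 L
  have e : ∫ t in (0)..L, ∫ s in (0)..L, corrSq u σ t s
      = ∑ a : Fin 2, ∑ b : Fin 2, ∑ i, ∑ j, gramU u σ L a i j * gramU u σ L b i j := by
    have e1 : ∀ t, ∫ s in (0)..L, corrSq u σ t s
        = ∑ a : Fin 2, ∑ b : Fin 2, ∫ s in (0)..L, corr u σ a b t s ^ 2 := fun t =>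
      integral_sum_sum (hin t) 0 L
    simp only [e1]
    rw [integral_sum_sum (f := fun a b t => ∫ s in (0)..L, corr u σ a b t s ^ 2) hout]
    exact Finset.sum_congr rfl fun a _ => Finset.sum_congr rfl fun b _ =>
      integral_integral_corr_sq hu σ L a b
  rw [e]
  have h : ∀ a b : Fin 2, ∑ i, ∑ j, gramU u σ L a i j * gramU u σ L b i j ≤ K := by
    intro a b
    have : ∑ i, ∑ j, gramU u σ L a i j * gramU u σ L b i j
        ≤ ∑ i, ∑ j, (gramU u σ L a i j ^ 2 / 2 + gramU u σ L b i j ^ 2 / 2) := by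
      refine Finset.sum_le_sum fun i _ => Finset.sum_le_sum fun j _ => ?_
      nlinarith [sq_nonneg (gramU u σ L a i j - gramU u σ L b i j)]
    simp only [Finset.sum_add_distrib, ← Finset.sum_div] at this
    have := hK a
    have := hK b
    linarith
  simp only [Fin.sum_univ_two]
  linarith [h 0 0, h 0 1, h 1 0, h 1 1]

/-- The decay rate of an oscillatory integral along the curve with frequency `v`. -/
def oscW (v : ℤ × ℤ) : ℝ := if v = 0 then 1 else (√(latNorm v))⁻¹

lemma oscW_sq (v : ℤ × ℤ) : oscW v ^ 2 = if v = 0 then 1 else 1 / latNorm v := by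
  unfold oscW
  split_ifs
  · simp
  · rw [inv_pow, Real.sq_sqrt (by unfold latNorm; positivity), one_div]

lemma sum_oscW_sub_sq_le {m : ℕ} (hm : 0 < m) {w : ℤ × ℤ} (hw : w ∈ latticeSet m) :
    ∑ v ∈ latticeSet m, oscW (w - v) ^ 2 ≤ 1 + 8 * ∑' k, latMajor k := by
  rw [← Finset.add_sum_erase _ _ hw]
  have h := sum_inv_latNorm_le hm (mem_latticeSet.1 hw)
  have e : ∑ v ∈ (latticeSet m).erase w, oscW (w - v) ^ 2
      = ∑ v ∈ (latticeSet m).erase w, 1 / latNorm (w - v) := by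
    refine Finset.sum_congr rfl fun v hv => ?_
    rw [oscW_sq, if_neg (sub_ne_zero.2 (Finset.ne_of_mem_erase hv).symm)]
  rw [e, oscW_sq, sub_self, if_pos rfl]
  linarith

lemma sum_oscW_add_sq_le {m : ℕ} (hm : 0 < m) {w : ℤ × ℤ} (hw : w ∈ latticeSet m) :
    ∑ v ∈ latticeSet m, oscW (w + v) ^ 2 ≤ 1 + 8 * ∑' k, latMajor k := by
  rw [sum_latticeSet_neg]
  simpa only [← sub_eq_add_neg] using sum_oscW_sub_sq_le hm hw

/-- A plane curve of unit speed on `[0, L]`, with curvature at least `c` and derivatives up to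
order `6` bounded by `M`. -/
structure IsArc (x y : ℝ → ℝ) (L c M : ℝ) : Prop where
  smooth_x : ContDiff ℝ (⊤ : ℕ∞) x
  smooth_y : ContDiff ℝ (⊤ : ℕ∞) y
  L_pos : 0 < L
  c_pos : 0 < c
  c_le : c ≤ 1
  one_le_M : 1 ≤ M
  bound_x : ∀ j ≤ 6, ∀ t ∈ Set.Icc 0 L, |iteratedDeriv j x t| ≤ M
  bound_y : ∀ j ≤ 6, ∀ t ∈ Set.Icc 0 L, |iteratedDeriv j y t| ≤ M
  unit : ∀ t ∈ Set.Icc 0 L, deriv x t ^ 2 + deriv y t ^ 2 = 1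
  orth : ∀ t ∈ Set.Icc 0 L, deriv x t * deriv (deriv x) t + deriv y t * deriv (deriv y) t = 0
  curv : ∀ t ∈ Set.Icc 0 L, c ^ 2 ≤ deriv (deriv x) t ^ 2 + deriv (deriv y) t ^ 2

/-- The constant in the bound for oscillatory integrals along an arc. -/
def oscC (L c M : ℝ) : ℝ := L + vdcC L c (2 * M) (2 * M)

lemma vdcC_nonneg {L c B : ℝ} (hL : 0 ≤ L) (hB : 0 ≤ B) : 0 ≤ vdcC L c B B := by
  unfold vdcC; positivity

lemma abs_integral_arc_le {x y : ℝ → ℝ} {L c M : ℝ} (h : IsArc x y L c M) {a a' : ℝ → ℝ} {A : ℝ}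
    (ha : ∀ t, HasDerivAt a (a' t) t) (ha' : Continuous a')
    (hA : ∀ t ∈ Set.Icc 0 L, |a t| ≤ A) (hA' : ∀ t ∈ Set.Icc 0 L, |a' t| ≤ A)
    (v : ℤ × ℤ) (p : ℝ) :
    |∫ t in (0)..L, a t * cos (arcPhase x y v t - p)| ≤ oscC L c M * A * oscW v := by
  have hL := h.L_pos
  have hM := h.one_le_M
  have hV := vdcC_nonneg (c := c) (B := 2 * M) hL.le (by linarith)
  have hA0 : 0 ≤ A := (abs_nonneg _).trans (hA 0 ⟨le_rfl, hL.le⟩)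
  by_cases hv : v = 0
  · rw [oscW, if_pos hv, ← Real.norm_eq_abs]
    have := intervalIntegral.norm_integral_le_of_norm_le_const (a := 0) (b := L) (C := A)
      (f := fun t => a t * cos (arcPhase x y v t - p)) fun t ht => by
        rw [Set.uIoc_of_le hL.le] at ht
        rw [Real.norm_eq_abs, abs_mul]
        calc _ ≤ A * 1 := mul_le_mul (hA t (Set.Ioc_subset_Icc_self ht)) (abs_cos_le_one _)
              (abs_nonneg _) hA0
          _ = A := mul_one A
    refine this.trans ?_
    rw [sub_zero, abs_of_pos hL, oscC]
    nlinarith [mul_nonneg hV hA0]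
  · rw [oscW, if_neg hv]
    have hr := one_le_latNorm hv
    set r := latNorm v with hrdef
    have hr0 : 0 < r := by linarith
    have hr2 : r ^ 2 = (v.1 : ℝ) ^ 2 + (v.2 : ℝ) ^ 2 := Real.sq_sqrt (by positivity)
    set θ := fun (f g : ℝ → ℝ) (t : ℝ) => ((v.1 : ℝ) * f t + v.2 * g t) / r with hθ
    have hθd : ∀ f g : ℝ → ℝ, ContDiff ℝ (⊤ : ℕ∞) f → ContDiff ℝ (⊤ : ℕ∞) g → ∀ t,
        HasDerivAt (θ f g) (θ (deriv f) (deriv g) t) t := fun f g hf hg t =>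
      (((hasDerivAt_deriv_of_contDiff hf t).const_mul _).add
        ((hasDerivAt_deriv_of_contDiff hg t).const_mul _)).div_const _
    have hθb : ∀ f g : ℝ → ℝ, ∀ t, |f t| ≤ M → |g t| ≤ M → |θ f g t| ≤ 2 * M := by
      intro f g t hf hg
      refine abs_le_of_sq_le_sq ?_ (by linarith)
      rw [hθ]
      simp only
      rw [div_pow, div_le_iff₀ (by positivity), hr2]
      have h2 : f t ^ 2 ≤ M ^ 2 := sq_le_sq' (abs_le.1 hf).1 (abs_le.1 hf).2
      have h3 : g t ^ 2 ≤ M ^ 2 := sq_le_sq' (abs_le.1 hg).1 (abs_le.1 hg).2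
      calc ((v.1 : ℝ) * f t + v.2 * g t) ^ 2
          ≤ (f t ^ 2 + g t ^ 2) * ((v.1 : ℝ) ^ 2 + (v.2 : ℝ) ^ 2) := by
            nlinarith [sq_nonneg ((v.1 : ℝ) * g t - v.2 * f t)]
        _ ≤ (2 * M) ^ 2 * ((v.1 : ℝ) ^ 2 + (v.2 : ℝ) ^ 2) := by
            gcongr
            nlinarith [sq_nonneg M]
    have hx1 := contDiff_deriv_top h.smooth_x
    have hy1 := contDiff_deriv_top h.smooth_y
    have hx2 := contDiff_deriv_top hx1
    have hy2 := contDiff_deriv_top hy1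
    have hx3 := contDiff_deriv_top hx2
    have hy3 := contDiff_deriv_top hy2
    set δ : ℝ := (√(2 * π * r))⁻¹ with hδ
    have hpr : 1 ≤ 2 * π * r := by nlinarith [pi_gt_three]
    have hδ0 : 0 < δ := by positivity
    have hδ1 : δ ≤ 1 := inv_le_one_of_one_le₀ (Real.one_le_sqrt.2 hpr)
    have hδ2 : δ ^ 2 = (2 * π * r)⁻¹ := by rw [hδ, inv_pow, Real.sq_sqrt (by positivity)]
    have hδr : δ ≤ (√r)⁻¹ := by
      rw [hδ]
      gcongr
      nlinarith [pi_gt_three]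
    have key := abs_integral_mul_cos_le (Φ := fun t => arcPhase x y v t - p)
      (θ := θ (deriv x) (deriv y)) (θ' := θ (deriv (deriv x)) (deriv (deriv y)))
      (θ'' := θ (deriv (deriv (deriv x))) (deriv (deriv (deriv y))))
      (a := a) (a' := a') (L := L) (δ := δ) (c := c) (A := A) (B₁ := 2 * M) (B₂ := 2 * M)
      (fun t => by
        refine ((hasDerivAt_arcPhase (hasDerivAt_deriv_of_contDiff h.smooth_x t)
          (hasDerivAt_deriv_of_contDiff h.smooth_y t) v).sub_const p).congr_deriv ?_
        rw [hδ2]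
        simp only [hθ, arcPhase]
        field_simp)
      (hθd _ _ hx1 hy1) (hθd _ _ hx2 hy2)
      (by
        have := hx3.continuous
        have := hy3.continuous
        simp only [hθ]
        fun_prop)
      ha ha' hL.le hδ0 hδ1 h.c_pos hA hA'
      (fun t ht => by
        refine abs_le_of_sq_le_sq ?_ zero_le_one
        simp only [hθ]
        rw [div_pow, div_le_iff₀ (by positivity), hr2]
        have := h.unit t ht
        have e : ((v.1 : ℝ) ^ 2 + (v.2 : ℝ) ^ 2) * (deriv x t ^ 2 + deriv y t ^ 2)
          = ((v.1 : ℝ) * deriv x t + v.2 * deriv y t) ^ 2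
            + ((v.1 : ℝ) * deriv y t - v.2 * deriv x t) ^ 2 := by ring
        rw [this, mul_one] at e
        nlinarith [sq_nonneg ((v.1 : ℝ) * deriv y t - v.2 * deriv x t)])
      (fun t ht => by
        have e1 := h.bound_x 2 (by norm_num) t ht
        have e2 := h.bound_y 2 (by norm_num) t ht
        rw [iteratedDeriv_succ, iteratedDeriv_one] at e1 e2
        exact hθb _ _ _ e1 e2)
      (fun t ht => by
        have e1 := h.bound_x 3 (by norm_num) t ht
        have e2 := h.bound_y 3 (by norm_num) t ht
        rw [iteratedDeriv_succ, iteratedDeriv_succ, iteratedDeriv_one] at e1 e2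
        exact hθb _ _ _ e1 e2)
      (fun t ht => by
        have hu := h.unit t ht
        have ho := h.orth t ht
        have hcv := h.curv t ht
        simp only [hθ]
        rw [div_pow, div_pow, ← add_div, le_div_iff₀ (by positivity), hr2]
        set X := deriv x t
        set Y := deriv y t
        set X' := deriv (deriv x) t
        set Y' := deriv (deriv y) t
        set κ := X * Y' - Y * X' with hκ
        have eX : X' = -κ * Y := by rw [hκ]; linear_combination X' * (-hu) + X * ho
        have eY : Y' = κ * X := by rw [hκ]; linear_combination Y' * (-hu) + Y * ho
        have hκ2 : c ^ 2 ≤ κ ^ 2 := by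
          have : X' ^ 2 + Y' ^ 2 = κ ^ 2 := by
            rw [eX, eY]; linear_combination κ ^ 2 * hu
          linarith
        have hc1 : c ^ 2 ≤ 1 := pow_le_one₀ h.c_pos.le h.c_le
        have e3 : ((v.1 : ℝ) * X' + v.2 * Y') ^ 2 = κ ^ 2 * ((v.1 : ℝ) * Y - v.2 * X) ^ 2 := by
          rw [eX, eY]; ring
        have e4 : (v.1 : ℝ) ^ 2 + (v.2 : ℝ) ^ 2
            = ((v.1 : ℝ) * X + v.2 * Y) ^ 2 + ((v.1 : ℝ) * Y - v.2 * X) ^ 2 := by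
          linear_combination ((v.1 : ℝ) ^ 2 + (v.2 : ℝ) ^ 2) * (-hu)
        rw [e3, e4, mul_add]
        have f1 : c ^ 2 * ((v.1 : ℝ) * X + v.2 * Y) ^ 2 ≤ 1 * ((v.1 : ℝ) * X + v.2 * Y) ^ 2 := by
          gcongr
        have f2 : c ^ 2 * ((v.1 : ℝ) * Y - v.2 * X) ^ 2
            ≤ κ ^ 2 * ((v.1 : ℝ) * Y - v.2 * X) ^ 2 := by gcongr
        linarith)
    refine key.trans ?_
    unfold oscC
    gcongr
    linarith

lemma arcPhase_sub (x y : ℝ → ℝ) (v w : ℤ × ℤ) (t : ℝ) :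
    arcPhase x y (v - w) t = arcPhase x y v t - arcPhase x y w t := by
  simp only [arcPhase, Prod.fst_sub, Prod.snd_sub]; push_cast; ring

lemma arcPhase_add (x y : ℝ → ℝ) (v w : ℤ × ℤ) (t : ℝ) :
    arcPhase x y (v + w) t = arcPhase x y v t + arcPhase x y w t := by
  simp only [arcPhase, Prod.fst_add, Prod.snd_add]; push_cast; ring

lemma IsArc.continuous_osc {x y : ℝ → ℝ} {L c M : ℝ} (h : IsArc x y L c M) (v : ℤ × ℤ) (p : ℝ) :
    Continuous fun t => cos (arcPhase x y v t - p) :=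
  continuous_cos.comp ((contDiff_arcPhase h.smooth_x h.smooth_y v).continuous.sub continuous_const)

/-- Products of two waves with a smooth amplitude have small integrals. -/
lemma IsArc.abs_integral_pair_le {x y : ℝ → ℝ} {L c M : ℝ} (h : IsArc x y L c M) {a a' : ℝ → ℝ}
    {A : ℝ} (ha : ∀ t, HasDerivAt a (a' t) t) (ha' : Continuous a')
    (hA : ∀ t ∈ Set.Icc 0 L, |a t| ≤ A) (hA' : ∀ t ∈ Set.Icc 0 L, |a' t| ≤ A)
    (v w : ℤ × ℤ) (p q ε : ℝ) (hε : |ε| = 1) {f : ℝ → ℝ} {N : ℝ} (hN : 0 < N)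
    (hf : ∀ t, f t = (2 * N)⁻¹ * (a t * cos (arcPhase x y (v - w) t - p)
      + ε * (a t * cos (arcPhase x y (v + w) t - q)))) :
    |∫ t in (0)..L, f t| ≤ (2 * N)⁻¹ * (oscC L c M * A * (oscW (v - w) + oscW (v + w))) := by
  have hac : Continuous a := continuous_iff_continuousAt.2 fun t => (ha t).continuousAt
  have c1 : Continuous fun t => a t * cos (arcPhase x y (v - w) t - p) :=
    hac.mul (h.continuous_osc (v - w) p)
  have c2 : Continuous fun t => ε * (a t * cos (arcPhase x y (v + w) t - q)) :=
    continuous_const.mul (hac.mul (h.continuous_osc (v + w) q))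
  have b1 := abs_integral_arc_le h ha ha' hA hA' (v - w) p
  have b2 := abs_integral_arc_le h ha ha' hA hA' (v + w) q
  simp only [hf]
  rw [intervalIntegral.integral_const_mul, intervalIntegral.integral_add
    (c1.intervalIntegrable _ _) (c2.intervalIntegrable _ _),
    intervalIntegral.integral_const_mul, abs_mul, abs_of_pos (by positivity : 0 < (2 * N)⁻¹)]
  gcongr
  refine (abs_add_le _ _).trans ?_
  rw [abs_mul ε, hε, one_mul]
  linarith

/-- The constant in the bound for the Gram matrices. -/
def gramC (L c M : ℝ) : ℝ := oscC L c M * (8 * M ^ 2)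

lemma abs_gramU_le {m : ℕ} (hm : 0 < m) (hN : (0 : ℝ) < latN m) {x y : ℝ → ℝ} {L c M : ℝ}
    (h : IsArc x y L c M) (a : Fin 2) (i j : latIdx m) :
    |gramU (arcU m x y) (arcσ m) L a i j| ≤ (2 * (latN m : ℝ))⁻¹ * (gramC L c M
      * (oscW (latPt i - latPt j) + oscW (latPt i + latPt j))) := by
  have hw : (√(latN m : ℝ))⁻¹ * (√(latN m : ℝ))⁻¹ = (latN m : ℝ)⁻¹ := by
    rw [← mul_inv, Real.mul_self_sqrt hN.le]
  have hσ : 0 < arcσ m := zero_lt_one.trans_le (one_le_arcσ hm)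
  have hM := h.one_le_M
  have hx1 := contDiff_deriv_top h.smooth_x
  have hy1 := contDiff_deriv_top h.smooth_y
  have hx2 := contDiff_deriv_top hx1
  have hy2 := contDiff_deriv_top hy1
  fin_cases a
  · refine h.abs_integral_pair_le (a := fun _ => 1) (a' := fun _ => 0)
      (p := latPh i - latPh j) (q := latPh i + latPh j) (ε := 1)
      (fun t => hasDerivAt_const t 1) continuous_const
      (fun t _ => ?_) (fun t _ => ?_) _ _ abs_one hN fun t => ?_
    · rw [abs_one]; nlinarith
    · rw [abs_zero]; positivity
    · simp only [dk_arcU_zero, arcPhase_sub, arcPhase_add, pow_zero, div_one]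
      have e1 : arcPhase x y (latPt i) t - arcPhase x y (latPt j) t - (latPh i - latPh j)
        = (arcPhase x y (latPt i) t - latPh i) - (arcPhase x y (latPt j) t - latPh j) := by ring
      have e2 : arcPhase x y (latPt i) t + arcPhase x y (latPt j) t - (latPh i + latPh j)
        = (arcPhase x y (latPt i) t - latPh i) + (arcPhase x y (latPt j) t - latPh j) := by ring
      rw [e1, e2]
      generalize arcPhase x y (latPt i) t - latPh i = A
      generalize arcPhase x y (latPt j) t - latPh j = B
      rw [cos_sub A B, cos_add A B, mul_inv, ← hw]
      ring
  · have hb1 : ∀ t ∈ Set.Icc 0 L, ∀ k : latIdx m,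
        |arcPhase (deriv x) (deriv y) (latPt k) t / arcσ m| ≤ 2 * M := by
      intro t ht k
      have e1 := h.bound_x 1 (by norm_num) t ht
      have e2 := h.bound_y 1 (by norm_num) t ht
      rw [iteratedDeriv_one] at e1 e2
      rw [abs_div, abs_of_pos hσ, div_le_iff₀ hσ]
      exact abs_arcPhase_le (latPt_mem k) e1 e2
    have hb2 : ∀ t ∈ Set.Icc 0 L, ∀ k : latIdx m,
        |arcPhase (deriv (deriv x)) (deriv (deriv y)) (latPt k) t / arcσ m| ≤ 2 * M := by
      intro t ht k
      have e1 := h.bound_x 2 (by norm_num) t ht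
      have e2 := h.bound_y 2 (by norm_num) t ht
      rw [iteratedDeriv_succ, iteratedDeriv_one] at e1 e2
      rw [abs_div, abs_of_pos hσ, div_le_iff₀ hσ]
      exact abs_arcPhase_le (latPt_mem k) e1 e2
    have hprod : ∀ r s : ℝ, |r| ≤ 2 * M → |s| ≤ 2 * M → |r * s| ≤ 4 * M ^ 2 := by
      intro r s hr hs
      rw [abs_mul]
      calc |r| * |s| ≤ 2 * M * (2 * M) := mul_le_mul hr hs (abs_nonneg _) (by linarith)
        _ = _ := by ring
    have hd : ∀ (k : latIdx m) (t : ℝ), HasDerivAt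
        (fun t => arcPhase (deriv x) (deriv y) (latPt k) t / arcσ m)
        (arcPhase (deriv (deriv x)) (deriv (deriv y)) (latPt k) t / arcσ m) t := fun k t =>
      (hasDerivAt_arcPhase (hasDerivAt_deriv_of_contDiff hx1 t)
        (hasDerivAt_deriv_of_contDiff hy1 t) _).div_const _
    have hc1 := fun k : latIdx m => (contDiff_arcPhase hx1 hy1 (latPt k)).continuous
    have hc2 := fun k : latIdx m => (contDiff_arcPhase hx2 hy2 (latPt k)).continuous
    refine h.abs_integral_pair_le
      (a := fun t => arcPhase (deriv x) (deriv y) (latPt i) t / arcσ m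
        * (arcPhase (deriv x) (deriv y) (latPt j) t / arcσ m))
      (a' := fun t => arcPhase (deriv (deriv x)) (deriv (deriv y)) (latPt i) t / arcσ m
        * (arcPhase (deriv x) (deriv y) (latPt j) t / arcσ m)
        + arcPhase (deriv x) (deriv y) (latPt i) t / arcσ m
        * (arcPhase (deriv (deriv x)) (deriv (deriv y)) (latPt j) t / arcσ m))
      (p := latPh i - latPh j) (q := latPh i + latPh j) (ε := -1)
      (fun t => (hd i t).mul (hd j t)) ?_
      (fun t ht => ?_) (fun t ht => ?_) _ _ (by simp) hN fun t => ?_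
    · have := hc1 i
      have := hc1 j
      have := hc2 i
      have := hc2 j
      fun_prop
    · refine (hprod _ _ (hb1 t ht i) (hb1 t ht j)).trans ?_
      nlinarith
    · refine (abs_add_le _ _).trans ?_
      have := hprod _ _ (hb2 t ht i) (hb1 t ht j)
      have := hprod _ _ (hb1 t ht i) (hb2 t ht j)
      linarith
    · simp only [dk_arcU_one h.smooth_x h.smooth_y, arcPhase_sub, arcPhase_add, pow_one]
      have e1 : arcPhase x y (latPt i) t - arcPhase x y (latPt j) t - (latPh i - latPh j)
        = (arcPhase x y (latPt i) t - latPh i) - (arcPhase x y (latPt j) t - latPh j) := by ring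
      have e2 : arcPhase x y (latPt i) t + arcPhase x y (latPt j) t - (latPh i + latPh j)
        = (arcPhase x y (latPt i) t - latPh i) + (arcPhase x y (latPt j) t - latPh j) := by ring
      rw [e1, e2]
      generalize arcPhase x y (latPt i) t - latPh i = A
      generalize arcPhase x y (latPt j) t - latPh j = B
      rw [cos_sub A B, cos_add A B, mul_inv, ← hw]
      ring

/-- The constant in the bound for the total correlation. -/
def corrC (L c M : ℝ) : ℝ := 4 * gramC L c M ^ 2 * (1 + 8 * ∑' k, latMajor k)

lemma sum_gramU_sq_le {m : ℕ} (hm : 0 < m) (hN : (0 : ℝ) < latN m) {x y : ℝ → ℝ} {L c M : ℝ}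
    (h : IsArc x y L c M) (a : Fin 2) :
    ∑ i, ∑ j, gramU (arcU m x y) (arcσ m) L a i j ^ 2 ≤ corrC L c M / latN m := by
  set T := 1 + 8 * ∑' k, latMajor k with hT
  set G := gramC L c M with hG
  have hle : ∀ i j : latIdx m, gramU (arcU m x y) (arcσ m) L a i j ^ 2
      ≤ G ^ 2 / (2 * (latN m : ℝ) ^ 2)
        * (oscW (latPt i - latPt j) ^ 2 + oscW (latPt i + latPt j) ^ 2) := by
    intro i j
    have hb := abs_gramU_le hm hN h a i j
    rw [← sq_abs]
    calc _ ≤ ((2 * (latN m : ℝ))⁻¹ * (G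
          * (oscW (latPt i - latPt j) + oscW (latPt i + latPt j)))) ^ 2 :=
          pow_le_pow_left₀ (abs_nonneg _) hb 2
      _ = G ^ 2 / (4 * (latN m : ℝ) ^ 2)
          * (oscW (latPt i - latPt j) + oscW (latPt i + latPt j)) ^ 2 := by
          field_simp; norm_num; ring
      _ ≤ G ^ 2 / (4 * (latN m : ℝ) ^ 2)
          * (2 * (oscW (latPt i - latPt j) ^ 2 + oscW (latPt i + latPt j) ^ 2)) := by
          gcongr
          nlinarith [sq_nonneg (oscW (latPt i - latPt j) - oscW (latPt i + latPt j))]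
      _ = _ := by field_simp; norm_num
  have hrow : ∀ v ∈ latticeSet m,
      ∑ w ∈ latticeSet m, (oscW (v - w) ^ 2 + oscW (v + w) ^ 2) ≤ 2 * T := fun v hv => by
    rw [Finset.sum_add_distrib]
    linarith [sum_oscW_sub_sq_le hm hv, sum_oscW_add_sq_le hm hv]
  have hidx : ∀ F : ℤ × ℤ → ℝ, ∑ i : latIdx m, F (latPt i) = 2 * ∑ v ∈ latticeSet m, F v := by
    intro F
    rw [sum_latIdx (fun v _ => F v), Finset.sum_add_distrib, two_mul]
  calc ∑ i, ∑ j, gramU (arcU m x y) (arcσ m) L a i j ^ 2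
      ≤ ∑ i : latIdx m, ∑ j : latIdx m, G ^ 2 / (2 * (latN m : ℝ) ^ 2)
        * (oscW (latPt i - latPt j) ^ 2 + oscW (latPt i + latPt j) ^ 2) :=
        Finset.sum_le_sum fun i _ => Finset.sum_le_sum fun j _ => hle i j
    _ = G ^ 2 / (2 * (latN m : ℝ) ^ 2) * (2 * ∑ v ∈ latticeSet m,
          (2 * ∑ w ∈ latticeSet m, (oscW (v - w) ^ 2 + oscW (v + w) ^ 2))) := by
        simp only [← Finset.mul_sum]
        rw [hidx fun v => ∑ j : latIdx m, (oscW (v - latPt j) ^ 2 + oscW (v + latPt j) ^ 2)]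
        simp only [fun v => hidx fun w => oscW (v - w) ^ 2 + oscW (v + w) ^ 2]
        rw [← Finset.mul_sum]
    _ ≤ G ^ 2 / (2 * (latN m : ℝ) ^ 2) * (2 * ∑ v ∈ latticeSet m, (2 * (2 * T))) := by
        gcongr with v hv
        exact hrow v hv
    _ = corrC L c M / latN m := by
        rw [Finset.sum_const, nsmul_eq_mul, ← latN, corrC]
        field_simp
        ring

/-- The variance bound for arcs. -/
lemma IsArc.variance_le {x y : ℝ → ℝ} {L c M : ℝ} (h : IsArc x y L c M) :
    ∃ C > 0, ∀ m : ℕ, 0 < m → (0 : ℝ) < latN m →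
      variance (fun ω => (Set.ncard {t | t ∈ Set.Icc 0 L ∧ proc (arcU m x y) 0 t ω = 0} : ℝ))
        (stdG (latIdx m)) ≤ C * m / latN m := by
  set B : ℝ := 2 * (720 * (2 * M) ^ 6) with hB
  have hM := h.one_le_M
  have hV : 0 ≤ varC B L := by
    have := covC_nonneg
    unfold varC
    positivity
  have hT : 0 ≤ ∑' k, latMajor k := tsum_nonneg latMajor_nonneg
  have hC : 0 ≤ corrC L c M := by unfold corrC; positivity
  refine ⟨8 * π ^ 2 * varC B L * corrC L c M + 1, by positivity, fun m hm hN => ?_⟩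
  have hp := isProc_arcU hm hN h.smooth_x h.smooth_y hM h.bound_x h.bound_y h.unit h.orth
  refine (variance_ncard_zeros_le hp (by positivity) h.L_pos (one_le_arcσ hm)).trans ?_
  have hI := integral_integral_corrSq_le hp.smooth (arcσ m) L (sum_gramU_sq_le hm hN h)
  calc _ ≤ varC B L * arcσ m ^ 2 * (4 * (corrC L c M / latN m)) := by gcongr
    _ = (8 * π ^ 2 * varC B L * corrC L c M) * m / latN m := by rw [arcσ_sq]; ring
    _ ≤ _ := by gcongr; linarith

/-- A smooth unit-speed curve with nonvanishing curvature is an arc with suitable constants. -/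
lemma exists_isArc {γ : ℝ → ℝ × ℝ} {L : ℝ} (hL : 0 < L) (hγ : ContDiff ℝ (⊤ : ℕ∞) γ)
    (hunit : ∀ t ∈ Set.Icc 0 L, (deriv γ t).1 ^ 2 + (deriv γ t).2 ^ 2 = 1)
    (hcurv : ∀ t ∈ Set.Icc 0 L, deriv (deriv γ) t ≠ 0) :
    ∃ c M : ℝ, IsArc (fun t => (γ t).1) (fun t => (γ t).2) L c M := by
  have hfst : ∀ {g : ℝ → ℝ × ℝ}, ContDiff ℝ (⊤ : ℕ∞) g → ∀ t,
      (deriv g t).1 = deriv (fun t => (g t).1) t := fun hg t =>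
    (hasFDerivAt_fst.comp_hasDerivAt t (hg.differentiable (by simp) t).hasDerivAt).deriv.symm
  have hsnd : ∀ {g : ℝ → ℝ × ℝ}, ContDiff ℝ (⊤ : ℕ∞) g → ∀ t,
      (deriv g t).2 = deriv (fun t => (g t).2) t := fun hg t =>
    (hasFDerivAt_snd.comp_hasDerivAt t (hg.differentiable (by simp) t).hasDerivAt).deriv.symm
  have hγ' : ContDiff ℝ (⊤ : ℕ∞) (deriv γ) := (contDiff_infty_iff_deriv.1 hγ).2
  set x := fun t => (γ t).1 with hxdef
  set y := fun t => (γ t).2 with hydef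
  have hx : ContDiff ℝ (⊤ : ℕ∞) x := contDiff_fst.comp hγ
  have hy : ContDiff ℝ (⊤ : ℕ∞) y := contDiff_snd.comp hγ
  have hx1 := contDiff_deriv_top hx
  have hy1 := contDiff_deriv_top hy
  have hx2 := contDiff_deriv_top hx1
  have hy2 := contDiff_deriv_top hy1
  have e1 : (fun t => (deriv γ t).1) = deriv x := funext fun t => hfst hγ t
  have e2 : (fun t => (deriv γ t).2) = deriv y := funext fun t => hsnd hγ t
  have e3 : ∀ t, (deriv (deriv γ) t).1 = deriv (deriv x) t := fun t => by rw [hfst hγ', e1]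
  have e4 : ∀ t, (deriv (deriv γ) t).2 = deriv (deriv y) t := fun t => by rw [hsnd hγ', e2]
  have hunit' : ∀ t ∈ Set.Icc 0 L, deriv x t ^ 2 + deriv y t ^ 2 = 1 := fun t ht => by
    rw [← e1, ← e2]; exact hunit t ht
  have horth : ∀ t ∈ Set.Icc 0 L,
      deriv x t * deriv (deriv x) t + deriv y t * deriv (deriv y) t = 0 := by
    have hcont : Continuous fun t => deriv x t * deriv (deriv x) t
        + deriv y t * deriv (deriv y) t :=
      (hx1.continuous.mul hx2.continuous).add (hy1.continuous.mul hy2.continuous)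
    have hopen : Set.Ioo 0 L ⊆ {t | deriv x t * deriv (deriv x) t
        + deriv y t * deriv (deriv y) t = 0} := by
      intro t ht
      have hd := ((hasDerivAt_deriv_of_contDiff hx1 t).pow 2).add
        ((hasDerivAt_deriv_of_contDiff hy1 t).pow 2)
      have hev : (deriv x ^ 2 + deriv y ^ 2) =ᶠ[nhds t] fun _ => (1 : ℝ) := by
        filter_upwards [Icc_mem_nhds ht.1 ht.2] with s hs
        exact hunit' s hs
      have h0 := (hd.congr_of_eventuallyEq hev.symm).unique (hasDerivAt_const t (1 : ℝ))
      simp only [Nat.cast_ofNat, Nat.add_one_sub_one, pow_one] at h0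
      rw [Set.mem_ofPred_eq]
      linarith
    have hcl := closure_minimal hopen (isClosed_eq hcont continuous_const)
    rw [closure_Ioo hL.ne] at hcl
    exact fun t ht => hcl ht
  have hcc : ContinuousOn (fun t => deriv (deriv x) t ^ 2 + deriv (deriv y) t ^ 2)
      (Set.Icc 0 L) :=
    ((hx2.continuous.pow 2).add (hy2.continuous.pow 2)).continuousOn
  obtain ⟨t₀, ht₀, hmin⟩ := isCompact_Icc.exists_isMinOn ⟨0, Set.left_mem_Icc.2 hL.le⟩ hcc
  have hpos : 0 < deriv (deriv x) t₀ ^ 2 + deriv (deriv y) t₀ ^ 2 := by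
    by_contra hcon
    have f1 : deriv (deriv x) t₀ = 0 := by
      have : deriv (deriv x) t₀ ^ 2 = 0 := by
        nlinarith [sq_nonneg (deriv (deriv x) t₀), sq_nonneg (deriv (deriv y) t₀)]
      simpa using this
    have f2 : deriv (deriv y) t₀ = 0 := by
      have : deriv (deriv y) t₀ ^ 2 = 0 := by
        nlinarith [sq_nonneg (deriv (deriv x) t₀), sq_nonneg (deriv (deriv y) t₀)]
      simpa using this
    exact hcurv t₀ ht₀ (Prod.ext (by rw [e3, f1]; rfl) (by rw [e4, f2]; rfl))
  have hbound : ∀ {z : ℝ → ℝ}, ContDiff ℝ (⊤ : ℕ∞) z →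
      ∃ M, ∀ j ≤ 6, ∀ t ∈ Set.Icc 0 L, |iteratedDeriv j z t| ≤ M := by
    intro z hz
    have h1 : ∀ j : ℕ, ∃ M, ∀ t ∈ Set.Icc 0 L, |iteratedDeriv j z t| ≤ M := fun j =>
      isCompact_Icc.exists_bound_of_continuousOn
        (hz.continuous_iteratedDeriv j (by exact_mod_cast le_top)).continuousOn
    choose M hM using h1
    refine ⟨∑ j ∈ Finset.range 7, |M j|, fun j hj t ht => ?_⟩
    refine ((hM j t ht).trans (le_abs_self _)).trans ?_
    exact Finset.single_le_sum (f := fun j => |M j|) (fun _ _ => abs_nonneg _)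
      (Finset.mem_range.2 (by omega))
  obtain ⟨M₁, hM₁⟩ := hbound hx
  obtain ⟨M₂, hM₂⟩ := hbound hy
  set q := deriv (deriv x) t₀ ^ 2 + deriv (deriv y) t₀ ^ 2 with hq
  refine ⟨min 1 q, max 1 (max M₁ M₂), hx, hy, hL, lt_min one_pos hpos, min_le_left _ _,
    le_max_left _ _, fun j hj t ht => (hM₁ j hj t ht).trans (by simp),
    fun j hj t ht => (hM₂ j hj t ht).trans (by simp), hunit', horth, fun t ht => ?_⟩
  have hm := hmin ht
  have h0 : 0 < min 1 q := lt_min one_pos hpos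
  calc (min 1 q) ^ 2 = min 1 q * min 1 q := sq _
    _ ≤ 1 * q := mul_le_mul (min_le_left _ _) (min_le_right _ _) h0.le one_pos.le
    _ = q := one_mul q
    _ ≤ _ := hm

/-- Variance bound: `Var(Z) ≤ C·m/N` whenever `|τ̂_m(4)| ≤ 1 − ε₀`. -/
theorem nodal_intersections_variance_bound
    (L : ℝ) (hL : 0 < L) (γ : ℝ → ℝ × ℝ) (hγ : ContDiff ℝ (⊤ : ℕ∞) γ)
    (hunit : ∀ t ∈ Set.Icc (0:ℝ) L, (deriv γ t).1 ^ 2 + (deriv γ t).2 ^ 2 = 1)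
    (hcurv : ∀ t ∈ Set.Icc (0:ℝ) L, deriv (deriv γ) t ≠ 0) :
    ∀ ε₀ ∈ Set.Ioo (0:ℝ) 1, ∃ C > 0, ∀ m : ℕ, 0 < m →
      (∃ a b : ℤ, a ^ 2 + b ^ 2 = (m : ℤ)) →
      |tauHat4 m| ≤ 1 - ε₀ →
      variance (fun ω => (nodalCount m γ L ω : ℝ)) (waveMeasure m)
        ≤ C * m / latN m := by
  intro ε₀ _
  obtain ⟨c, M, h⟩ := exists_isArc hL hγ hunit hcurv
  obtain ⟨C, hC, hV⟩ := h.variance_le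
  refine ⟨C, hC, fun m hm hab _ => ?_⟩
  rw [variance_nodalCount_eq]
  exact hV m hm (latN_pos hab)

end
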